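/- Let n ≥ 2 and p ≥ 1, and let conjugacy classes c_1,…,c_{p+1} ⊂ gl(n,ℂ) be given, where c_1 has n distinct eigenvalues and tr(B_1) + ⋯ + tr(B_{p+1}) = 0. Then there exists a tuple (A_1,…,A_{p+1}) with A_j ∈ c_j, A_1 + ⋯ + A_{p+1} = 0 and trivial centralizer if and only if conditions (α_n) and (β_n) hold. -/

import Mathlib

open Polynomial BigOperators

noncomputable def rk {n : ℕ} (Y : Matrix (Fin n) (Fin n) ℂ) : ℕ :=
  ⨅ μ : ℂ, (Y - μ • (1 : Matrix (Fin n) (Fin n) ℂ)).rank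

/-- The submodule of matrices commuting with `Y`. -/
noncomputable def centSub {n : ℕ} (Y : Matrix (Fin n) (Fin n) ℂ) : Submodule ℂ (Matrix (Fin n) (Fin n) ℂ) where
  carrier := {Z | Y * Z = Z * Y}
  add_mem' := by
    intro a b ha hb
    simp only [Set.mem_setOf_eq] at *
    rw [Matrix.mul_add, Matrix.add_mul, ha, hb]
  zero_mem' := by simp
  smul_mem' := by
    intro c a ha
    simp only [Set.mem_setOf_eq] at *
    rw [Matrix.mul_smul, Matrix.smul_mul, ha]

/-- `d(Y) = n² - dim of centralizer of Y`, the dimension of the conjugacy class. -/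
noncomputable def dd {n : ℕ} (Y : Matrix (Fin n) (Fin n) ℂ) : ℕ :=
  n ^ 2 - Module.finrank ℂ (centSub Y)

def SameClass {n : ℕ} (A B : Matrix (Fin n) (Fin n) ℂ) : Prop :=
  ∃ S : Matrix (Fin n) (Fin n) ℂ, IsUnit S ∧ A = S * B * S⁻¹

def IrreducibleTuple {n q : ℕ} (A : Fin q → Matrix (Fin n) (Fin n) ℂ) : Prop :=
  ∀ W : Submodule ℂ (Fin n → ℂ), (∀ j, ∀ v ∈ W, (A j).mulVec v ∈ W) → W = ⊥ ∨ W = ⊤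

def TrivialCentralizer {n q : ℕ} (A : Fin q → Matrix (Fin n) (Fin n) ℂ) : Prop :=
  ∀ Z : Matrix (Fin n) (Fin n) ℂ, (∀ j, Z * A j = A j * Z) →
    ∃ c : ℂ, Z = c • (1 : Matrix (Fin n) (Fin n) ℂ)

def HasDistinctEigenvalues {n : ℕ} (Y : Matrix (Fin n) (Fin n) ℂ) : Prop :=
  ∃ μ : Fin n → ℂ, Function.Injective μ ∧ Y.charpoly = ∏ k, (Polynomial.X - Polynomial.C (μ k))

def IsDiagble {n : ℕ} (Y : Matrix (Fin n) (Fin n) ℂ) : Prop :=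
  ∃ S : Matrix (Fin n) (Fin n) ℂ, IsUnit S ∧ ∃ d : Fin n → ℂ, Y = S * Matrix.diagonal d * S⁻¹

noncomputable def multOf {n : ℕ} (Y : Matrix (Fin n) (Fin n) ℂ) (μ : ℂ) : ℕ :=
  Module.finrank ℂ (LinearMap.ker (Y - μ • (1 : Matrix (Fin n) (Fin n) ℂ)).mulVecLin)

/-- The Sylvester map `X ↦ P X - X R`. -/
noncomputable def sylv {l m : ℕ} (P : Matrix (Fin l) (Fin l) ℂ) (R : Matrix (Fin m) (Fin m) ℂ) :
    Matrix (Fin l) (Fin m) ℂ →ₗ[ℂ] Matrix (Fin l) (Fin m) ℂ where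
  toFun Z := P * Z - Z * R
  map_add' Z W := by
    show P * (Z + W) - (Z + W) * R = (P * Z - Z * R) + (P * W - W * R)
    rw [Matrix.mul_add, Matrix.add_mul]; abel
  map_smul' c Z := by
    show P * (c • Z) - (c • Z) * R = c • (P * Z - Z * R)
    rw [Matrix.mul_smul, Matrix.smul_mul, smul_sub]

noncomputable def sDim {l m : ℕ} (P : Matrix (Fin l) (Fin l) ℂ) (R : Matrix (Fin m) (Fin m) ℂ) : ℕ :=
  Module.finrank ℂ (LinearMap.range (sylv P R))

set_option linter.all false

section P1
variable {V W : Type} [AddCommGroup V] [Module ℂ V] [AddCommGroup W] [Module ℂ W]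

def Eig {V : Type} [AddCommGroup V] [Module ℂ V] (T : V →ₗ[ℂ] V) (μ : ℂ) : Prop :=
  ∃ x : V, x ≠ 0 ∧ T x = μ • x

noncomputable def sh {V : Type} [AddCommGroup V] [Module ℂ V] (T : V →ₗ[ℂ] V) (μ : ℂ) : V →ₗ[ℂ] V :=
  T - μ • LinearMap.id

noncomputable def KD {V : Type} [AddCommGroup V] [Module ℂ V] (T : V →ₗ[ℂ] V) (μ : ℂ) : ℕ :=
  Module.finrank ℂ (LinearMap.ker (sh T μ))

lemma shift_apply (T : V →ₗ[ℂ] V) (μ : ℂ) (x : V) :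
    (sh T μ) x = T x - μ • x := by simp [sh]

lemma not_eig_inj (T : V →ₗ[ℂ] V) (μ : ℂ) (h : ¬ Eig T μ) :
    Function.Injective (sh T μ) := by
  rw [← LinearMap.ker_eq_bot, LinearMap.ker_eq_bot']
  intro x hx
  by_contra h0
  exact h ⟨x, h0, by rw [shift_apply] at hx; exact sub_eq_zero.mp hx⟩

lemma not_eig_surj [FiniteDimensional ℂ V] (T : V →ₗ[ℂ] V) (μ : ℂ) (h : ¬ Eig T μ) :
    Function.Surjective (sh T μ) :=
  LinearMap.injective_iff_surjective.mp (not_eig_inj T μ h)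

lemma eig_not_surj [FiniteDimensional ℂ V] (T : V →ₗ[ℂ] V) (μ : ℂ) (h : Eig T μ) :
    ¬ Function.Surjective (sh T μ) := by
  intro hs
  have hi := LinearMap.injective_iff_surjective.mpr hs
  obtain ⟨x, h0, hx⟩ := h
  exact h0 (hi (by rw [shift_apply, hx, sub_self, map_zero]))

lemma eig_of_not_surj [FiniteDimensional ℂ V] (T : V →ₗ[ℂ] V) (μ : ℂ) 
    (h : ¬ Function.Surjective (sh T μ)) : Eig T μ := by
  by_contra hc
  exact h (not_eig_surj T μ hc)

lemma eig_quot [FiniteDimensional ℂ V] [FiniteDimensional ℂ W] (T : V →ₗ[ℂ] V) (T' : W →ₗ[ℂ] W)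
    (q : V →ₗ[ℂ] W) (hq : Function.Surjective q) (h : ∀ x, q (T x) = T' (q x)) (μ : ℂ)
    (he : Eig T' μ) : Eig T μ := by
  apply eig_of_not_surj
  intro hs
  apply eig_not_surj T' μ he
  intro w
  obtain ⟨v, rfl⟩ := hq w
  obtain ⟨u, rfl⟩ := hs v
  exact ⟨q u, by rw [shift_apply, shift_apply, map_sub, map_smul, h]⟩

lemma eig_sub (T : V →ₗ[ℂ] V) (T' : W →ₗ[ℂ] W)
    (i : W →ₗ[ℂ] V) (hi : Function.Injective i) (h : ∀ x, T (i x) = i (T' x)) (μ : ℂ)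
    (he : Eig T' μ) : Eig T μ := by
  obtain ⟨x, h0, hx⟩ := he
  refine ⟨i x, fun hc => h0 (hi (by rw [hc, map_zero])), by rw [h, hx, map_smul]⟩

lemma eig_iff_hasEig (T : V →ₗ[ℂ] V) (μ : ℂ) : Eig T μ ↔ Module.End.HasEigenvalue T μ := by
  constructor
  · rintro ⟨x, h0, hx⟩
    exact Module.End.hasEigenvalue_of_hasEigenvector
      (Module.End.hasEigenvector_iff.mpr ⟨Module.End.mem_eigenspace_iff.mpr hx, h0⟩)
  · intro h
    obtain ⟨x, hx⟩ := h.exists_hasEigenvector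
    exact ⟨x, hx.2, hx.apply_eq_smul⟩

lemma exists_eig [FiniteDimensional ℂ V] [Nontrivial V] (T : V →ₗ[ℂ] V) : ∃ μ, Eig T μ := by
  obtain ⟨c, hc⟩ := Module.End.exists_eigenvalue T
  exact ⟨c, (eig_iff_hasEig T c).mpr hc⟩

lemma eig_finite [FiniteDimensional ℂ V] (T : V →ₗ[ℂ] V) : {μ | Eig T μ}.Finite := by
  have := Module.End.finite_hasEigenvalue T
  apply this.subset
  intro μ h
  exact (eig_iff_hasEig T μ).mp h

lemma exists_notMem (s : Set ℂ) (h : s.Finite) : ∃ z, z ∉ s := by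
  exact h.infinite_compl.nonempty

/-- Sylvester: no common eigenvalue, `U R = R V` gives `R = 0`. -/
lemma syl [FiniteDimensional ℂ V] [FiniteDimensional ℂ W] (U : V →ₗ[ℂ] V) (T : W →ₗ[ℂ] W)
    (R : W →ₗ[ℂ] V) (h : ∀ x, U (R x) = R (T x)) (hd : ∀ μ, ¬ (Eig U μ ∧ Eig T μ)) : 
    ∀ x, R x = 0 := by
  by_contra hc
  push Not at hc
  obtain ⟨x, hx⟩ := hc
  -- U restricted to range R
  have hU : ∀ v ∈ LinearMap.range R, U v ∈ LinearMap.range R := by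
    rintro _ ⟨w, rfl⟩
    exact ⟨T w, (h w).symm⟩
  have : Nontrivial (LinearMap.range R) := ⟨⟨R x, x, rfl⟩, 0, fun hh => hx (by simpa using congrArg Subtype.val hh)⟩
  obtain ⟨μ, hμ⟩ := exists_eig (U.restrict hU)
  have h1 : Eig U μ := eig_sub U (U.restrict hU) (LinearMap.range R).subtype
    (Submodule.injective_subtype _) (fun x => rfl) μ hμ
  have h2 : Eig T μ := eig_quot T (U.restrict hU) R.rangeRestrict (LinearMap.surjective_rangeRestrict R)
    (fun x => Subtype.ext (h x).symm) μ hμ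
  exact hd μ ⟨h1, h2⟩

end P1

set_option linter.unusedSimpArgs false
section P2
variable {V W L : Type} [AddCommGroup V] [Module ℂ V] [AddCommGroup W] [Module ℂ W]
  [AddCommGroup L] [Module ℂ L]

def IsSc {V : Type} [AddCommGroup V] [Module ℂ V] (T : V →ₗ[ℂ] V) : Prop :=
  ∃ c : ℂ, ∀ x, T x = c • x

def Hautus {V L : Type} [AddCommGroup V] [Module ℂ V] [AddCommGroup L] [Module ℂ L]
    (F : V →ₗ[ℂ] V) (G : L →ₗ[ℂ] V) : Prop :=
  ∀ μ : ℂ, ∀ y, ∃ z l, F z - μ • z + G l = y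

lemma exists_dual_one (y : V) (hy : y ≠ 0) : ∃ θ : V →ₗ[ℂ] ℂ, θ y = 1 := by
  obtain ⟨θ, hθ⟩ := LinearMap.exists_leftInverse_of_injective (LinearMap.toSpanSingleton ℂ V y)
    (LinearMap.ker_toSpanSingleton ℂ (by exact hy))
  refine ⟨θ, ?_⟩
  have := LinearMap.congr_fun hθ 1
  simpa using this

lemma finrank_quot_span [FiniteDimensional ℂ V] (y : V) (hy : y ≠ 0) (e : ℕ)
    (he : Module.finrank ℂ V = e + 1) : Module.finrank ℂ (V ⧸ Submodule.span ℂ {y}) = e := by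
  have h1 := Submodule.finrank_quotient_add_finrank (Submodule.span ℂ {y})
  rw [finrank_span_singleton hy] at h1
  omega

lemma exists_pp_vec [FiniteDimensional ℂ V] [Nontrivial V] (F : V →ₗ[ℂ] V) (G : L →ₗ[ℂ] V)
    (hH : Hautus F G) (w : ℂ) : ∃ y k, y ≠ 0 ∧ F y - w • y = G k := by
  by_cases h : Eig F w
  · obtain ⟨y, h0, hy⟩ := h
    exact ⟨y, 0, h0, by rw [hy, sub_self, map_zero]⟩
  · have hG : ∃ k, G k ≠ 0 := by
      by_contra hc
      push Not at hc
      obtain ⟨μ, hμ⟩ := exists_eig F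
      apply eig_not_surj F μ hμ
      intro y
      obtain ⟨z, l, hz⟩ := hH μ y
      exact ⟨z, by rw [shift_apply, ← hz, hc, add_zero]⟩
    obtain ⟨k, hk⟩ := hG
    obtain ⟨y, hy⟩ := not_eig_surj F w h (G k)
    refine ⟨y, k, fun h0 => hk ?_, by rw [← hy, shift_apply]⟩
    rw [← hy, h0, map_zero]

/-- pole placement -/
lemma pp : ∀ (e : ℕ) (V : Type) [AddCommGroup V] [Module ℂ V] [FiniteDimensional ℂ V]
    (F : V →ₗ[ℂ] V) (G : L →ₗ[ℂ] V) (_ : Module.finrank ℂ V = e) (_ : Hautus F G) (w : Fin e → ℂ),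
    ∃ H : V →ₗ[ℂ] L, ∀ i, Eig (F - G ∘ₗ H) (w i) := by
  intro e
  induction e with
  | zero => intro V _ _ _ F G _ _ w; exact ⟨0, fun i => i.elim0⟩
  | succ e ih =>
    intro V _ _ _ F G he hH w
    have : Nontrivial V := Module.nontrivial_of_finrank_pos (R := ℂ) (by omega)
    obtain ⟨y, k, h0, hy⟩ := exists_pp_vec F G hH (w 0)
    obtain ⟨θ, hθ⟩ := exists_dual_one y h0
    set F1 : V →ₗ[ℂ] V := F - G ∘ₗ (θ.smulRight k) with hF1
    have hF1y : F1 y = w 0 • y := by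
      simp only [hF1, LinearMap.sub_apply, LinearMap.comp_apply, LinearMap.smulRight_apply, hθ, one_smul]
      rw [← hy]; abel
    set S := Submodule.span ℂ {y} with hS
    have hinv : S ≤ S.comap F1 := by
      rw [hS, Submodule.span_singleton_le_iff_mem, Submodule.mem_comap, hF1y]
      exact Submodule.smul_mem _ _ (Submodule.mem_span_singleton_self y)
    obtain ⟨H', hH'⟩ := ih (V ⧸ S) (S.mapQ S F1 hinv) (S.mkQ ∘ₗ G) (finrank_quot_span y h0 e he)
      (by
        intro μ y'
        obtain ⟨v, rfl⟩ := Submodule.mkQ_surjective S y'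
        obtain ⟨z, l, hz⟩ := hH μ v
        refine ⟨S.mkQ z, l + θ z • k, ?_⟩
        rw [← hz]
        simp only [Submodule.mkQ_apply, Submodule.mapQ_apply, LinearMap.comp_apply]
        rw [← Submodule.Quotient.mk_smul, ← Submodule.Quotient.mk_sub, ← Submodule.Quotient.mk_add]
        congr 1
        simp only [hF1, LinearMap.sub_apply, LinearMap.comp_apply, LinearMap.smulRight_apply, map_add]
        abel) (fun i => w i.succ)
    refine ⟨θ.smulRight k + H' ∘ₗ S.mkQ, ?_⟩
    intro i
    refine Fin.cases ?_ (fun i => ?_) i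
    · refine ⟨y, h0, ?_⟩
      have : S.mkQ y = 0 := by simp [hS, Submodule.mem_span_singleton_self]
      rw [← hF1y]
      simp only [hF1, LinearMap.sub_apply, LinearMap.add_apply, LinearMap.comp_apply, this, map_zero, add_zero]
    · apply eig_quot _ _ S.mkQ (Submodule.mkQ_surjective S) _ _ (hH' i)
      intro x
      simp only [hF1, LinearMap.sub_apply, LinearMap.comp_apply, LinearMap.smulRight_apply, map_add,
        map_sub, LinearMap.add_apply, Submodule.mkQ_apply, Submodule.mapQ_apply,
        Submodule.Quotient.mk_sub]
      abel

lemma hautus_fb (F : V →ₗ[ℂ] V) (G : L →ₗ[ℂ] V) (H : V →ₗ[ℂ] L) (h : Hautus F G) :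
    Hautus (F - G ∘ₗ H) G := by
  intro μ y
  obtain ⟨z, l, hz⟩ := h μ y
  refine ⟨z, l + H z, ?_⟩
  rw [← hz]
  simp only [LinearMap.sub_apply, LinearMap.comp_apply, map_add]
  abel

lemma exists_left_eig [FiniteDimensional ℂ V] (T : V →ₗ[ℂ] V) (μ : ℂ) (h : Eig T μ) :
    ∃ η : V →ₗ[ℂ] ℂ, η ≠ 0 ∧ ∀ x, η (T x) = μ * η x := by
  have h1 := eig_not_surj T μ h
  rw [← LinearMap.range_eq_top] at h1
  obtain ⟨η, h0, hη⟩ := Submodule.exists_le_ker_of_lt_top _ (lt_top_iff_ne_top.mpr h1)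
  refine ⟨η, h0, fun x => ?_⟩
  have := hη ⟨x, rfl⟩
  rw [LinearMap.mem_ker, shift_apply, map_sub, map_smul, sub_eq_zero] at this
  simpa using this

lemma eig_of_left [FiniteDimensional ℂ V] (T : V →ₗ[ℂ] V) (μ : ℂ) (η : V →ₗ[ℂ] ℂ) (h0 : η ≠ 0)
    (h : ∀ x, η (T x) = μ * η x) : Eig T μ := by
  apply eig_of_not_surj
  intro hs
  apply h0
  ext v
  obtain ⟨u, rfl⟩ := hs v
  rw [shift_apply, map_sub, map_smul, h]; simp

lemma exists_ker_ne [FiniteDimensional ℂ L] (hL : 2 ≤ Module.finrank ℂ L) (φ : L →ₗ[ℂ] ℂ) :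
    ∃ k, k ≠ 0 ∧ φ k = 0 := by
  have h : 0 < Module.finrank ℂ (LinearMap.ker φ) := by
    have h1 := LinearMap.finrank_range_add_finrank_ker φ
    have h2 := Submodule.finrank_le (LinearMap.range φ)
    rw [Module.finrank_self] at h2
    omega
  have := Module.nontrivial_of_finrank_pos h
  obtain ⟨k, hk⟩ := exists_ne (0 : LinearMap.ker φ)
  exact ⟨k, fun h => hk (Subtype.ext h), k.2⟩

lemma pp_nonsc [FiniteDimensional ℂ V] [FiniteDimensional ℂ L] (e : ℕ) (F : V →ₗ[ℂ] V) (G : L →ₗ[ℂ] V)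
    (he : Module.finrank ℂ V = e) (hH : Hautus F G) (w : Fin e → ℂ) (hw : Function.Injective w)
    (he1 : 0 < e) (hL : 2 ≤ Module.finrank ℂ L) (K : L →ₗ[ℂ] L) :
    ∃ H : V →ₗ[ℂ] L, (∀ i, Eig (F - G ∘ₗ H) (w i)) ∧ ¬ IsSc (K + H ∘ₗ G) := by
  obtain ⟨H, h⟩ := pp e V F G he hH w
  by_cases hs : IsSc (K + H ∘ₗ G)
  swap
  · exact ⟨H, h, hs⟩
  obtain ⟨c, hc⟩ := hs
  obtain ⟨η, h0, hη⟩ := exists_left_eig _ _ (h ⟨0, he1⟩)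
  set w0 := w ⟨0, he1⟩
  obtain ⟨k, hk0, hk⟩ := exists_ker_ne hL (η ∘ₗ G)
  have hη2 : ∀ x, η ((F - G ∘ₗ (H + η.smulRight k)) x) = w0 * η x := by
    intro x
    rw [← hη]
    simp only [LinearMap.sub_apply, LinearMap.comp_apply, LinearMap.smulRight_apply, map_add,
        map_sub, LinearMap.add_apply, map_smul] at hk ⊢
    rw [hk]; simp
  refine ⟨H + η.smulRight k, ?_, ?_⟩
  · intro i
    by_cases hi : i = ⟨0, he1⟩
    · subst hi
      exact eig_of_left _ _ η h0 hη2
    · obtain ⟨x, hx0, hx⟩ := h i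
      refine ⟨x, hx0, ?_⟩
      have h1 := hη x
      rw [hx, map_smul, smul_eq_mul] at h1
      have h2 : η x = 0 := by
        by_contra hne
        exact hi (hw (mul_right_cancel₀ hne h1))
      rw [← hx]
      simp [LinearMap.comp_apply, h2]
  · rintro ⟨c', hc'⟩
    have key : ∀ l, (c' - c) • l = η (G l) • k := by
      intro l
      have h1 := hc l
      have h2 := hc' l
      simp only [LinearMap.add_apply, LinearMap.comp_apply, LinearMap.smulRight_apply] at h1 h2
      rw [sub_smul, ← h1, ← h2]; abel
    have h1 := key k
    simp only [LinearMap.comp_apply] at hk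
    rw [hk, zero_smul, smul_eq_zero] at h1
    have h2 := h1.resolve_right hk0
    have h3 : ∀ l, η (G l) = 0 := by
      intro l
      have := key l
      rw [h2, zero_smul] at this
      exact (smul_eq_zero.mp this.symm).resolve_right hk0
    apply h0
    ext y
    obtain ⟨z, l, rfl⟩ := hautus_fb F G H hH w0 y
    rw [map_add, map_sub, hη, h3]
    simp

lemma KD_le [FiniteDimensional ℂ V] [FiniteDimensional ℂ W] (T : V →ₗ[ℂ] V) (T' : W →ₗ[ℂ] W)
    (q : V →ₗ[ℂ] W) (h : ∀ x, q (T x) = T' (q x)) (μ : ℂ) :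
    KD T μ ≤ Module.finrank ℂ (LinearMap.ker q ⊓ LinearMap.ker (sh T μ) : Submodule ℂ V) + KD T' μ := by
  have hq : ∀ x ∈ LinearMap.ker (sh T μ), q x ∈ LinearMap.ker (sh T' μ) := by
    intro x hx
    rw [LinearMap.mem_ker, shift_apply] at hx ⊢
    rw [← h, ← map_smul, ← map_sub, hx, map_zero]
  let f := q.restrict hq
  have h1 := LinearMap.finrank_range_add_finrank_ker f
  have h2 : Module.finrank ℂ (LinearMap.range f) ≤ KD T' μ := Submodule.finrank_le _
  have h3 : Module.finrank ℂ (LinearMap.ker f) ≤ 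
      Module.finrank ℂ (LinearMap.ker q ⊓ LinearMap.ker (sh T μ) : Submodule ℂ V) := by
    rw [← Submodule.finrank_map_subtype_eq]
    apply Submodule.finrank_mono
    rintro _ ⟨x, hx, rfl⟩
    refine ⟨?_, x.2⟩
    have := congrArg Subtype.val (LinearMap.mem_ker.mp hx)
    exact this
  unfold KD
  unfold KD at h2
  omega

lemma KD_eq_coker [FiniteDimensional ℂ V] (T : V →ₗ[ℂ] V) (μ : ℂ) :
    KD T μ = Module.finrank ℂ (V ⧸ LinearMap.range (sh T μ)) := by
  have h1 := LinearMap.finrank_range_add_finrank_ker (sh T μ)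
  have h2 := Submodule.finrank_quotient_add_finrank (LinearMap.range (sh T μ))
  unfold KD; omega

noncomputable def CK {V L : Type} [AddCommGroup V] [Module ℂ V] [AddCommGroup L] [Module ℂ L]
    (F : V →ₗ[ℂ] V) (G : L →ₗ[ℂ] V) (μ : ℂ) : ℕ :=
  Module.finrank ℂ (V ⧸ (LinearMap.range (sh F μ) ⊔ LinearMap.range G))

lemma CK_zero [FiniteDimensional ℂ V] (F : V →ₗ[ℂ] V) (μ : ℂ) :
    CK F (0 : L →ₗ[ℂ] V) μ = KD F μ := by
  rw [KD_eq_coker, CK, LinearMap.range_zero, sup_bot_eq]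

/-- cokernel dimension monotone under surjections -/
lemma finrank_quot_le [FiniteDimensional ℂ V] [FiniteDimensional ℂ W] (q : V →ₗ[ℂ] W)
    (hq : Function.Surjective q) (A : Submodule ℂ V) (B : Submodule ℂ W) (h : ∀ x ∈ A, q x ∈ B) :
    Module.finrank ℂ (W ⧸ B) ≤ Module.finrank ℂ (V ⧸ A) := by
  apply LinearMap.finrank_le_finrank_of_surjective (f := A.mapQ B q h)
  intro y
  obtain ⟨w, rfl⟩ := Submodule.mkQ_surjective B y
  obtain ⟨v, rfl⟩ := hq w
  exact ⟨A.mkQ v, rfl⟩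

lemma CK_quot [FiniteDimensional ℂ V] [FiniteDimensional ℂ W] (F : V →ₗ[ℂ] V) (G : L →ₗ[ℂ] V)
    (F' : W →ₗ[ℂ] W) (G' : L →ₗ[ℂ] W) (q : V →ₗ[ℂ] W) (hq : Function.Surjective q)
    (H : V →ₗ[ℂ] L) (h1 : ∀ x, q (F x) = F' (q x) + G' (H x)) (h2 : ∀ l, q (G l) = G' l) (μ : ℂ) :
    CK F' G' μ ≤ CK F G μ := by
  apply finrank_quot_le q hq
  intro x hx
  obtain ⟨_, ⟨a, rfl⟩, _, ⟨l, rfl⟩, rfl⟩ := Submodule.mem_sup.mp hx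
  apply Submodule.mem_sup.mpr
  refine ⟨sh F' μ (q a), ⟨_, rfl⟩, G' (H a + l), ⟨_, rfl⟩, ?_⟩
  rw [map_add, map_add, h2, shift_apply, shift_apply, map_sub, map_smul, h1]
  abel

lemma ppg : ∀ (e : ℕ) (V : Type) [AddCommGroup V] [Module ℂ V] [FiniteDimensional ℂ V]
    (F : V →ₗ[ℂ] V) (G : L →ₗ[ℂ] V) (_ : Module.finrank ℂ V = e) (Sg : Set ℂ) (_ : Sg.Finite),
    ∃ H : V →ₗ[ℂ] L, ∀ μ, KD (F - G ∘ₗ H) μ ≤ max 1 (CK F G μ) ∧ 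
      (μ ∈ Sg → KD (F - G ∘ₗ H) μ ≤ CK F G μ) := by
  intro e
  induction e with
  | zero => 
    intro V _ _ _ F G he Sg _
    have : ∀ (T : V →ₗ[ℂ] V) μ, KD T μ = 0 := by
      intro T μ
      have := Submodule.finrank_le (LinearMap.ker (sh T μ))
      unfold KD; omega
    exact ⟨0, fun μ => by simp [this]⟩
  | succ e ih =>
    intro V _ _ _ F G he Sg hSg
    by_cases hG : ∃ k, G k ≠ 0
    swap
    · have : G = 0 := by
        ext k; by_contra hc; exact hG ⟨k, hc⟩
      subst this
      refine ⟨0, fun μ => ?_⟩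
      simp [CK_zero]
    obtain ⟨k, hk⟩ := hG
    obtain ⟨w, hw⟩ := exists_notMem _ (hSg.union (eig_finite F))
    have hwS : w ∉ Sg := fun h => hw (Or.inl h)
    have hwE : ¬ Eig F w := fun h => hw (Or.inr h)
    obtain ⟨y, hy⟩ := not_eig_surj F w hwE (G k)
    have h0 : y ≠ 0 := fun h => hk (by rw [← hy, h, map_zero])
    rw [shift_apply] at hy
    obtain ⟨θ, hθ⟩ := exists_dual_one y h0
    set F1 : V →ₗ[ℂ] V := F - G ∘ₗ (θ.smulRight k) with hF1
    have hF1y : F1 y = w • y := by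
      simp only [hF1, LinearMap.sub_apply, LinearMap.comp_apply, LinearMap.smulRight_apply, hθ, one_smul]
      rw [← hy]; abel
    set S := Submodule.span ℂ {y} with hS
    have hinv : S ≤ S.comap F1 := by
      rw [hS, Submodule.span_singleton_le_iff_mem, Submodule.mem_comap, hF1y]
      exact Submodule.smul_mem _ _ (Submodule.mem_span_singleton_self y)
    obtain ⟨H', hH'⟩ := ih (V ⧸ S) (S.mapQ S F1 hinv) (S.mkQ ∘ₗ G) (finrank_quot_span y h0 e he)
      (Sg ∪ {w}) (hSg.union (Set.finite_singleton w))
    have hck : ∀ μ, CK (S.mapQ S F1 hinv) (S.mkQ ∘ₗ G) μ ≤ CK F G μ := by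
      intro μ
      apply CK_quot _ _ _ _ S.mkQ (Submodule.mkQ_surjective S) (θ.smulRight k)
      · intro x
        simp only [hF1, LinearMap.sub_apply, LinearMap.comp_apply, LinearMap.smulRight_apply, map_add,
        map_sub, LinearMap.add_apply, Submodule.mkQ_apply, Submodule.mapQ_apply,
        Submodule.Quotient.mk_sub]
        abel
      · intro l; rfl
    have hckw : CK F G w = 0 := by
      unfold CK
      rw [LinearMap.range_eq_top.mpr (not_eig_surj F w hwE), top_sup_eq]
      exact Module.finrank_zero_of_subsingleton
    set H := θ.smulRight k + H' ∘ₗ S.mkQ with hHd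
    have hint : ∀ x, S.mkQ ((F - G ∘ₗ H) x) = (S.mapQ S F1 hinv - (S.mkQ ∘ₗ G) ∘ₗ H') (S.mkQ x) := by
      intro x
      simp only [hHd, hF1, LinearMap.sub_apply, LinearMap.comp_apply, LinearMap.smulRight_apply, map_add,
        map_sub, LinearMap.add_apply, Submodule.mkQ_apply, Submodule.mapQ_apply,
        Submodule.Quotient.mk_sub]
      abel
    have hyy : (F - G ∘ₗ H) y = w • y := by
      have : S.mkQ y = 0 := by simp [hS, Submodule.mem_span_singleton_self]
      rw [← hF1y]
      simp only [hF1, hHd, LinearMap.sub_apply, LinearMap.add_apply, LinearMap.comp_apply, this, map_zero, add_zero]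
    refine ⟨H, fun μ => ?_⟩
    have hkd := KD_le (F - G ∘ₗ H) _ S.mkQ hint μ
    rw [Submodule.ker_mkQ] at hkd
    by_cases hμ : μ = w
    · subst hμ
      have h1 : Module.finrank ℂ (S ⊓ LinearMap.ker (sh (F - G ∘ₗ H) μ) : Submodule ℂ V) ≤ 1 := by
        rw [← finrank_span_singleton (K := ℂ) h0]
        exact Submodule.finrank_mono inf_le_left
      have h2 := (hH' μ).2 (by simp)
      have h3 := hck μ
      refine ⟨?_, fun h => absurd h hwS⟩
      omega
    · have h1 : (S ⊓ LinearMap.ker (sh (F - G ∘ₗ H) μ) : Submodule ℂ V) = ⊥ := by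
        rw [eq_bot_iff]
        rintro x ⟨hx1, hx2⟩
        obtain ⟨c, rfl⟩ := Submodule.mem_span_singleton.mp hx1
        have hx3 := LinearMap.mem_ker.mp hx2
        rw [shift_apply, map_smul, hyy, smul_comm, ← sub_smul, smul_eq_zero, sub_eq_zero] at hx3
        rcases hx3 with h | h
        · exact absurd h.symm hμ
        · exact h
      rw [h1, finrank_bot, zero_add] at hkd
      have h3 := hck μ
      refine ⟨hkd.trans ((hH' μ).1.trans (max_le_max le_rfl h3)), fun h => 
        hkd.trans (((hH' μ).2 (Or.inl h)).trans h3)⟩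

end P2

section P3
variable {V W L : Type} [AddCommGroup V] [Module ℂ V] [AddCommGroup W] [Module ℂ W]
  [AddCommGroup L] [Module ℂ L]

lemma distinct_basis [FiniteDimensional ℂ V] (n : ℕ) (hV : Module.finrank ℂ V = n) (T : V →ₗ[ℂ] V)
    (w : Fin n → ℂ) (hw : Function.Injective w) (h : ∀ i, Eig T (w i)) :
    ∃ b : Module.Basis (Fin n) ℂ V, ∀ i, T (b i) = w i • b i := by
  choose x h0 hx using h
  have hl : LinearIndependent ℂ x := Module.End.eigenvectors_linearIndependent' T w hw x
    (fun i => Module.End.hasEigenvector_iff.mpr ⟨Module.End.mem_eigenspace_iff.mpr (hx i), h0 i⟩)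
  have hsp : ⊤ ≤ Submodule.span ℂ (Set.range x) := by
    rw [hl.span_eq_top_of_card_eq_finrank' (by simp [hV])]
  exact ⟨Module.Basis.mk hl hsp, fun i => by simp [hx]⟩

lemma distinct_eig [FiniteDimensional ℂ V] (n : ℕ) (hV : Module.finrank ℂ V = n) (T : V →ₗ[ℂ] V)
    (w : Fin n → ℂ) (hw : Function.Injective w) (h : ∀ i, Eig T (w i)) (μ : ℂ) (hμ : Eig T μ) :
    ∃ i, μ = w i := by
  obtain ⟨b, hb⟩ := distinct_basis n hV T w hw h
  obtain ⟨x, h0, hx⟩ := hμ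
  by_contra hc
  push Not at hc
  apply h0
  apply b.repr.injective
  ext i
  have h1 : b.repr (T x) i = w i * b.repr x i := by
    conv_lhs => rw [← b.sum_repr x]
    simp only [map_sum, map_smul, hb]
    rw [Finsupp.finset_sum_apply]
    rw [Finset.sum_eq_single i]
    · simp; ring
    · intro j _ hj
      simp [hj]
    · simp
  rw [hx, map_smul, Finsupp.smul_apply, smul_eq_mul] at h1
  by_contra hne
  exact hc i (mul_right_cancel₀ (by simpa using hne) h1)

lemma distinct_trace [FiniteDimensional ℂ V] (n : ℕ) (hV : Module.finrank ℂ V = n) (T : V →ₗ[ℂ] V)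
    (w : Fin n → ℂ) (hw : Function.Injective w) (h : ∀ i, Eig T (w i)) :
    LinearMap.trace ℂ V T = ∑ i, w i := by
  obtain ⟨b, hb⟩ := distinct_basis n hV T w hw h
  rw [LinearMap.trace_eq_matrix_trace ℂ b, Matrix.trace]
  apply Finset.sum_congr rfl
  intro i _
  simp [LinearMap.toMatrix_apply, hb]

lemma nonsc_vec [FiniteDimensional ℂ V] (T : V →ₗ[ℂ] V) (h : ¬ IsSc T) :
    ∃ x, LinearIndependent ℂ ![x, T x] := by
  by_contra hc
  push Not at hc
  obtain ⟨a, ha⟩ := LinearMap.exists_eq_smul_id_of_forall_notLinearIndependent hc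
  exact h ⟨a, fun x => by rw [ha]; simp⟩

/-- projection to `ker φ` along `x` -/
noncomputable def prK (x : V) (φ : V →ₗ[ℂ] ℂ) (h : φ x = 1) : V →ₗ[ℂ] LinearMap.ker φ :=
  (LinearMap.id - φ.smulRight x).codRestrict (LinearMap.ker φ) (fun v => by
    simp [LinearMap.mem_ker, h])

lemma prK_coe (x : V) (φ : V →ₗ[ℂ] ℂ) (h : φ x = 1) (v : V) :
    ((prK x φ h v : LinearMap.ker φ) : V) = v - φ v • x := rfl

lemma prK_self (x : V) (φ : V →ₗ[ℂ] ℂ) (h : φ x = 1) : prK x φ h x = 0 := by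
  apply Subtype.ext; rw [prK_coe, h]; simp

lemma prK_ker (x : V) (φ : V →ₗ[ℂ] ℂ) (h : φ x = 1) (z : LinearMap.ker φ) : prK x φ h z = z := by
  apply Subtype.ext; rw [prK_coe, LinearMap.mem_ker.mp z.2]; simp

lemma prK_dec (x : V) (φ : V →ₗ[ℂ] ℂ) (h : φ x = 1) (v : V) :
    v = φ v • x + (prK x φ h v : V) := by rw [prK_coe]; abel

lemma prK_surj (x : V) (φ : V →ₗ[ℂ] ℂ) (h : φ x = 1) : Function.Surjective (prK x φ h) :=
  fun z => ⟨z, prK_ker x φ h z⟩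

lemma prK_kerEq (x : V) (φ : V →ₗ[ℂ] ℂ) (h : φ x = 1) (v : V) (hv : prK x φ h v = 0) :
    v = φ v • x := by
  conv_lhs => rw [prK_dec x φ h v, hv]
  simp

lemma finrank_ker_phi [FiniteDimensional ℂ V] (x : V) (φ : V →ₗ[ℂ] ℂ) (h : φ x = 1) (m : ℕ)
    (hm : Module.finrank ℂ V = m + 1) : Module.finrank ℂ (LinearMap.ker φ) = m := by
  have h1 := LinearMap.finrank_range_add_finrank_ker φ
  have h2 : LinearMap.range φ = ⊤ := LinearMap.range_eq_top.mpr
    (fun c => ⟨c • x, by simp [h]⟩)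
  rw [h2, finrank_top, Module.finrank_self] at h1
  omega

lemma trace_split [FiniteDimensional ℂ V] (E : V →ₗ[ℂ] V) (x : V) (φ : V →ₗ[ℂ] ℂ) (h : φ x = 1) :
    LinearMap.trace ℂ V E = φ (E x) +
      LinearMap.trace ℂ _ (prK x φ h ∘ₗ E ∘ₗ (LinearMap.ker φ).subtype) := by
  have h1 : E = φ.smulRight (E x) + (E ∘ₗ (LinearMap.ker φ).subtype) ∘ₗ prK x φ h := by
    ext v
    conv_lhs => rw [prK_dec x φ h v]
    simp
  conv_lhs => rw [h1]
  rw [map_add, LinearMap.trace_smulRight, LinearMap.trace_comp_comm']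

lemma exists_good_phi [FiniteDimensional ℂ V] (E : V →ₗ[ℂ] V) (hE : ¬ IsSc E) (δ : ℂ) :
    ∃ (x : V) (φ : V →ₗ[ℂ] ℂ) (h : φ x = 1), E x - δ • x ≠ 0 ∧ φ (E x) = δ ∧ 
     (3 ≤ Module.finrank ℂ V → ¬ IsSc (prK x φ h ∘ₗ E ∘ₗ (LinearMap.ker φ).subtype)) := by
  obtain ⟨x, hx⟩ := nonsc_vec E hE
  rw [LinearIndependent.pair_iff] at hx
  set c := E x - δ • x with hc
  have hc0 : c ≠ 0 := by
    intro h
    have := hx (-δ) 1 (by rw [← h, hc]; module)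
    simpa using this.2
  have hxc : ∀ s t : ℂ, s • x + t • c = 0 → s = 0 ∧ t = 0 := by
    intro s t h
    have := hx (s - t * δ) t (by rw [← h, hc]; module)
    obtain ⟨h1, h2⟩ := this
    rw [h2] at h1
    exact ⟨by simpa using h1, h2⟩
  have hx1 : x ∉ Submodule.span ℂ {c} := by
    intro h
    obtain ⟨a, ha⟩ := Submodule.mem_span_singleton.mp h
    have := hxc 1 (-a) (by rw [← ha]; module)
    simpa using this.1
  obtain ⟨φ0, h0, hφ0⟩ := Submodule.exists_le_ker_of_notMem hx1
  obtain ⟨φ, hφx, hφc⟩ : ∃ φ : V →ₗ[ℂ] ℂ, φ x = 1 ∧ φ c = 0 := by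
    refine ⟨(φ0 x)⁻¹ • φ0, by simp [h0], ?_⟩
    have := hφ0 (Submodule.mem_span_singleton_self c)
    rw [LinearMap.mem_ker] at this
    simp [this]
  have hEx : E x = δ • x + c := by rw [hc]; abel
  by_cases hs : 3 ≤ Module.finrank ℂ V
  swap
  · exact ⟨x, φ, hφx, hc0, by rw [hEx]; simp [hφx, hφc], fun h => absurd h hs⟩
  have hlt : Submodule.span ℂ (Set.range ![x, c]) < ⊤ := by
    rw [lt_top_iff_ne_top]
    intro h
    have h1 := finrank_range_le_card (R := ℂ) ![x, c]
    rw [Set.finrank, h, finrank_top] at h1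
    simp at h1
    omega
  obtain ⟨ψ, hψ0, hψ⟩ := Submodule.exists_le_ker_of_lt_top _ hlt
  have hψx : ψ x = 0 := hψ (Submodule.subset_span ⟨0, rfl⟩)
  have hψc : ψ c = 0 := hψ (Submodule.subset_span ⟨1, rfl⟩)
  have hφ2x : (φ + ψ) x = 1 := by simp [hφx, hψx]
  by_cases h1 : IsSc (prK x φ hφx ∘ₗ E ∘ₗ (LinearMap.ker φ).subtype)
  swap
  · exact ⟨x, φ, hφx, hc0, by rw [hEx]; simp [hφx, hφc], fun _ => h1⟩
  by_cases h2 : IsSc (prK x (φ + ψ) hφ2x ∘ₗ E ∘ₗ (LinearMap.ker (φ + ψ)).subtype)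
  swap
  · exact ⟨x, φ + ψ, hφ2x, hc0, by rw [hEx]; simp [hφx, hφc, hψx, hψc], fun _ => h2⟩
  exfalso
  obtain ⟨g, hg⟩ := h1
  obtain ⟨g', hg'⟩ := h2
  have k1 : ∀ z, φ z = 0 → ∃ a : ℂ, E z = g • z + a • x := by
    intro z hz
    have := congrArg Subtype.val (hg ⟨z, hz⟩)
    simp only [LinearMap.comp_apply, prK_coe, Submodule.subtype_apply, Submodule.coe_smul] at this
    exact ⟨φ (E z), by rw [← this]; abel⟩
  have k2 : ∀ z, (φ + ψ) z = 0 → ∃ a : ℂ, E z = g' • z + a • x := by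
    intro z hz
    have := congrArg Subtype.val (hg' ⟨z, hz⟩)
    simp only [LinearMap.comp_apply, prK_coe, Submodule.subtype_apply, Submodule.coe_smul] at this
    exact ⟨(φ + ψ) (E z), by rw [← this]; abel⟩
  obtain ⟨a, ha⟩ := k1 c hφc
  obtain ⟨a', ha'⟩ := k2 c (by simp [hφc, hψc])
  have hgg := (hxc (a - a') (g - g') (by 
    have : g • c + a • x = g' • c + a' • x := by rw [← ha, ha']
    rw [← sub_eq_zero] at this
    rw [← this]; module)).2
  have hgg : g = g' := sub_eq_zero.mp hgg
  subst hgg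
  obtain ⟨z, hz⟩ : ∃ z, ψ z ≠ 0 := by
    by_contra hcc
    push Not at hcc
    exact hψ0 (LinearMap.ext hcc)
  obtain ⟨b, hb⟩ := k1 (z - φ z • x) (by simp [hφx])
  obtain ⟨b', hb'⟩ := k2 (z - (φ + ψ) z • x) (by simp [hφx, hψx])
  have e1 : E (ψ z • x) = g • (ψ z • x) + (b - b') • x := by
    have : ψ z • x = (z - φ z • x) - (z - (φ + ψ) z • x) := by
      simp only [LinearMap.add_apply]; module
    rw [this, map_sub, hb, hb']; module
  rw [map_smul, hEx] at e1
  have := (hxc (ψ z * δ - g * ψ z - (b - b')) (ψ z) (by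
    rw [← sub_eq_zero] at e1
    rw [← e1]; module)).2
  exact hz this

end P3

section P4
variable {V W L : Type} [AddCommGroup V] [Module ℂ V] [AddCommGroup W] [Module ℂ W]
  [AddCommGroup L] [Module ℂ L]

lemma isSc_dim1 [FiniteDimensional ℂ V] (h : Module.finrank ℂ V = 1) (T : V →ₗ[ℂ] V) : IsSc T := by
  by_contra hc
  obtain ⟨x, hx⟩ := nonsc_vec T hc
  have := hx.fintype_card_le_finrank
  simp at this
  omega

lemma trace_sc [FiniteDimensional ℂ V] (T : V →ₗ[ℂ] V) (c : ℂ) (h : ∀ x, T x = c • x) :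
    LinearMap.trace ℂ V T = Module.finrank ℂ V * c := by
  have : T = c • LinearMap.id := LinearMap.ext (fun x => by simp [h])
  rw [this, map_smul, LinearMap.trace_id]
  simp [mul_comm]

lemma fillmore : ∀ (m : ℕ) (V : Type) [AddCommGroup V] [Module ℂ V] [FiniteDimensional ℂ V]
    (E : V →ₗ[ℂ] V) (_ : Module.finrank ℂ V = m + 1) (_ : m = 0 ∨ ¬ IsSc E)
    (u v : Fin (m+1) → ℂ) (_ : Function.Injective u) (_ : Function.Injective v)
    (_ : LinearMap.trace ℂ V E = ∑ i, (u i + v i)),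
    ∃ A B : V →ₗ[ℂ] V, A + B = E ∧ (∀ i, Eig A (u i)) ∧ (∀ i, Eig B (v i)) ∧
      ∀ Z : V →ₗ[ℂ] V, (∀ x, Z (A x) = A (Z x)) → (∀ x, Z (B x) = B (Z x)) → IsSc Z := by
  intro m
  induction m with
  | zero =>
    intro V _ _ _ E hV _ u v _ _ htr
    obtain ⟨c, hc⟩ := isSc_dim1 hV E
    have : Nontrivial V := Module.nontrivial_of_finrank_pos (R := ℂ) (by omega)
    obtain ⟨x, hx⟩ := exists_ne (0 : V)
    have h1 := trace_sc E c hc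
    rw [htr, hV] at h1
    simp at h1
    refine ⟨u 0 • LinearMap.id, v 0 • LinearMap.id, ?_, ?_, ?_, ?_⟩
    · ext y; simp [hc, ← h1, add_smul]
    · intro i; fin_cases i; exact ⟨x, hx, by simp⟩
    · intro i; fin_cases i; exact ⟨x, hx, by simp⟩
    · intro Z _ _; exact isSc_dim1 hV Z
  | succ m ih =>
    intro V _ _ _ E hV hE u v hu hv htr
    have hE : ¬ IsSc E := hE.resolve_left (by omega)
    obtain ⟨x, φ, hφ, hc0, hφE, hns⟩ := exists_good_phi E hE (u 0 + v 0)
    set K := LinearMap.ker φ with hK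
    set P : V →ₗ[ℂ] K := prK x φ hφ with hP
    set E' := P ∘ₗ E ∘ₗ K.subtype with hE'
    have hfK : Module.finrank ℂ K = m + 1 := finrank_ker_phi x φ hφ (m+1) hV
    have hts := trace_split E x φ hφ
    rw [htr, hφE, Fin.sum_univ_succ] at hts
    obtain ⟨A', B', hAB, hA', hB', hZ'⟩ := ih K E' hfK 
      (by by_cases hm : m = 0
          · exact Or.inl hm
          · exact Or.inr (hns (by omega))) (fun i => u i.succ) (fun i => v i.succ) 
      (fun i j h => Fin.succ_injective _ (hu h)) (fun i j h => Fin.succ_injective _ (hv h))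
      (by linear_combination - hts)
    set c := E x - (u 0 + v 0) • x with hc
    have hφc : φ c = 0 := by rw [hc]; simp [hφE, hφ]
    have hEx : E x = (u 0 + v 0) • x + c := by rw [hc]; abel
    set A : V →ₗ[ℂ] V := φ.smulRight (u 0 • x + c) + K.subtype ∘ₗ A' ∘ₗ P with hA
    set B : V →ₗ[ℂ] V := φ.smulRight (v 0 • x) + (φ ∘ₗ E ∘ₗ K.subtype ∘ₗ P).smulRight x 
      + K.subtype ∘ₗ B' ∘ₗ P with hB
    have eA : ∀ y, A y = φ y • (u 0 • x + c) + (A' (P y) : V) := fun y => rfl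
    have eB : ∀ y, B y = φ y • (v 0 • x) + φ (E (P y)) • x + (B' (P y) : V) := fun y => rfl
    have hPK : ∀ z : K, P z = z := prK_ker x φ hφ
    have hPx : P x = 0 := prK_self x φ hφ
    have hφK : ∀ z : K, φ z = 0 := fun z => z.2
    have hPc : ∀ z, (P z : V) = z - φ z • x := prK_coe x φ hφ
    have eAz : ∀ z : K, A z = A' z := fun z => by rw [eA, hφK, hPK]; simp
    have eBz : ∀ z : K, B z = φ (E z) • x + (B' z : V) := fun z => by rw [eB, hφK, hPK]; simp
    have eBx : B x = v 0 • x := by rw [eB, hφ, hPx]; simp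
    have eAx : A x = u 0 • x + c := by rw [eA, hφ, hPx]; simp
    have hφA : ∀ y, φ (A y) = u 0 * φ y := fun y => by
      rw [eA]; simp [hφ, hφc, hφK]; ring
    have hPB : ∀ y, P (B y) = B' (P y) := fun y => by
      rw [eB]; simp [hPx, hPK]
    refine ⟨A, B, ?_, ?_, ?_, ?_⟩
    · ext y
      rw [LinearMap.add_apply, eA, eB]
      have h1 : (A' (P y) : V) + (B' (P y) : V) = E (P y) - φ (E (P y)) • x := by
        have := congrArg Subtype.val (LinearMap.congr_fun hAB (P y))
        simp only [LinearMap.add_apply, Submodule.coe_add] at this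
        rw [this, hE']
        simp only [LinearMap.comp_apply, Submodule.subtype_apply, hPc]
      have h2 : E y = φ y • E x + E (P y) := by
        conv_lhs => rw [prK_dec x φ hφ y]
        rw [map_add, map_smul]
      rw [h2, hEx]
      have h3 : E (P y) = (A' (P y) : V) + (B' (P y) : V) + φ (E (P y)) • x := by rw [h1]; abel
      rw [h3]
      simp only [map_add, map_smul, hφ, hφK, smul_eq_mul]
      module
    · intro i
      refine Fin.cases ?_ (fun i => ?_) i
      · apply eig_of_left A _ φ _ hφA
        intro h; rw [h] at hφ; simp at hφ
      · exact eig_sub A A' K.subtype (Submodule.injective_subtype _) eAz _ (hA' i)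
    · intro i
      refine Fin.cases ?_ (fun i => ?_) i
      · refine ⟨x, ?_, eBx⟩
        intro h; rw [h] at hφ; simp at hφ
      · exact eig_quot B B' P (prK_surj x φ hφ) hPB _ (hB' i)
    · intro Z hZA hZB
      have nA : ¬ Eig A' (u 0) := by
        intro h
        obtain ⟨i, hi⟩ := distinct_eig (m+1) hfK A' _ (fun i j h => Fin.succ_injective _ (hu h)) hA' _ h
        exact (Fin.succ_ne_zero i) (hu hi).symm
      have nB : ¬ Eig B' (v 0) := by
        intro h
        obtain ⟨i, hi⟩ := distinct_eig (m+1) hfK B' _ (fun i j h => Fin.succ_injective _ (hv h)) hB' _ h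
        exact (Fin.succ_ne_zero i) (hv hi).symm
      have hρ : ∀ z : K, φ (Z z) = 0 := by
        by_contra hcc
        apply nA
        apply eig_of_left A' _ (φ ∘ₗ Z ∘ₗ K.subtype)
        · intro h; exact hcc (fun z => LinearMap.congr_fun h z)
        · intro z
          simp only [LinearMap.comp_apply, Submodule.subtype_apply]
          rw [← eAz, hZA, hφA]
      have hζ : P (Z x) = 0 := by
        by_contra hcc
        exact nB ⟨P (Z x), hcc, by rw [← hPB, ← hZB, eBx, map_smul, map_smul]⟩
      have hZx := prK_kerEq x φ hφ _ hζ
      set z0 := φ (Z x)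
      have hρ' : ∀ z ∈ K, Z z ∈ K := fun z hz => LinearMap.mem_ker.mpr (hρ ⟨z, hz⟩)
      set Z' : K →ₗ[ℂ] K := Z.restrict hρ' with hZd
      have eZ : ∀ z : K, (Z' z : V) = Z z := fun z => rfl
      obtain ⟨c0, hc0'⟩ := hZ' Z'
        (by intro z; apply Subtype.ext; rw [eZ, ← eAz, hZA, ← eAz]; rfl)
        (by
          intro z
          have h1 := congrArg P (hZB z)
          rw [hPB, eBz, map_add, map_smul, hZx, map_add, map_smul, map_smul, hPx, ← eZ, ← eZ, hPK, hPK] at h1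
          simpa using h1)
      have hZK : ∀ z : K, Z z = c0 • (z : V) := fun z => congrArg Subtype.val (hc0' z)
      have hZc : Z c = c0 • c := hZK ⟨c, hφc⟩
      have h5 := hZA x
      rw [eAx, hZx, map_smul, eAx, map_add, map_smul, hZx, hZc] at h5
      have h6 : (c0 - z0) • c = 0 := by
        rw [← sub_eq_zero] at h5
        rw [← h5]; module
      have h7 := (smul_eq_zero.mp h6).resolve_right hc0
      refine ⟨c0, fun y => ?_⟩
      rw [prK_dec x φ hφ y, map_add, map_smul, hZx, ← sub_eq_zero.mp h7]
      rw [hZK]; module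

lemma KD_pos_iff [FiniteDimensional ℂ V] (T : V →ₗ[ℂ] V) (μ : ℂ) : 0 < KD T μ ↔ Eig T μ := by
  unfold KD
  rw [Module.finrank_pos_iff_exists_ne_zero]
  constructor
  · rintro ⟨⟨x, hx⟩, h0⟩
    refine ⟨x, fun h => h0 (Subtype.ext h), ?_⟩
    rw [LinearMap.mem_ker, shift_apply, sub_eq_zero] at hx
    exact hx
  · rintro ⟨x, h0, hx⟩
    exact ⟨⟨x, by rw [LinearMap.mem_ker, shift_apply, hx, sub_self]⟩, fun h => h0 (congrArg Subtype.val h)⟩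

lemma KD_ext [FiniteDimensional ℂ V] [FiniteDimensional ℂ W] (T : V →ₗ[ℂ] V) (T' : W →ₗ[ℂ] W)
    (q : V →ₗ[ℂ] W) (h : ∀ x, q (T x) = T' (q x)) (x : V) (a : ℂ) (hx : T x = a • x)
    (hq : ∀ y, q y = 0 → ∃ c : ℂ, y = c • x) (μ : ℂ) :
    KD T μ ≤ (if μ = a then 1 else 0) + KD T' μ := by
  refine (KD_le T T' q h μ).trans (Nat.add_le_add_right ?_ _)
  split_ifs with hμ
  · refine (Submodule.finrank_mono (t := Submodule.span ℂ {x}) ?_).trans (finrank_span_le_card _ |>.trans (by simp))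
    rintro y ⟨h1, _⟩
    obtain ⟨c, rfl⟩ := hq y h1
    exact Submodule.smul_mem _ _ (Submodule.mem_span_singleton_self x)
  · have : (LinearMap.ker q ⊓ LinearMap.ker (sh T μ) : Submodule ℂ V) = ⊥ := by
      rw [eq_bot_iff]
      rintro y ⟨h1, h2⟩
      obtain ⟨c, rfl⟩ := hq y h1
      have h3 := LinearMap.mem_ker.mp h2
      rw [shift_apply, map_smul, hx, smul_comm, ← sub_smul, smul_eq_zero, sub_eq_zero] at h3
      rcases h3 with h | h
      · exact absurd h.symm hμ
      · exact h
    rw [this, finrank_bot]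

lemma uvg : ∀ (m : ℕ) (V : Type) [AddCommGroup V] [Module ℂ V] [FiniteDimensional ℂ V]
    (E : V →ₗ[ℂ] V) (_ : Module.finrank ℂ V = m) (Sg : Set ℂ) (_ : Sg.Finite),
    ∃ A B : V →ₗ[ℂ] V, A + B = E ∧ (∀ μ, KD A μ ≤ 1) ∧ (∀ μ, KD B μ ≤ 1) ∧
      (∀ μ, Eig A μ → ¬ Eig B μ) ∧ (∀ μ ∈ Sg, ¬ Eig A μ ∧ ¬ Eig B μ) := by
  intro m
  induction m with
  | zero =>
    intro V _ _ _ E hV Sg _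
    have hs : Subsingleton V := Module.finrank_zero_iff.mp hV
    have : ∀ (T : V →ₗ[ℂ] V) μ, ¬ Eig T μ := by
      rintro T μ ⟨x, h0, _⟩; exact h0 (Subsingleton.elim _ _)
    have h2 : ∀ (T : V →ₗ[ℂ] V) μ, KD T μ ≤ 1 := by
      intro T μ
      have := mt (KD_pos_iff T μ).mp (this T μ)
      omega
    exact ⟨E, 0, by simp, h2 _, h2 _, fun μ h => absurd h (this _ _), fun μ _ => ⟨this _ _, this _ _⟩⟩
  | succ m ih =>
    intro V _ _ _ E hV Sg hSg
    have : Nontrivial V := Module.nontrivial_of_finrank_pos (R := ℂ) (by omega)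
    obtain ⟨δ, x, hx0, hx⟩ := exists_eig E
    obtain ⟨φ, hφ⟩ := exists_dual_one x hx0
    set K := LinearMap.ker φ with hK
    set P : V →ₗ[ℂ] K := prK x φ hφ with hP
    obtain ⟨A', B', hAB, hA', hB', hd', hs'⟩ := ih K (P ∘ₗ E ∘ₗ K.subtype) (finrank_ker_phi x φ hφ m hV) Sg hSg
    have hfin : (Sg ∪ {μ | Eig A' μ} ∪ {μ | Eig B' μ}).Finite :=
      (hSg.union (eig_finite A')).union (eig_finite B')
    obtain ⟨u, hu⟩ := exists_notMem _ ((hfin.union (hfin.image (fun z => δ - z))).union (Set.finite_singleton (δ/2)))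
    simp only [Set.mem_union, Set.mem_singleton_iff, not_or] at hu
    obtain ⟨⟨⟨⟨hu1, hu2⟩, hu3⟩, hu4⟩, hu5⟩ := hu
    have hu6 : ∀ z, z = δ - u → z ∉ (Sg ∪ {μ | Eig A' μ} ∪ {μ | Eig B' μ}) := by
      rintro z rfl hz
      exact hu4 ⟨_, hz, by simp⟩
    have hu7 := hu6 _ rfl
    simp only [Set.mem_union, Set.mem_setOf_eq, not_or] at hu7
    obtain ⟨⟨hu8, hu9⟩, hu10⟩ := hu7
    have hne : u ≠ δ - u := by
      intro h; apply hu5; rw [eq_div_iff (by norm_num)]; linear_combination h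
    set A : V →ₗ[ℂ] V := φ.smulRight (u • x) + K.subtype ∘ₗ A' ∘ₗ P with hA
    set B : V →ₗ[ℂ] V := φ.smulRight ((δ - u) • x) + (φ ∘ₗ E ∘ₗ K.subtype ∘ₗ P).smulRight x 
      + K.subtype ∘ₗ B' ∘ₗ P with hB
    have eA : ∀ y, A y = φ y • (u • x) + (A' (P y) : V) := fun y => rfl
    have eB : ∀ y, B y = φ y • ((δ - u) • x) + φ (E (P y)) • x + (B' (P y) : V) := fun y => rfl
    have hPK : ∀ z : K, P z = z := prK_ker x φ hφ
    have hPx : P x = 0 := prK_self x φ hφ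
    have hPc : ∀ z, (P z : V) = z - φ z • x := prK_coe x φ hφ
    have eBx : B x = (δ - u) • x := by rw [eB, hφ, hPx]; simp
    have eAx : A x = u • x := by rw [eA, hφ, hPx]; simp
    have hPA : ∀ y, P (A y) = A' (P y) := fun y => by
      rw [eA]; simp [hPx, hPK]
    have hPB : ∀ y, P (B y) = B' (P y) := fun y => by
      rw [eB]; simp [hPx, hPK]
    have kA := KD_ext A A' P hPA x u eAx (fun y hy => ⟨_, prK_kerEq x φ hφ y hy⟩)
    have kB := KD_ext B B' P hPB x (δ - u) eBx (fun y hy => ⟨_, prK_kerEq x φ hφ y hy⟩)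
    have sA : ∀ μ, Eig A μ → μ = u ∨ Eig A' μ := by
      intro μ h
      have h1 := kA μ
      rw [← KD_pos_iff] at h ⊢
      split_ifs at h1 with h2
      · exact Or.inl h2
      · right; omega
    have sB : ∀ μ, Eig B μ → μ = δ - u ∨ Eig B' μ := by
      intro μ h
      have h1 := kB μ
      rw [← KD_pos_iff] at h ⊢
      split_ifs at h1 with h2
      · exact Or.inl h2
      · right; omega
    refine ⟨A, B, ?_, ?_, ?_, ?_, ?_⟩
    · ext y
      rw [LinearMap.add_apply, eA, eB]
      have h1 : (A' (P y) : V) + (B' (P y) : V) = E (P y) - φ (E (P y)) • x := by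
        have := congrArg Subtype.val (LinearMap.congr_fun hAB (P y))
        simp only [LinearMap.add_apply, Submodule.coe_add] at this
        rw [this]
        simp only [LinearMap.comp_apply, Submodule.subtype_apply, hPc]
      have h2 : E y = φ y • E x + E (P y) := by
        conv_lhs => rw [prK_dec x φ hφ y]
        rw [map_add, map_smul]
      rw [h2, hx]
      have h3 : E (P y) - φ (E (P y)) • x + φ (E (P y)) • x = E (P y) := by abel
      rw [← h1] at h3
      conv_rhs => rw [← h3]
      module
    · intro μ
      have h1 := kA μ
      split_ifs at h1 with h2
      · subst h2
        have := mt (KD_pos_iff A' μ).mp hu2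
        omega
      · have := hA' μ; omega
    · intro μ
      have h1 := kB μ
      split_ifs at h1 with h2
      · subst h2
        have := mt (KD_pos_iff B' (δ - u)).mp hu10
        omega
      · have := hB' μ; omega
    · intro μ h1 h2
      rcases sA μ h1 with rfl | h1 <;> rcases sB μ h2 with h2 | h2
      · exact hne h2
      · exact hu3 h2
      · subst h2; exact hu9 h1
      · exact hd' μ h1 h2
    · intro μ hμ
      refine ⟨fun h1 => ?_, fun h2 => ?_⟩
      · rcases sA μ h1 with rfl | h1
        · exact hu1 hμ
        · exact (hs' μ hμ).1 h1
      · rcases sB μ h2 with rfl | h2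
        · exact hu8 hμ
        · exact (hs' μ hμ).2 h2

end P4

section P5
variable {V W L X : Type} [AddCommGroup V] [Module ℂ V] [AddCommGroup W] [Module ℂ W]
  [AddCommGroup L] [Module ℂ L] [AddCommGroup X] [Module ℂ X]

def Gen {X : Type} [AddCommGroup X] [Module ℂ X] (P : X → Prop) : Prop :=
  (∃ a, P a) ∧ (∀ a b, P a → {t : ℂ | ¬ P (a + t • b)}.Finite) ∧ (∀ (c : ℂ) a, c ≠ 0 → P a → P (c • a))

lemma gen_and (P Q : X → Prop) (hP : Gen P) (hQ : Gen Q) : Gen (fun a => P a ∧ Q a) := by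
  obtain ⟨⟨a, ha⟩, hP1, hP2⟩ := hP
  obtain ⟨⟨b, hb⟩, hQ1, hQ2⟩ := hQ
  refine ⟨?_, ?_, ?_⟩
  · have f1 := hP1 a b ha
    have f2 := hQ1 b a hb
    have f3 : {s : ℂ | s⁻¹ ∈ {t : ℂ | ¬ P (a + t • b)}}.Finite :=
      f1.preimage (inv_injective.injOn)
    obtain ⟨s, hs⟩ := exists_notMem _ ((f2.union f3).union (Set.finite_singleton 0))
    simp only [Set.mem_union, Set.mem_singleton_iff, not_or, Set.mem_setOf_eq, not_not] at hs
    obtain ⟨⟨h1, h2⟩, h3⟩ := hs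
    refine ⟨a + s⁻¹ • b, h2, ?_⟩
    have := hQ2 s⁻¹ _ (inv_ne_zero h3) h1
    rwa [smul_add, smul_smul, inv_mul_cancel₀ h3, one_smul, add_comm] at this
  · rintro a b ⟨h1, h2⟩
    apply ((hP1 a b h1).union (hQ1 a b h2)).subset
    intro t ht
    simp only [Set.mem_setOf_eq, Set.mem_union] at ht ⊢
    tauto
  · rintro c a hc ⟨h1, h2⟩
    exact ⟨hP2 c a hc h1, hQ2 c a hc h2⟩

lemma gen_forall {ι : Type} (s : Finset ι) (P : ι → X → Prop) (h : ∀ i ∈ s, Gen (P i)) :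
    Gen (fun a => ∀ i ∈ s, P i a) := by
  classical
  induction s using Finset.induction_on with
  | empty => exact ⟨⟨0, by simp⟩, by simp, by simp⟩
  | insert i s hi ih =>
    have := gen_and _ _ (h i (by simp)) (ih (fun j hj => h j (by simp [hj])))
    simpa using this

lemma rk_generic [FiniteDimensional ℂ V] [FiniteDimensional ℂ W] (T₀ T₁ : V →ₗ[ℂ] W) (k : ℕ)
    (hk : k ≤ Module.finrank ℂ (LinearMap.range T₀)) :
    {t : ℂ | ¬ k ≤ Module.finrank ℂ (LinearMap.range (T₀ + t • T₁))}.Finite := by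
  set R := LinearMap.range T₀ with hR
  obtain ⟨ι, hι⟩ := LinearMap.exists_rightInverse_of_surjective T₀.rangeRestrict
    (LinearMap.range_rangeRestrict T₀)
  obtain ⟨ρ, hρ⟩ := LinearMap.exists_leftInverse_of_injective R.subtype (Submodule.ker_subtype R)
  set M : R →ₗ[ℂ] R := ρ ∘ₗ T₁ ∘ₗ ι
  have h1 : ∀ (t : ℂ) (x : R), ρ ((T₀ + t • T₁) (ι x)) = x + t • M x := by
    intro t x
    have e1 : T₀ (ι x) = R.subtype x := congrArg Subtype.val (LinearMap.congr_fun hι x)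
    have e2 : ρ (R.subtype x) = x := LinearMap.congr_fun hρ x
    rw [LinearMap.add_apply, map_add, e1, e2, LinearMap.smul_apply, map_smul]
    rfl
  have hf : {t : ℂ | -t⁻¹ ∈ {μ | Eig M μ}}.Finite := by
    apply (eig_finite M).preimage
    intro a _ b _ h
    exact inv_injective (neg_injective h)
  apply hf.subset
  intro t ht
  simp only [Set.mem_setOf_eq, not_le] at ht ⊢
  have hni : ¬ Function.Injective (ρ ∘ₗ (T₀ + t • T₁) ∘ₗ ι) := by
    intro hi
    have h2 := LinearMap.finrank_range_of_inj hi
    have hk2 : k ≤ Module.finrank ℂ (LinearMap.range T₀) := hk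
    have h3 : Module.finrank ℂ (LinearMap.range (ρ ∘ₗ (T₀ + t • T₁) ∘ₗ ι)) ≤
        Module.finrank ℂ (LinearMap.range (T₀ + t • T₁)) := by
      have : LinearMap.range (ρ ∘ₗ (T₀ + t • T₁) ∘ₗ ι) ≤ (LinearMap.range (T₀ + t • T₁)).map ρ := by
        rintro _ ⟨x, rfl⟩
        exact ⟨_, ⟨ι x, rfl⟩, rfl⟩
      exact (Submodule.finrank_mono this).trans (Submodule.finrank_map_le _ _)
    omega
  rw [← LinearMap.ker_eq_bot, LinearMap.ker_eq_bot'] at hni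
  push Not at hni
  obtain ⟨x, hx, h0⟩ := hni
  have hx' : x + t • M x = 0 := by rw [← h1]; exact hx
  have ht0 : t ≠ 0 := by
    rintro rfl
    simp at hx'
    exact h0 hx'
  refine ⟨x, h0, ?_⟩
  have : t • M x = - x := by rw [eq_neg_iff_add_eq_zero, add_comm]; exact hx'
  rw [neg_smul, ← smul_neg, ← this, smul_smul, inv_mul_cancel₀ ht0, one_smul]

lemma exists_W [FiniteDimensional ℂ V] (N : V →ₗ[ℂ] V) (h0 : N ≠ 0) (hk : ∃ x, x ≠ 0 ∧ N x = 0) :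
    ∃ u, (∀ s t : ℂ, s • u + t • N u = 0 → s = 0 ∧ t = 0) ∧ (∃ ν : ℂ, N (N u) = ν • N u) ∧
      (2 * Module.finrank ℂ (LinearMap.range N) ≤ Module.finrank ℂ V → u ∉ LinearMap.range N) := by
  have indep0 : ∀ u, N u ≠ 0 → N (N u) = 0 → ∀ s t : ℂ, s • u + t • N u = 0 → s = 0 ∧ t = 0 := by
    intro u h1 h2 s t h
    have h3 := congrArg N h
    rw [map_add, map_smul, map_smul, h2, smul_zero, add_zero, map_zero] at h3
    have hs := (smul_eq_zero.mp h3).resolve_right h1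
    rw [hs, zero_smul, zero_add] at h
    exact ⟨hs, (smul_eq_zero.mp h).resolve_right h1⟩
  by_cases hc1 : (LinearMap.ker N ≤ LinearMap.range N) ∧
      2 * Module.finrank ℂ (LinearMap.range N) ≤ Module.finrank ℂ V
  · obtain ⟨hle, hr⟩ := hc1
    have heq : LinearMap.ker N = LinearMap.range N := by
      apply Submodule.eq_of_le_of_finrank_le hle
      have := LinearMap.finrank_range_add_finrank_ker N
      omega
    obtain ⟨u, hu⟩ : ∃ u, N u ≠ 0 := by
      by_contra hcc; push Not at hcc; exact h0 (LinearMap.ext hcc)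
    have h2 : N (N u) = 0 := by
      have : N u ∈ LinearMap.ker N := by rw [heq]; exact ⟨u, rfl⟩
      exact this
    refine ⟨u, indep0 u hu h2, ⟨0, by simp [h2]⟩, fun _ hcc => hu ?_⟩
    rw [← heq] at hcc; exact hcc
  · obtain ⟨x, hx0, hxk, hxr⟩ : ∃ x, x ≠ 0 ∧ N x = 0 ∧ 
        (2 * Module.finrank ℂ (LinearMap.range N) ≤ Module.finrank ℂ V → x ∉ LinearMap.range N) := by
      by_cases hr : 2 * Module.finrank ℂ (LinearMap.range N) ≤ Module.finrank ℂ V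
      · have : ¬ (LinearMap.ker N ≤ LinearMap.range N) := fun h => hc1 ⟨h, hr⟩
        obtain ⟨x, h1, h2⟩ := SetLike.not_le_iff_exists.mp this
        exact ⟨x, fun h => h2 (by rw [h]; exact Submodule.zero_mem _), h1, fun _ => h2⟩
      · obtain ⟨x, h1, h2⟩ := hk
        exact ⟨x, h1, h2, fun h => absurd h hr⟩
    have hinv : ∀ v ∈ LinearMap.range N, N v ∈ LinearMap.range N := fun v _ => ⟨v, rfl⟩
    have : Nontrivial (LinearMap.range N) := by
      rw [Submodule.nontrivial_iff_ne_bot]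
      intro h; exact h0 (LinearMap.range_eq_bot.mp h)
    obtain ⟨ν, ⟨y, hyr⟩, hy0', hy'⟩ := exists_eig (N.restrict hinv)
    have hy : N y = ν • y := congrArg Subtype.val hy'
    have hy0 : y ≠ 0 := fun h => hy0' (Subtype.ext h)
    clear hy' hy0'
    by_cases hν : ν = 0
    · subst hν
      rw [zero_smul] at hy
      obtain ⟨z, rfl⟩ := hyr
      by_cases hz : z ∈ LinearMap.range N
      · refine ⟨z + x, ?_, ⟨0, by simp [hxk, hy]⟩, ?_⟩
        · apply indep0 <;> simp [hxk, hy, hy0]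
        · intro hr hcc
          exact hxr hr (by simpa using Submodule.sub_mem _ hcc hz)
      · exact ⟨z, indep0 z hy0 hy, ⟨0, by simp [hy]⟩, fun _ => hz⟩
    · have hNu : N (x + y) = ν • y := by rw [map_add, hxk, hy, zero_add]
      refine ⟨x + y, ?_, ⟨ν, by rw [hNu, map_smul, hy]⟩, ?_⟩
      · intro s t h
        rw [hNu] at h
        have h3 := congrArg N h
        rw [map_add, map_smul, map_smul, map_smul, hNu, hy, map_zero] at h3
        have h4 : ((s + t * ν) * ν) • y = 0 := by rw [← h3]; module
        have h5 := (mul_eq_zero.mp ((smul_eq_zero.mp h4).resolve_right hy0)).resolve_right hν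
        have h6 : s • x = 0 := by
          have : s • x = (s • (x + y) + t • ν • y) - (s + t * ν) • y := by module
          rw [this, h, h5]; simp
        have hs := (smul_eq_zero.mp h6).resolve_right hx0
        rw [hs, zero_add] at h5
        exact ⟨hs, (mul_eq_zero.mp h5).resolve_right hν⟩
      · intro hr hcc
        exact hxr hr (by simpa using Submodule.sub_mem _ hcc hyr)

lemma KD_rank [FiniteDimensional ℂ V] (T : V →ₗ[ℂ] V) (μ : ℂ) :
    Module.finrank ℂ (LinearMap.range (sh T μ)) + KD T μ = Module.finrank ℂ V :=
  LinearMap.finrank_range_add_finrank_ker _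

lemma L1_step [FiniteDimensional ℂ V] (n m : ℕ) (hn : Module.finrank ℂ V = n) (hm : 2 * (m + 1) ≤ n)
    (B : V →ₗ[ℂ] V) (h : ∀ μ, KD B μ ≤ n - (m + 1)) :
    ∃ u, ∃ S : Submodule ℂ V, S = Submodule.span ℂ (Set.range ![u, B u]) ∧ Module.finrank ℂ S = 2 ∧ 
      S ≤ S.comap B ∧ ∀ μ, Module.finrank ℂ (V ⧸ (LinearMap.range (sh B μ) ⊔ S)) ≤ n - 2 - m := by
  have : Nontrivial V := Module.nontrivial_of_finrank_pos (R := ℂ) (by omega)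
  obtain ⟨μ₀, hμ₀⟩ := exists_eig B
  obtain ⟨l, hl1, hl2⟩ : ∃ l, Eig B l ∧ ((∃ μ, KD B μ = n - (m + 1)) → KD B l = n - (m+1)) := by
    by_cases hc : ∃ μ, KD B μ = n - (m + 1)
    · obtain ⟨μ, hμ⟩ := hc
      exact ⟨μ, (KD_pos_iff B μ).mp (by omega), fun _ => hμ⟩
    · exact ⟨μ₀, hμ₀, fun h => absurd h hc⟩
  have hN0 : sh B l ≠ 0 := by
    intro hc
    have h1 := KD_rank B l
    rw [hc, LinearMap.range_zero, finrank_bot] at h1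
    have := h l
    omega
  obtain ⟨x, hx0, hx⟩ := hl1
  obtain ⟨u, hu1, ⟨ν, hu2⟩, hu3⟩ := exists_W (sh B l) hN0 ⟨x, hx0, by rw [shift_apply, hx, sub_self]⟩
  have hBu : B u = sh B l u + l • u := by rw [shift_apply]; abel
  have hind : LinearIndependent ℂ ![u, B u] := by
    rw [LinearIndependent.pair_iff]
    intro s t hst
    rw [hBu] at hst
    have := hu1 (s + t * l) t (by rw [← hst]; module)
    obtain ⟨h1, h2⟩ := this
    rw [h2] at h1
    exact ⟨by simpa using h1, h2⟩
  set S := Submodule.span ℂ (Set.range ![u, B u]) with hS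
  have huS : u ∈ S := Submodule.subset_span ⟨0, rfl⟩
  have hBuS : B u ∈ S := Submodule.subset_span ⟨1, rfl⟩
  have hfS : Module.finrank ℂ S = 2 := by
    have := finrank_span_eq_card hind
    simpa using this
  have hBBu : B (B u) ∈ S := by
    have h1 : sh B l u = B u - l • u := shift_apply _ _ _
    have h2 : sh B l (sh B l u) = B (B u) - l • B u - l • (B u - l • u) := by
      rw [h1, shift_apply, map_sub, map_smul]
    have h3 : B (B u) = ν • (B u - l • u) + l • B u + l • (B u - l • u) := by
      rw [← h1, ← hu2, h2, h1]; abel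
    rw [h3]
    exact S.add_mem (S.add_mem (S.smul_mem _ (S.sub_mem hBuS (S.smul_mem _ huS))) (S.smul_mem _ hBuS))
      (S.smul_mem _ (S.sub_mem hBuS (S.smul_mem _ huS)))
  refine ⟨u, S, rfl, hfS, ?_, ?_⟩
  · rw [hS, Submodule.span_le]
    rintro _ ⟨i, rfl⟩
    fin_cases i
    · exact hBuS
    · exact hBBu
  · intro μ
    have hq := Submodule.finrank_quotient_add_finrank (LinearMap.range (sh B μ) ⊔ S)
    have hr := KD_rank B μ
    by_cases hc : KD B μ = n - (m + 1)
    swap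
    · have := h μ
      have h2 := Submodule.finrank_mono (le_sup_left : LinearMap.range (sh B μ) ≤ LinearMap.range (sh B μ) ⊔ S)
      omega
    · have hl3 := hl2 ⟨μ, hc⟩
      have hrl := KD_rank B l
      by_cases hμ : μ = l
      · subst hμ
        have hlt : LinearMap.range (sh B μ) < LinearMap.range (sh B μ) ⊔ S := by
          refine lt_of_le_of_ne le_sup_left (fun he => ?_)
          apply hu3 (by omega)
          rw [he]
          exact Submodule.mem_sup_right huS
        have h2 := Submodule.finrank_lt_finrank_of_lt hlt
        omega
      · have hlt : LinearMap.ker (sh B l) < LinearMap.range (sh B μ) ⊔ S := by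
          refine lt_of_le_of_ne ?_ (fun he => ?_)
          · intro x hx
            apply Submodule.mem_sup_left
            rw [LinearMap.mem_ker, shift_apply, sub_eq_zero] at hx
            have hne : l - μ ≠ 0 := sub_ne_zero.mpr (Ne.symm hμ)
            refine ⟨(l - μ)⁻¹ • x, ?_⟩
            rw [map_smul, shift_apply, hx, ← sub_smul, smul_smul, inv_mul_cancel₀ hne, one_smul]
          · have : u ∈ LinearMap.ker (sh B l) := by rw [he]; exact Submodule.mem_sup_right huS
            have := (hu1 0 1 (by rw [LinearMap.mem_ker.mp this]; simp)).2
            exact one_ne_zero this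
        have h2 := Submodule.finrank_lt_finrank_of_lt hlt
        have : Module.finrank ℂ (LinearMap.ker (sh B l)) = KD B l := rfl
        omega

lemma L1_aux : ∀ (m n : ℕ) (V : Type) [AddCommGroup V] [Module ℂ V] [FiniteDimensional ℂ V]
    (_ : Module.finrank ℂ V = n) (_ : 2 * m ≤ n)
    (B : V →ₗ[ℂ] V) (_ : ∀ μ, KD B μ ≤ n - m),
    ∃ v : Fin m → V, ∃ S : Submodule ℂ V, S = Submodule.span ℂ (Set.range v ∪ Set.range (fun i => B (v i))) ∧
      S ≤ S.comap B ∧ 2 * m ≤ Module.finrank ℂ S := by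
  intro m
  induction m with
  | zero =>
    intro n V _ _ _ _ _ B _
    refine ⟨Fin.elim0, ⊥, ?_, by simp, by simp⟩
    simp
  | succ m ih =>
    intro n V _ _ _ hn hm B h
    obtain ⟨u, W, hW, hW2, hWi, hWq⟩ := L1_step n m hn hm B h
    have hfq : Module.finrank ℂ (V ⧸ W) = n - 2 := by
      have := Submodule.finrank_quotient_add_finrank W
      omega
    obtain ⟨v', S', hS', hS'i, hS'f⟩ := ih (n - 2) (V ⧸ W) hfq (by omega) (W.mapQ W B hWi) (by
      intro μ
      rw [KD_eq_coker]
      refine le_trans (finrank_quot_le W.mkQ (Submodule.mkQ_surjective W) (LinearMap.range (sh B μ) ⊔ W) _ ?_) (hWq μ)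
      intro x hx
      obtain ⟨_, ⟨a, rfl⟩, w, hw, rfl⟩ := Submodule.mem_sup.mp hx
      refine ⟨W.mkQ a, ?_⟩
      rw [map_add, shift_apply, shift_apply]
      have : W.mkQ w = 0 := by simpa using hw
      rw [this]; simp)
    have hv : ∃ v : Fin m → V, ∀ i, W.mkQ (v i) = v' i := by
      choose v hv using fun i => Submodule.mkQ_surjective W (v' i)
      exact ⟨v, hv⟩
    obtain ⟨v, hv⟩ := hv
    have hmap : S' = (Submodule.span ℂ (Set.range v ∪ Set.range (fun i => B (v i)))).map W.mkQ := by
      rw [hS', Submodule.map_span, Set.image_union, ← Set.range_comp, ← Set.range_comp]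
      congr 2
      · congr 1; ext i; simp [← hv]
      · congr 1; ext i; simp [← hv]
    have hcomap : S'.comap W.mkQ = W ⊔ Submodule.span ℂ (Set.range v ∪ Set.range (fun i => B (v i))) := by
      rw [hmap, Submodule.comap_map_mkQ]
    refine ⟨Fin.cons u v, S'.comap W.mkQ, ?_, ?_, ?_⟩
    · rw [hcomap, hW, ← Submodule.span_union]
      congr 1
      ext y
      simp only [Set.mem_union, Set.mem_range, Fin.exists_fin_succ, Fin.cons_zero, Fin.cons_succ]
      simp
      tauto
    · intro x hx
      exact hS'i hx
    · set S := S'.comap W.mkQ with hSd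
      have h1 := LinearMap.finrank_range_add_finrank_ker (W.mkQ.domRestrict S)
      have h2 : LinearMap.range (W.mkQ.domRestrict S) = S' := by
        rw [LinearMap.range_domRestrict, hSd, Submodule.map_comap_eq_of_surjective (Submodule.mkQ_surjective W)]
      have h3 : 2 ≤ Module.finrank ℂ (LinearMap.ker (W.mkQ.domRestrict S)) := by
        have hWS : W ≤ S := by rw [hcomap]; exact le_sup_left
        rw [← hW2]
        have hr : ∀ w : W, (⟨w, hWS w.2⟩ : S) ∈ LinearMap.ker (W.mkQ.domRestrict S) := by
          intro w; simp [LinearMap.mem_ker]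
        apply LinearMap.finrank_le_finrank_of_injective 
          (f := (Submodule.inclusion hWS).codRestrict (LinearMap.ker (W.mkQ.domRestrict S)) hr)
        intro a b hab
        have := congrArg (fun z : LinearMap.ker (W.mkQ.domRestrict S) => ((z : S) : V)) hab
        exact Subtype.ext this
      rw [h2] at h1
      omega

/-- the map `(a,b) ↦ B φ a + φ b`. -/
noncomputable def jet {V L : Type} [AddCommGroup V] [Module ℂ V] [AddCommGroup L] [Module ℂ L]
    (B : V →ₗ[ℂ] V) (φ : L →ₗ[ℂ] V) : L × L →ₗ[ℂ] V := (B ∘ₗ φ).coprod φ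

lemma jet_apply (B : V →ₗ[ℂ] V) (φ : L →ₗ[ℂ] V) (a b : L) : jet B φ (a, b) = B (φ a) + φ b := rfl

lemma L1 [FiniteDimensional ℂ V] (n m : ℕ) (hn : Module.finrank ℂ V = n) (hm : 2 * m ≤ n)
    (B : V →ₗ[ℂ] V) (h : ∀ μ, KD B μ ≤ n - m) :
    ∃ φ : (Fin m → ℂ) →ₗ[ℂ] V, Function.Injective (jet B φ) ∧
      LinearMap.range (jet B φ) ≤ (LinearMap.range (jet B φ)).comap B := by
  obtain ⟨v, S, hS, hSi, hSf⟩ := L1_aux m n V hn hm B h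
  set φ := Fintype.linearCombination ℂ v with hφ
  have hr : LinearMap.range (jet B φ) = S := by
    rw [jet, LinearMap.range_coprod, LinearMap.range_comp, hφ, Fintype.range_linearCombination, hS,
      Submodule.map_span, Submodule.span_union, ← Set.range_comp, sup_comm]
    rfl
  refine ⟨φ, ?_, by rw [hr]; exact hSi⟩
  rw [← LinearMap.ker_eq_bot, ← Submodule.finrank_eq_zero (R := ℂ)]
  have h1 := LinearMap.finrank_range_add_finrank_ker (jet B φ)
  rw [hr, Module.finrank_prod, Module.finrank_fin_fun] at h1
  omega

end P5

section P6
variable {V W L X Y : Type} [AddCommGroup V] [Module ℂ V] [AddCommGroup W] [Module ℂ W]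
  [AddCommGroup L] [Module ℂ L] [AddCommGroup X] [Module ℂ X] [AddCommGroup Y] [Module ℂ Y]

lemma exists_phi [FiniteDimensional ℂ V] (R : Submodule ℂ V) (m : ℕ) :
    ∃ φ : (Fin m → ℂ) →ₗ[ℂ] V, 
      Module.finrank ℂ V - (Module.finrank ℂ V - Module.finrank ℂ R - m) ≤
        Module.finrank ℂ (R ⊔ LinearMap.range φ : Submodule ℂ V) := by
  obtain ⟨C, hC⟩ := Submodule.exists_isCompl R
  have hd := Submodule.finrank_add_eq_of_isCompl hC
  set j := min m (Module.finrank ℂ C)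
  obtain ⟨f, hf⟩ := exists_linearIndependent_of_le_finrank (R := ℂ) (M := C) (min_le_right m (Module.finrank ℂ C))
  have hcast : Function.Injective (Fin.castLE (min_le_left m (Module.finrank ℂ C))) :=
    Fin.castLE_injective _
  set φ := C.subtype ∘ₗ Fintype.linearCombination ℂ f ∘ₗ 
    LinearMap.funLeft ℂ ℂ (Fin.castLE (min_le_left m (Module.finrank ℂ C))) with hφ
  refine ⟨φ, ?_⟩
  have hr : LinearMap.range φ = (LinearMap.range (C.subtype ∘ₗ Fintype.linearCombination ℂ f)) := by
    rw [hφ, ← LinearMap.comp_assoc]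
    exact LinearMap.range_comp_of_range_eq_top _ 
      (LinearMap.range_eq_top.mpr (LinearMap.funLeft_surjective_of_injective ℂ ℂ _ hcast))
  have hinj : Function.Injective (C.subtype ∘ₗ Fintype.linearCombination ℂ f) := by
    rw [LinearMap.coe_comp]
    exact (Submodule.injective_subtype C).comp (hf.fintypeLinearCombination_injective)
  have h1 := LinearMap.finrank_range_of_inj hinj
  rw [← hr, Module.finrank_fin_fun] at h1
  have h2 := Submodule.finrank_sup_add_finrank_inf_eq R (LinearMap.range φ)
  have h3 : R ⊓ LinearMap.range φ = ⊥ := by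
    rw [eq_bot_iff, ← hC.inf_eq_bot]
    apply inf_le_inf_left
    rintro _ ⟨x, rfl⟩
    exact (Fintype.linearCombination ℂ f _).2
  rw [h3, finrank_bot] at h2
  omega

lemma LA [FiniteDimensional ℂ V] (n m : ℕ) (hn : Module.finrank ℂ V = n) (hm : 2 * m ≤ n)
    (A : V →ₗ[ℂ] V) (h : ∀ μ, KD A μ ≤ n - m) :
    ∃ φ : (Fin m → ℂ) →ₗ[ℂ] V, Function.Injective (jet A φ) ∧ ∀ μ, CK A φ μ ≤ KD A μ - m := by
  have g1 : Gen (fun φ : (Fin m → ℂ) →ₗ[ℂ] V => 2 * m ≤ Module.finrank ℂ (LinearMap.range (jet A φ))) := by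
    refine ⟨?_, ?_, ?_⟩
    · obtain ⟨φ, hφ, _⟩ := L1 n m hn hm A h
      refine ⟨φ, ?_⟩
      show 2 * m ≤ Module.finrank ℂ (LinearMap.range (jet A φ))
      rw [LinearMap.finrank_range_of_inj hφ, Module.finrank_prod, Module.finrank_fin_fun]
      omega
    · intro φ ψ hφ
      have := rk_generic (jet A φ) (jet A ψ) _ hφ
      have e : ∀ t : ℂ, jet A (φ + t • ψ) = jet A φ + t • jet A ψ := by
        intro t; apply LinearMap.ext; rintro ⟨a, b⟩; simp [jet_apply]; abel
      refine this.subset ?_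
      intro t ht
      simp only [Set.mem_setOf_eq] at ht ⊢
      rwa [e t] at ht
    · intro c φ hc hφ
      have e : jet A (c • φ) = c • jet A φ := by
        apply LinearMap.ext; rintro ⟨a, b⟩; simp [jet_apply]
      show 2 * m ≤ Module.finrank ℂ (LinearMap.range (jet A (c • φ)))
      rw [e, LinearMap.range_smul _ _ hc]; exact hφ
  have g2 : ∀ μ, Gen (fun φ : (Fin m → ℂ) →ₗ[ℂ] V => n - (KD A μ - m) ≤
      Module.finrank ℂ (LinearMap.range ((sh A μ).coprod φ))) := by
    intro μ
    refine ⟨?_, ?_, ?_⟩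
    · obtain ⟨φ, hφ⟩ := exists_phi (LinearMap.range (sh A μ)) m
      refine ⟨φ, ?_⟩
      show n - (KD A μ - m) ≤ Module.finrank ℂ (LinearMap.range ((sh A μ).coprod φ))
      rw [LinearMap.range_coprod]
      have := KD_rank A μ
      omega
    · intro φ ψ hφ
      have := rk_generic ((sh A μ).coprod φ) ((0 : V →ₗ[ℂ] V).coprod ψ) _ hφ
      have e : ∀ t : ℂ, (sh A μ).coprod (φ + t • ψ) = (sh A μ).coprod φ + t • (0 : V →ₗ[ℂ] V).coprod ψ := by
        intro t; apply LinearMap.ext; rintro ⟨a, b⟩; simp; abel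
      refine this.subset ?_
      intro t ht
      simp only [Set.mem_setOf_eq] at ht ⊢
      rwa [e t] at ht
    · intro c φ hc hφ
      show _ ≤ Module.finrank ℂ (LinearMap.range ((sh A μ).coprod (c • φ)))
      rw [LinearMap.range_coprod, LinearMap.range_smul _ _ hc, ← LinearMap.range_coprod]; exact hφ
  obtain ⟨φ, hφ1, hφ2⟩ := (gen_and _ _ g1 (gen_forall (eig_finite A).toFinset _ (fun μ _ => g2 μ))).1
  refine ⟨φ, ?_, ?_⟩
  · rw [← LinearMap.ker_eq_bot, ← Submodule.finrank_eq_zero (R := ℂ)]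
    have h1 := LinearMap.finrank_range_add_finrank_ker (jet A φ)
    rw [Module.finrank_prod, Module.finrank_fin_fun] at h1
    omega
  · intro μ
    have h1 := Submodule.finrank_quotient_add_finrank (LinearMap.range (sh A μ) ⊔ LinearMap.range φ)
    by_cases hμ : Eig A μ
    · have h2 := hφ2 μ (by simpa using hμ)
      rw [LinearMap.range_coprod] at h2
      have h3 := KD_rank A μ
      unfold CK
      have h4 : KD A μ - m ≤ n := by omega
      omega
    · have : CK A φ μ = 0 := by
        unfold CK
        rw [LinearMap.range_eq_top.mpr (not_eig_surj A μ hμ), top_sup_eq]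
        exact Module.finrank_zero_of_subsingleton
      omega

def NFormA {V L Y : Type} [AddCommGroup V] [Module ℂ V] [AddCommGroup L] [Module ℂ L] [AddCommGroup Y]
    [Module ℂ Y] (A : V →ₗ[ℂ] V) (α κ : L →ₗ[ℂ] L) (μ ν : Y →ₗ[ℂ] L) (Γ : L →ₗ[ℂ] Y) (F : Y →ₗ[ℂ] Y) : Prop :=
  ∃ E : (L × L × Y) ≃ₗ[ℂ] V, ∀ a b y, A (E (a, b, y)) = E (α a + b + μ y, κ a + ν y, Γ a + F y)

def NFormB {V L Y : Type} [AddCommGroup V] [Module ℂ V] [AddCommGroup L] [Module ℂ L] [AddCommGroup Y]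
    [Module ℂ Y] (A : V →ₗ[ℂ] V) (α κ : L →ₗ[ℂ] L) (μ ν : Y →ₗ[ℂ] L) (β : ℂ) : Prop :=
  ∃ E : (L × L × Y) ≃ₗ[ℂ] V, ∀ a b y, A (E (a, b, y)) = E (α a - b + μ y, κ a + ν y, β • y)

/-- extend an injective map to an equivalence -/
lemma extend_equiv [FiniteDimensional ℂ V] (n m e : ℕ) (hn : Module.finrank ℂ V = n) (hm : 2 * m + e = n)
    (f : (Fin m → ℂ) × (Fin m → ℂ) →ₗ[ℂ] V) (hf : Function.Injective f) :
    ∃ E : ((Fin m → ℂ) × (Fin m → ℂ) × (Fin e → ℂ)) ≃ₗ[ℂ] V, ∀ a b, E (a, b, 0) = f (a, b) := by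
  obtain ⟨C, hC⟩ := Submodule.exists_isCompl (LinearMap.range f)
  have hd := Submodule.finrank_add_eq_of_isCompl hC
  rw [LinearMap.finrank_range_of_inj hf, Module.finrank_prod, Module.finrank_fin_fun] at hd
  have hCe : Module.finrank ℂ (Fin e → ℂ) = Module.finrank ℂ C := by
    rw [Module.finrank_fin_fun]; omega
  set ζ := LinearEquiv.ofFinrankEq (Fin e → ℂ) C hCe
  let g : ((Fin m → ℂ) × (Fin m → ℂ) × (Fin e → ℂ)) →ₗ[ℂ] V :=
    (f.coprod (C.subtype ∘ₗ ζ.toLinearMap)) ∘ₗ (LinearEquiv.prodAssoc ℂ (Fin m → ℂ) (Fin m → ℂ) (Fin e → ℂ)).symm.toLinearMap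
  have hg : ∀ a b y, g (a, b, y) = f (a, b) + (ζ y : V) := fun a b y => rfl
  have hinj : Function.Injective g := by
    rw [← LinearMap.ker_eq_bot, LinearMap.ker_eq_bot']
    rintro ⟨a, b, y⟩ h
    rw [hg] at h
    have h1 : f (a, b) ∈ LinearMap.range f ⊓ C := by
      refine ⟨⟨_, rfl⟩, ?_⟩
      have : f (a, b) = - (ζ y : V) := eq_neg_of_add_eq_zero_left h
      rw [this]; exact C.neg_mem (ζ y).2
    rw [hC.inf_eq_bot, Submodule.mem_bot] at h1
    rw [h1, zero_add] at h
    have h2 : y = 0 := by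
      apply ζ.injective; rw [map_zero]; exact Subtype.ext h
    have h3 : (a, b) = 0 := hf (by rw [h1, map_zero])
    rw [Prod.mk_eq_zero] at h3
    rw [h2, h3.1, h3.2]; rfl
  have hfr : Module.finrank ℂ ((Fin m → ℂ) × (Fin m → ℂ) × (Fin e → ℂ)) = Module.finrank ℂ V := by
    simp only [Module.finrank_prod, Module.finrank_fin_fun]; omega
  refine ⟨LinearEquiv.ofInjectiveOfFinrankEq g hinj hfr, fun a b => ?_⟩
  show g (a, b, 0) = _
  rw [hg]; simp

lemma triple (T : (L × L × Y) →ₗ[ℂ] W) (a b : L) (y : Y) :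
    T (a, b, y) = T (a, 0, 0) + T (0, b, 0) + T (0, 0, y) := by
  rw [← map_add, ← map_add]; simp

lemma nfA [FiniteDimensional ℂ V] (n m e : ℕ) (hn : Module.finrank ℂ V = n) (hm : 2 * m + e = n)
    (A : V →ₗ[ℂ] V) (h : ∀ μ, KD A μ ≤ n - m) :
    ∃ (α κ : (Fin m → ℂ) →ₗ[ℂ] (Fin m → ℂ)) (μ ν : (Fin e → ℂ) →ₗ[ℂ] (Fin m → ℂ)) 
      (Γ : (Fin m → ℂ) →ₗ[ℂ] (Fin e → ℂ)) (F : (Fin e → ℂ) →ₗ[ℂ] (Fin e → ℂ)),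
      NFormA A α κ μ ν Γ F ∧ ∀ l, CK F Γ l ≤ KD A l - m := by
  obtain ⟨φ, hφ, hck⟩ := LA n m hn (by omega) A h
  obtain ⟨E, hE⟩ := extend_equiv n m e hn hm (jet A φ) hφ
  have hb : ∀ b, A (E (0, b, 0)) = E (b, 0, 0) := by
    intro b; rw [hE, hE, jet_apply, jet_apply]; simp
  let T := E.symm.toLinearMap ∘ₗ A ∘ₗ E.toLinearMap
  have hT : ∀ x, E (T x) = A (E x) := fun x => by simp [T]
  have hTb : ∀ b, T (0, b, 0) = (b, 0, 0) := fun b => E.injective (by rw [hT, hb])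
  let i1 : (Fin m → ℂ) →ₗ[ℂ] ((Fin m → ℂ) × (Fin m → ℂ) × (Fin e → ℂ)) := LinearMap.inl ℂ _ _
  let i3 : (Fin e → ℂ) →ₗ[ℂ] ((Fin m → ℂ) × (Fin m → ℂ) × (Fin e → ℂ)) := LinearMap.inr ℂ _ _ ∘ₗ LinearMap.inr ℂ _ _
  let p1 : ((Fin m → ℂ) × (Fin m → ℂ) × (Fin e → ℂ)) →ₗ[ℂ] (Fin m → ℂ) := LinearMap.fst ℂ _ _
  let p2 : ((Fin m → ℂ) × (Fin m → ℂ) × (Fin e → ℂ)) →ₗ[ℂ] (Fin m → ℂ) := LinearMap.fst ℂ _ _ ∘ₗ LinearMap.snd ℂ _ _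
  let p3 : ((Fin m → ℂ) × (Fin m → ℂ) × (Fin e → ℂ)) →ₗ[ℂ] (Fin e → ℂ) := LinearMap.snd ℂ _ _ ∘ₗ LinearMap.snd ℂ _ _
  have hTf : ∀ a b y, A (E (a, b, y)) = E ((p1 ∘ₗ T ∘ₗ i1) a + b + (p1 ∘ₗ T ∘ₗ i3) y, 
      (p2 ∘ₗ T ∘ₗ i1) a + (p2 ∘ₗ T ∘ₗ i3) y, (p3 ∘ₗ T ∘ₗ i1) a + (p3 ∘ₗ T ∘ₗ i3) y) := by
    intro a b y
    rw [← hT, triple, hTb]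
    congr 1
    show _ = ((T (a, 0, 0)).1 + b + (T (0, 0, y)).1, (T (a, 0, 0)).2.1 + (T (0,0,y)).2.1, 
      (T (a, 0, 0)).2.2 + (T (0,0,y)).2.2)
    ext <;> simp
  refine ⟨p1 ∘ₗ T ∘ₗ i1, p2 ∘ₗ T ∘ₗ i1, p1 ∘ₗ T ∘ₗ i3, p2 ∘ₗ T ∘ₗ i3, p3 ∘ₗ T ∘ₗ i1, p3 ∘ₗ T ∘ₗ i3, ⟨E, hTf⟩, ?_⟩
  intro l
  refine le_trans ?_ (hck l)
  refine finrank_quot_le (p3 ∘ₗ E.symm.toLinearMap) ?_ _ _ ?_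
  · intro y
    exact ⟨E (0, 0, y), by simp [p3]⟩
  · intro x hx
    obtain ⟨_, ⟨v, rfl⟩, _, ⟨b, rfl⟩, rfl⟩ := Submodule.mem_sup.mp hx
    obtain ⟨⟨a, b', y⟩, rfl⟩ := E.surjective v
    have hφb : φ b = E (0, b, 0) := by rw [hE, jet_apply]; simp
    rw [shift_apply, hTf, hφb, ← map_smul, ← map_sub, ← map_add]
    rw [LinearMap.comp_apply, LinearEquiv.coe_coe, LinearEquiv.symm_apply_apply]
    show (p3 ∘ₗ T ∘ₗ i1) a + (p3 ∘ₗ T ∘ₗ i3) y - l • y + 0 ∈ _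
    apply Submodule.mem_sup.mpr
    refine ⟨sh (p3 ∘ₗ T ∘ₗ i3) l y, ⟨_, rfl⟩, _, ⟨a, rfl⟩, ?_⟩
    rw [shift_apply]; abel

lemma nfB [FiniteDimensional ℂ V] (n m e : ℕ) (hn : Module.finrank ℂ V = n) (hm : 2 * m + e = n)
    (A : V →ₗ[ℂ] V) (h : ∀ μ, KD A μ ≤ n - m) (hs : e ≤ 1 ∨ ∃ l, KD A l = n - m) :
    ∃ (α κ : (Fin m → ℂ) →ₗ[ℂ] (Fin m → ℂ)) (μ ν : (Fin e → ℂ) →ₗ[ℂ] (Fin m → ℂ)) (β : ℂ),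
      NFormB A α κ μ ν β := by
  obtain ⟨φ, hφ, hinv⟩ := L1 n m hn (by omega) A h
  let sg : ((Fin m → ℂ) × (Fin m → ℂ)) →ₗ[ℂ] ((Fin m → ℂ) × (Fin m → ℂ)) := (-LinearMap.id).prodMap LinearMap.id
  have hsg : ∀ a b, sg (a, b) = (-a, b) := fun a b => by simp [sg]
  have hf : Function.Injective (jet A φ ∘ₗ sg) := by
    rw [LinearMap.coe_comp]
    apply hφ.comp
    rintro ⟨a, b⟩ ⟨a', b'⟩ h
    rw [hsg, hsg] at h
    simpa using h
  obtain ⟨E, hE⟩ := extend_equiv n m e hn hm (jet A φ ∘ₗ sg) hf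
  have hE : ∀ a b, E (a, b, 0) = - A (φ a) + φ b := by
    intro a b; rw [hE, LinearMap.comp_apply, hsg, jet_apply]; simp
  have hb : ∀ b, A (E (0, b, 0)) = E (-b, 0, 0) := by
    intro b; rw [hE, hE]; simp
  let T := E.symm.toLinearMap ∘ₗ A ∘ₗ E.toLinearMap
  have hT : ∀ x, E (T x) = A (E x) := fun x => by simp [T]
  have hTb : ∀ b, T (0, b, 0) = (-b, 0, 0) := fun b => E.injective (by rw [hT, hb])
  let i1 : (Fin m → ℂ) →ₗ[ℂ] ((Fin m → ℂ) × (Fin m → ℂ) × (Fin e → ℂ)) := LinearMap.inl ℂ _ _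
  let i3 : (Fin e → ℂ) →ₗ[ℂ] ((Fin m → ℂ) × (Fin m → ℂ) × (Fin e → ℂ)) := LinearMap.inr ℂ _ _ ∘ₗ LinearMap.inr ℂ _ _
  let p1 : ((Fin m → ℂ) × (Fin m → ℂ) × (Fin e → ℂ)) →ₗ[ℂ] (Fin m → ℂ) := LinearMap.fst ℂ _ _
  let p2 : ((Fin m → ℂ) × (Fin m → ℂ) × (Fin e → ℂ)) →ₗ[ℂ] (Fin m → ℂ) := LinearMap.fst ℂ _ _ ∘ₗ LinearMap.snd ℂ _ _
  let p3 : ((Fin m → ℂ) × (Fin m → ℂ) × (Fin e → ℂ)) →ₗ[ℂ] (Fin e → ℂ) := LinearMap.snd ℂ _ _ ∘ₗ LinearMap.snd ℂ _ _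
  have hV0 : ∀ v ∈ LinearMap.range (jet A φ), p3 (E.symm v) = 0 := by
    rintro _ ⟨⟨a, b⟩, rfl⟩
    have : jet A φ (a, b) = E (-a, b, 0) := by rw [hE, jet_apply]; simp
    rw [this]; simp [p3]
  have hTa : ∀ a, p3 (T (a, 0, 0)) = 0 := by
    intro a
    apply hV0
    apply hinv
    show E (a, 0, 0) ∈ _
    exact ⟨(-a, 0), by rw [hE, jet_apply]; simp⟩
  have hsc : ∃ β : ℂ, ∀ y, p3 (T (0, 0, y)) = β • y := by
    rcases hs with hs | ⟨l, hl⟩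
    · rcases Nat.le_one_iff_eq_zero_or_eq_one.mp hs with rfl | rfl
      · exact ⟨0, fun y => Subsingleton.elim _ _⟩
      · exact isSc_dim1 (by simp) (p3 ∘ₗ T ∘ₗ i3)
    · refine ⟨l, fun y => ?_⟩
      have hle : LinearMap.range (sh A l ∘ₗ φ) = LinearMap.range (sh A l) := by
        apply Submodule.eq_of_le_of_finrank_le
        · rintro _ ⟨x, rfl⟩; exact ⟨φ x, rfl⟩
        · have hi : Function.Injective (sh A l ∘ₗ φ) := by
            rw [← LinearMap.ker_eq_bot, LinearMap.ker_eq_bot']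
            intro a ha
            rw [LinearMap.comp_apply, shift_apply] at ha
            have : jet A φ (a, -(l • a)) = 0 := by
              rw [jet_apply, ← ha]; simp [sub_eq_add_neg]
            have := hφ (this.trans (map_zero _).symm)
            exact (Prod.mk_eq_zero.mp this).1
          rw [LinearMap.finrank_range_of_inj hi, Module.finrank_fin_fun]
          have := KD_rank A l
          omega
      have hmem : sh A l (E (0, 0, y)) ∈ LinearMap.range (jet A φ) := by
        have : sh A l (E (0, 0, y)) ∈ LinearMap.range (sh A l ∘ₗ φ) := by rw [hle]; exact ⟨_, rfl⟩
        obtain ⟨a, ha⟩ := this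
        refine ⟨(a, -(l • a)), ?_⟩
        rw [← ha, jet_apply, LinearMap.comp_apply, shift_apply]; simp [sub_eq_add_neg]
      have h1 := hV0 _ hmem
      rw [shift_apply, ← hT, ← map_smul, ← map_sub, LinearEquiv.symm_apply_apply, map_sub, sub_eq_zero] at h1
      rw [h1]; rfl
  obtain ⟨β, hβ⟩ := hsc
  refine ⟨p1 ∘ₗ T ∘ₗ i1, p2 ∘ₗ T ∘ₗ i1, p1 ∘ₗ T ∘ₗ i3, p2 ∘ₗ T ∘ₗ i3, β, E, ?_⟩
  intro a b y
  rw [← hT, triple, hTb, ← hβ]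
  congr 1
  have h2 : (T (a, 0, 0)).2.2 = 0 := hTa a
  show _ = ((T (a, 0, 0)).1 - b + (T (0, 0, y)).1, (T (a, 0, 0)).2.1 + (T (0,0,y)).2.1, 
      (T (0,0,y)).2.2)
  ext <;> simp [h2, sub_eq_add_neg]

lemma trace_prod [FiniteDimensional ℂ V] [FiniteDimensional ℂ W] (T : (V × W) →ₗ[ℂ] (V × W)) :
    LinearMap.trace ℂ _ T = LinearMap.trace ℂ V (LinearMap.fst ℂ V W ∘ₗ T ∘ₗ LinearMap.inl ℂ V W) +
      LinearMap.trace ℂ W (LinearMap.snd ℂ V W ∘ₗ T ∘ₗ LinearMap.inr ℂ V W) := by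
  have h : T = (T ∘ₗ LinearMap.inl ℂ V W) ∘ₗ LinearMap.fst ℂ V W + (T ∘ₗ LinearMap.inr ℂ V W) ∘ₗ LinearMap.snd ℂ V W := by
    apply LinearMap.ext; rintro ⟨a, b⟩
    simp only [LinearMap.add_apply, LinearMap.comp_apply, ← map_add]
    simp
  conv_lhs => rw [h]
  rw [map_add, LinearMap.trace_comp_comm', LinearMap.trace_comp_comm' (LinearMap.snd ℂ V W)]

lemma trace_sim [FiniteDimensional ℂ V] [FiniteDimensional ℂ W] (T : V →ₗ[ℂ] V) (T' : W →ₗ[ℂ] W) (E : W ≃ₗ[ℂ] V)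
    (h : ∀ x, T (E x) = E (T' x)) : LinearMap.trace ℂ _ T = LinearMap.trace ℂ _ T' := by
  have : T' = E.symm.toLinearMap ∘ₗ (T ∘ₗ E.toLinearMap) := by
    ext x; simp [h]
  rw [this, LinearMap.trace_comp_comm']
  congr 1
  ext x; simp

lemma trace_triple [FiniteDimensional ℂ V] [FiniteDimensional ℂ L] [FiniteDimensional ℂ Y]
    (A : V →ₗ[ℂ] V) (E : (L × L × Y) ≃ₗ[ℂ] V) (T : (L × L × Y) →ₗ[ℂ] (L × L × Y)) (h : ∀ x, A (E x) = E (T x))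
    (α δ : L →ₗ[ℂ] L) (F : Y →ₗ[ℂ] Y) (h1 : ∀ a, (T (a, 0, 0)).1 = α a)
    (h2 : ∀ b, (T (0, b, 0)).2.1 = δ b) (h3 : ∀ y, (T (0, 0, y)).2.2 = F y) :
    LinearMap.trace ℂ V A = LinearMap.trace ℂ L α + LinearMap.trace ℂ L δ + LinearMap.trace ℂ Y F := by
  rw [trace_sim A T E h, trace_prod, trace_prod, add_assoc]
  congr 1
  · congr 1; ext a : 1; exact h1 a
  · congr 1
    · congr 1; ext a : 1; exact h2 a
    · congr 1; ext a : 1; exact h3 a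

lemma trace_NFA [FiniteDimensional ℂ V] [FiniteDimensional ℂ L] [FiniteDimensional ℂ Y]
   (A : V →ₗ[ℂ] V) (α κ : L →ₗ[ℂ] L) (μ ν : Y →ₗ[ℂ] L) (Γ : L →ₗ[ℂ] Y) (F : Y →ₗ[ℂ] Y) 
   (h : NFormA A α κ μ ν Γ F) : LinearMap.trace ℂ V A = LinearMap.trace ℂ L α + LinearMap.trace ℂ Y F := by
  obtain ⟨E, hE⟩ := h
  have hT : ∀ a b y, (E.symm.toLinearMap ∘ₗ A ∘ₗ E.toLinearMap) (a, b, y) = (α a + b + μ y, κ a + ν y, Γ a + F y) := by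
    intro a b y; simp [hE]
  have := trace_triple A E (E.symm.toLinearMap ∘ₗ A ∘ₗ E.toLinearMap) (by intro x; simp) α 0 F
    (fun a => by rw [hT]; simp) (fun a => by rw [hT]; simp) (fun a => by rw [hT]; simp)
  simpa using this

lemma trace_NFB [FiniteDimensional ℂ V] [FiniteDimensional ℂ L] [FiniteDimensional ℂ Y]
   (A : V →ₗ[ℂ] V) (α κ : L →ₗ[ℂ] L) (μ ν : Y →ₗ[ℂ] L) (β : ℂ)
   (h : NFormB A α κ μ ν β) : LinearMap.trace ℂ V A = LinearMap.trace ℂ L α + Module.finrank ℂ Y * β := by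
  obtain ⟨E, hE⟩ := h
  have hT : ∀ a b y, (E.symm.toLinearMap ∘ₗ A ∘ₗ E.toLinearMap) (a, b, y) = (α a - b + μ y, κ a + ν y, β • y) := by
    intro a b y; simp [hE]
  have := trace_triple A E (E.symm.toLinearMap ∘ₗ A ∘ₗ E.toLinearMap) (by intro x; simp) α 0 (β • LinearMap.id)
    (fun a => by rw [hT]; simp) (fun a => by rw [hT]; simp) (fun a => by rw [hT]; simp)
  rw [this, trace_sc (β • LinearMap.id) β (by simp)]; simp

end P6

section P7
variable {V W L X Y : Type} [AddCommGroup V] [Module ℂ V] [AddCommGroup W] [Module ℂ W]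
  [AddCommGroup L] [Module ℂ L] [AddCommGroup X] [Module ℂ X] [AddCommGroup Y] [Module ℂ Y]

/-- the shear (a,b,y) ↦ (a - H y, b - P a - K y, y) -/
def shear {L Y : Type} [AddCommGroup L] [Module ℂ L] [AddCommGroup Y] [Module ℂ Y]
    (H : Y →ₗ[ℂ] L) (P : L →ₗ[ℂ] L) (K : Y →ₗ[ℂ] L) : (L × L × Y) ≃ₗ[ℂ] (L × L × Y) where
  toFun x := (x.1 - H x.2.2, x.2.1 - P x.1 - K x.2.2, x.2.2)
  invFun x := (x.1 + H x.2.2, x.2.1 + P (x.1 + H x.2.2) + K x.2.2, x.2.2)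
  map_add' x y := by
    ext <;> simp <;> abel
  map_smul' c x := by
    ext <;> simp [smul_sub]
  left_inv x := by
    ext <;> simp <;> abel
  right_inv x := by
    ext <;> simp <;> abel

structure Comb {L Y : Type} [AddCommGroup L] [Module ℂ L] [AddCommGroup Y] [Module ℂ Y]
    (TA TB : (L × L × Y) →ₗ[ℂ] (L × L × Y)) (U Vv : L →ₗ[ℂ] L) (Γ : L →ₗ[ℂ] Y) (Wy : Y →ₗ[ℂ] Y) : Prop where
  h1 : ∀ a b y, (TA (a, b, y) + TB (a, b, y)).1 = U a
  h3 : ∀ a b y, (TA (a, b, y) + TB (a, b, y)).2.2 = Γ a + Wy y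
  h2 : ∀ b, TA (0, b, 0) + TB (0, b, 0) = (0, Vv b, 0)
  h4 : ∀ b, TA (0, b, 0) = (b, Vv b, 0)

lemma comb (A B : V →ₗ[ℂ] V) (α κ α' κ' : L →ₗ[ℂ] L) (μ ν μ' ν' : Y →ₗ[ℂ] L) (Γ : L →ₗ[ℂ] Y) (F : Y →ₗ[ℂ] Y) (β : ℂ)
    (hA : NFormA A α κ μ ν Γ F) (hB : NFormB B α' κ' μ' ν' β) (H : Y →ₗ[ℂ] L) (U Vv : L →ₗ[ℂ] L)
    (hUV : U + Vv = α + α' + H ∘ₗ Γ) :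
    ∃ (EA EB : (L × L × Y) ≃ₗ[ℂ] V) (TA TB : (L × L × Y) →ₗ[ℂ] (L × L × Y)),
      (∀ x, A (EA x) = EA (TA x)) ∧ (∀ x, B (EB x) = EB (TB x)) ∧ 
      Comb TA TB U Vv Γ (F + β • LinearMap.id - Γ ∘ₗ H) := by
  obtain ⟨E, hE⟩ := hA
  obtain ⟨E', hE'⟩ := hB
  let K : Y →ₗ[ℂ] L := - (α ∘ₗ H) + μ - H ∘ₗ Γ ∘ₗ H + H ∘ₗ F - α' ∘ₗ H + μ' + β • H
  let Q := shear H Vv K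
  let R := shear H (0 : L →ₗ[ℂ] L) (0 : Y →ₗ[ℂ] L)
  have hQ : ∀ a b y, Q (a, b, y) = (a - H y, b - Vv a - K y, y) := fun a b y => rfl
  have hR : ∀ a b y, R (a, b, y) = (a - H y, b - 0 - 0, y) := fun a b y => rfl
  have hQs : ∀ a b y, Q.symm (a, b, y) = (a + H y, b + Vv (a + H y) + K y, y) := fun a b y => rfl
  have hRs : ∀ a b y, R.symm (a, b, y) = (a + H y, b + 0 + 0, y) := fun a b y => rfl
  let EA := Q.trans E
  let EB := R.trans E'
  let TA : (L × L × Y) →ₗ[ℂ] (L × L × Y) := EA.symm.toLinearMap ∘ₗ A ∘ₗ EA.toLinearMap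
  let TB : (L × L × Y) →ₗ[ℂ] (L × L × Y) := EB.symm.toLinearMap ∘ₗ B ∘ₗ EB.toLinearMap
  have hTA : ∀ a b y, TA (a, b, y) = Q.symm (α (a - H y) + (b - Vv a - K y) + μ y, κ (a - H y) + ν y, Γ (a - H y) + F y) := by
    intro a b y
    show Q.symm (E.symm (A (E (Q (a, b, y))))) = _
    rw [hQ, hE, LinearEquiv.symm_apply_apply]
  have hTB : ∀ a b y, TB (a, b, y) = R.symm (α' (a - H y) - (b - 0 - 0) + μ' y, κ' (a - H y) + ν' y, β • y) := by
    intro a b y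
    show R.symm (E'.symm (B (E' (R (a, b, y))))) = _
    rw [hR, hE', LinearEquiv.symm_apply_apply]
  have hK : ∀ y, K y = - (α (H y)) + μ y - H (Γ (H y)) + H (F y) - α' (H y) + μ' y + β • H y := fun y => rfl
  have hU : ∀ a, U a = α a + α' a + H (Γ a) - Vv a := fun a => by
    have := LinearMap.congr_fun hUV a
    simp only [LinearMap.add_apply, LinearMap.comp_apply] at this
    rw [← this]; abel
  refine ⟨EA, EB, TA, TB, fun x => by simp [TA], fun x => by simp [TB], ?_, ?_, ?_, ?_⟩
  · intro a b y
    rw [hTA, hTB, hQs, hRs, Prod.mk_add_mk, hU, hK]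
    simp only [map_sub, map_add, map_smul]
    abel
  · intro a b y
    rw [hTA, hTB, hQs, hRs, Prod.mk_add_mk]
    simp only [map_sub, map_add, map_smul, Prod.mk_add_mk, LinearMap.sub_apply, LinearMap.add_apply, LinearMap.smul_apply,
      LinearMap.id_apply, LinearMap.comp_apply]
    abel
  · intro b
    rw [hTA, hTB, hQs, hRs]
    simp
  · intro b
    rw [hTA, hQs]
    simp

lemma comb_central [FiniteDimensional ℂ L] [FiniteDimensional ℂ Y]
    (TA TB : (L × L × Y) →ₗ[ℂ] (L × L × Y)) (U Vv : L →ₗ[ℂ] L) (Γ : L →ₗ[ℂ] Y) (Wy : Y →ₗ[ℂ] Y)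
    (hC : Comb TA TB U Vv Γ Wy) (hUV : ∀ μ, ¬ (Eig U μ ∧ Eig Vv μ)) (hUW : ∀ μ, ¬ (Eig U μ ∧ Eig Wy μ))
    (hWV : ∀ μ, ¬ (Eig Wy μ ∧ Eig Vv μ)) (hH : Hautus Wy Γ)
    (hz : ∀ Z : L →ₗ[ℂ] L, (∀ x, Z (U x) = U (Z x)) → (∀ x, Z (Vv x) = Vv (Z x)) → IsSc Z)
    (Z : (L × L × Y) →ₗ[ℂ] (L × L × Y)) (hZA : ∀ x, Z (TA x) = TA (Z x)) (hZB : ∀ x, Z (TB x) = TB (Z x)) : IsSc Z := by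
  obtain ⟨h1, h3, h2, h4⟩ := hC
  let S := TA + TB
  have hS : ∀ x, S x = TA x + TB x := fun x => rfl
  have hZS : ∀ x, S (Z x) = Z (S x) := fun x => by rw [hS, hS, map_add, hZA, hZB]
  replace h1 : ∀ x, (S x).1 = U x.1 := fun x => h1 x.1 x.2.1 x.2.2
  replace h3 : ∀ x, (S x).2.2 = Γ x.1 + Wy x.2.2 := fun x => h3 x.1 x.2.1 x.2.2
  replace h2 : ∀ b, S (0, b, 0) = (0, Vv b, 0) := h2
  let i1 : L →ₗ[ℂ] (L × L × Y) := LinearMap.inl ℂ _ _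
  let i2 : L →ₗ[ℂ] (L × L × Y) := LinearMap.inr ℂ _ _ ∘ₗ LinearMap.inl ℂ _ _
  let i3 : Y →ₗ[ℂ] (L × L × Y) := LinearMap.inr ℂ _ _ ∘ₗ LinearMap.inr ℂ _ _
  let p1 : (L × L × Y) →ₗ[ℂ] L := LinearMap.fst ℂ _ _
  let p2 : (L × L × Y) →ₗ[ℂ] L := LinearMap.fst ℂ _ _ ∘ₗ LinearMap.snd ℂ _ _
  let p3 : (L × L × Y) →ₗ[ℂ] Y := LinearMap.snd ℂ _ _ ∘ₗ LinearMap.snd ℂ _ _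
  have r12 : ∀ b, (Z (0, b, 0)).1 = 0 := by
    refine syl U Vv (p1 ∘ₗ Z ∘ₗ i2) ?_ hUV
    intro b
    show U (Z (0, b, 0)).1 = (Z (0, Vv b, 0)).1
    rw [← h1, hZS, h2]
  have r32 : ∀ b, (Z (0, b, 0)).2.2 = 0 := by
    refine syl Wy Vv (p3 ∘ₗ Z ∘ₗ i2) ?_ hWV
    intro b
    show Wy (Z (0, b, 0)).2.2 = (Z (0, Vv b, 0)).2.2
    have := h3 (Z (0, b, 0))
    rw [r12, map_zero, zero_add] at this
    rw [← this, hZS, h2]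
  have zb : ∀ b, Z (0, b, 0) = (0, (p2 ∘ₗ Z ∘ₗ i2) b, 0) := by
    intro b
    refine Prod.ext (r12 b) (Prod.ext rfl (r32 b))
  have r13 : ∀ y, (Z (0, 0, y)).1 = 0 := by
    refine syl U Wy (p1 ∘ₗ Z ∘ₗ i3) ?_ hUW
    intro y
    show U (Z (0, 0, y)).1 = (Z (0, 0, Wy y)).1
    have e : S (0, 0, y) = (0, 0, Wy y) + (0, (S (0, 0, y)).2.1, 0) := by
      have e1 := h1 (0, 0, y)
      have e3 := h3 (0, 0, y)
      simp only [map_zero, zero_add] at e1 e3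
      refine Prod.ext ?_ (Prod.ext ?_ ?_)
      · simpa using e1
      · simp
      · simpa using e3
    rw [← h1, hZS, e, map_add, Prod.fst_add, r12, add_zero]
  have za : ∀ x : L × L × Y, (Z x).1 = (p1 ∘ₗ Z ∘ₗ i1) x.1 := by
    rintro ⟨a, b, y⟩
    rw [triple, Prod.fst_add, Prod.fst_add, r12, r13, add_zero, add_zero]; rfl
  have zz : ∀ b, (p1 ∘ₗ Z ∘ₗ i1) b = (p2 ∘ₗ Z ∘ₗ i2) b := by
    intro b
    have e := hZA (0, b, 0)
    rw [h4, zb, h4] at e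
    have e1 := congrArg Prod.fst e
    rw [za] at e1
    exact e1
  obtain ⟨c, hc⟩ := hz (p1 ∘ₗ Z ∘ₗ i1) (by
      intro a
      have : U ((p1 ∘ₗ Z ∘ₗ i1) a) = (S (Z (a, 0, 0))).1 := by rw [h1]; rfl
      rw [this, hZS, za, h1]) (by
      intro b
      rw [zz, zz]
      have e := hZS (0, b, 0)
      rw [zb, h2, h2, zb] at e
      exact (congrArg (fun t => t.2.1) e).symm)
  refine ⟨c, ?_⟩
  let Z' := Z - c • LinearMap.id
  have hZ' : ∀ x, Z' x = Z x - c • x := fun x => rfl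
  have hb0 : ∀ b, Z' (0, b, 0) = 0 := by
    intro b
    rw [hZ', zb, ← zz, hc]; simp
  have hZ'S : ∀ x, S (Z' x) = Z' (S x) := fun x => by rw [hZ', hZ', map_sub, hZS, map_smul]
  have hZ'A : ∀ x, TA (Z' x) = Z' (TA x) := fun x => by rw [hZ', hZ', map_sub, hZA, map_smul]
  have ha0 : ∀ a, Z' (a, 0, 0) = 0 := by
    intro a
    have e := hZ'A (0, a, 0)
    rw [hb0, map_zero, h4, triple, hb0] at e
    have e0 : Z' ((0, 0, 0) : L × L × Y) = 0 := map_zero Z'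
    rw [e0, add_zero, add_zero] at e
    exact e.symm
  let M := Z' ∘ₗ i3
  have hM : ∀ x : L × L × Y, Z' x = M x.2.2 := by
    rintro ⟨a, b, y⟩
    rw [triple, ha0, hb0, zero_add, zero_add]; rfl
  have hMW : ∀ y, M (Wy y) = S (M y) := by
    intro y
    have : M y = Z' (0, 0, y) := rfl
    rw [this, hZ'S, hM, h3, map_zero, zero_add]
  have hMG : ∀ a, M (Γ a) = 0 := by
    intro a
    have e := hZ'S (a, 0, 0)
    rw [ha0, map_zero, hM, h3, map_zero, add_zero] at e
    exact e.symm
  have hM0 : ∀ y, M y = 0 := by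
    by_contra hne
    push Not at hne
    obtain ⟨y0, hy0⟩ := hne
    let T : LinearMap.range M →ₗ[ℂ] LinearMap.range M := S.restrict (by
      rintro _ ⟨y, rfl⟩; exact ⟨Wy y, hMW y⟩)
    have : Nontrivial (LinearMap.range M) := ⟨⟨⟨M y0, y0, rfl⟩, 0, fun h => hy0 (congrArg Subtype.val h)⟩⟩
    obtain ⟨μ, hμ⟩ := exists_eig T
    apply eig_not_surj T μ hμ
    rintro ⟨_, y, rfl⟩
    obtain ⟨z, l, hzl⟩ := hH μ y
    refine ⟨⟨M z, z, rfl⟩, Subtype.ext ?_⟩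
    rw [shift_apply]
    show S (M z) - μ • M z = M y
    rw [← hzl, map_add, hMG, map_sub, hMW, map_smul, add_zero]
  intro x
  have := hM x
  rw [hM0, hZ', sub_eq_zero] at this
  exact this

lemma comb_eig [FiniteDimensional ℂ L] [FiniteDimensional ℂ Y]
    (TA TB : (L × L × Y) →ₗ[ℂ] (L × L × Y)) (U Vv : L →ₗ[ℂ] L) (Γ : L →ₗ[ℂ] Y) (Wy : Y →ₗ[ℂ] Y)
    (hC : Comb TA TB U Vv Γ Wy) (μ : ℂ) (h : Eig U μ ∨ Eig Vv μ ∨ Eig Wy μ) : Eig (TA + TB) μ := by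
  obtain ⟨h1, h3, h2, h4⟩ := hC
  rcases h with h | h | h
  · exact eig_quot (TA + TB) U (LinearMap.fst ℂ L (L × Y)) LinearMap.fst_surjective 
      (fun x => h1 x.1 x.2.1 x.2.2) μ h
  · refine eig_sub (TA + TB) Vv (LinearMap.inr ℂ L (L × Y) ∘ₗ LinearMap.inl ℂ L Y) ?_ (fun x => h2 x) μ h
    rw [LinearMap.coe_comp]; exact LinearMap.inr_injective.comp LinearMap.inl_injective
  · let S' : (L × Y) →ₗ[ℂ] (L × Y) := LinearMap.prod (U ∘ₗ LinearMap.fst ℂ L Y) (Γ.coprod Wy)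
    refine eig_quot (TA + TB) S' (LinearMap.prodMap LinearMap.id (LinearMap.snd ℂ L Y)) ?_ ?_ μ ?_
    · rintro ⟨a, y⟩; exact ⟨(a, 0, y), rfl⟩
    · rintro ⟨a, b, y⟩
      exact Prod.ext (h1 a b y) (h3 a b y)
    · refine eig_sub S' Wy (LinearMap.inr ℂ L Y) LinearMap.inr_injective ?_ μ h
      intro y; simp [S']

lemma KD_sub [FiniteDimensional ℂ V] [FiniteDimensional ℂ W] [FiniteDimensional ℂ X] (T : V →ₗ[ℂ] V) (T' : W →ₗ[ℂ] W)
    (T1 : X →ₗ[ℂ] X) (i : X →ₗ[ℂ] V) (hi : Function.Injective i) (hT : ∀ x, T (i x) = i (T1 x))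
    (q : V →ₗ[ℂ] W) (h : ∀ x, q (T x) = T' (q x)) (hq : ∀ y, q y = 0 → ∃ z, y = i z) (μ : ℂ) :
    KD T μ ≤ KD T1 μ + KD T' μ := by
  refine (KD_le T T' q h μ).trans (Nat.add_le_add_right ?_ _)
  refine le_trans (Submodule.finrank_mono (t := (LinearMap.ker (sh T1 μ)).map i) ?_) (Submodule.finrank_map_le _ _)
  rintro y ⟨h1, h2⟩
  obtain ⟨z, rfl⟩ := hq y h1
  refine ⟨z, ?_, rfl⟩
  have h2 : sh T μ (i z) = 0 := h2
  rw [shift_apply, hT, ← map_smul, ← map_sub] at h2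
  show sh T1 μ z = 0
  rw [shift_apply]
  exact hi (h2.trans (map_zero i).symm)

lemma comb_KD [FiniteDimensional ℂ L] [FiniteDimensional ℂ Y]
    (TA TB : (L × L × Y) →ₗ[ℂ] (L × L × Y)) (U Vv : L →ₗ[ℂ] L) (Γ : L →ₗ[ℂ] Y) (Wy : Y →ₗ[ℂ] Y)
    (hC : Comb TA TB U Vv Γ Wy) (μ : ℂ) : KD (TA + TB) μ ≤ KD U μ + KD Vv μ + KD Wy μ := by
  obtain ⟨h1, h3, h2, h4⟩ := hC
  let S' : (L × Y) →ₗ[ℂ] (L × Y) := LinearMap.prod (U ∘ₗ LinearMap.fst ℂ L Y) (Γ.coprod Wy)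
  have a1 : KD (TA + TB) μ ≤ KD Vv μ + KD S' μ := by
    refine KD_sub (TA + TB) S' Vv (LinearMap.inr ℂ L (L × Y) ∘ₗ LinearMap.inl ℂ L Y) ?_ (fun x => h2 x)
      (LinearMap.prodMap LinearMap.id (LinearMap.snd ℂ L Y)) ?_ ?_ μ
    · rw [LinearMap.coe_comp]; exact LinearMap.inr_injective.comp LinearMap.inl_injective
    · rintro ⟨a, b, y⟩
      exact Prod.ext (h1 a b y) (h3 a b y)
    · rintro ⟨a, b, y⟩ h
      have h : (a, y) = 0 := h
      rw [Prod.mk_eq_zero] at h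
      exact ⟨b, by rw [h.1, h.2]; rfl⟩
  have a2 : KD S' μ ≤ KD Wy μ + KD U μ := by
    refine KD_sub S' U Wy (LinearMap.inr ℂ L Y) LinearMap.inr_injective ?_ (LinearMap.fst ℂ L Y) (fun x => rfl) ?_ μ
    · intro y; simp [S']
    · rintro ⟨a, y⟩ h
      have h : a = 0 := h
      exact ⟨y, by rw [h]; rfl⟩
  omega
end P7

section P8
variable {V W L X Y : Type} [AddCommGroup V] [Module ℂ V] [AddCommGroup W] [Module ℂ W]
  [AddCommGroup L] [Module ℂ L] [AddCommGroup X] [Module ℂ X] [AddCommGroup Y] [Module ℂ Y]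

def Sim {V : Type} [AddCommGroup V] [Module ℂ V] (A A' : V →ₗ[ℂ] V) : Prop :=
  ∃ g : V ≃ₗ[ℂ] V, ∀ x, A (g x) = g (A' x)

def PTc {V : Type} [AddCommGroup V] [Module ℂ V] (A B : V →ₗ[ℂ] V) {n : ℕ} (w : Fin n → ℂ) : Prop :=
  ∃ A' B', Sim A A' ∧ Sim B B' ∧ (∀ i, Eig (A' + B') (w i)) ∧ 
    ∀ Z : V →ₗ[ℂ] V, (∀ x, Z (A' x) = A' (Z x)) → (∀ x, Z (B' x) = B' (Z x)) → IsSc Z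

lemma Sim.refl (A : V →ₗ[ℂ] V) : Sim A A := ⟨LinearEquiv.refl ℂ V, fun x => rfl⟩

lemma PTc.symm (A B : V →ₗ[ℂ] V) {n : ℕ} (w : Fin n → ℂ) (h : PTc A B w) : PTc B A w := by
  obtain ⟨A', B', h1, h2, h3, h4⟩ := h
  refine ⟨B', A', h2, h1, ?_, fun Z hA hB => h4 Z hB hA⟩
  intro i; rw [add_comm]; exact h3 i

/-- transport from the model space -/
lemma comb_transport (A B : V →ₗ[ℂ] V) (TA TB : X →ₗ[ℂ] X) (EA EB : X ≃ₗ[ℂ] V) (hA : ∀ x, A (EA x) = EA (TA x))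
    (hB : ∀ x, B (EB x) = EB (TB x)) : ∃ B' : V →ₗ[ℂ] V, Sim B B' ∧ (∀ x, B' (EA x) = EA (TB x)) := by
  refine ⟨EA.toLinearMap ∘ₗ TB ∘ₗ EA.symm.toLinearMap, ⟨EA.symm.trans EB, fun x => ?_⟩, fun x => ?_⟩
  · simp [hB]
  · simp

lemma PTcore [FiniteDimensional ℂ V] [FiniteDimensional ℂ L] [FiniteDimensional ℂ Y] (m e : ℕ) 
    (hL : Module.finrank ℂ L = m) (hY : Module.finrank ℂ Y = e) (hm : 1 ≤ m)
    (A B : V →ₗ[ℂ] V) (α κ α' κ' : L →ₗ[ℂ] L) (μ ν μ' ν' : Y →ₗ[ℂ] L) (Γ : L →ₗ[ℂ] Y) (F : Y →ₗ[ℂ] Y) (β : ℂ)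
    (hA : NFormA A α κ μ ν Γ F) (hB : NFormB B α' κ' μ' ν' β) (hH : Hautus F Γ)
    (hc : m = 1 ∨ 1 ≤ e ∨ ¬ IsSc (α + α')) (w : Fin (m + m + e) → ℂ) (hw : Function.Injective w)
    (htr : LinearMap.trace ℂ V A + LinearMap.trace ℂ V B = ∑ i, w i) : PTc A B w := by
  obtain ⟨k, rfl⟩ : ∃ k, m = k + 1 := ⟨m - 1, by omega⟩
  let u : Fin (k+1) → ℂ := fun i => w (Fin.castAdd e (Fin.castAdd (k+1) i))
  let v : Fin (k+1) → ℂ := fun i => w (Fin.castAdd e (Fin.natAdd (k+1) i))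
  let z : Fin e → ℂ := fun i => w (Fin.natAdd (k+1+(k+1)) i)
  have hu : Function.Injective u := fun i j h => by
    have := hw h; simpa [Fin.ext_iff] using this
  have hv : Function.Injective v := fun i j h => by
    have := hw h; simpa [Fin.ext_iff] using this
  have hz : Function.Injective z := fun i j h => by
    have := hw h; simpa [Fin.ext_iff] using this
  have huv : ∀ i j, u i ≠ v j := fun i j h => by
    have := hw h; simp [Fin.ext_iff] at this; omega
  have huz : ∀ i j, u i ≠ z j := fun i j h => by
    have := hw h; simp [Fin.ext_iff] at this; omega
  have hvz : ∀ i j, v i ≠ z j := fun i j h => by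
    have := hw h; simp [Fin.ext_iff] at this; omega
  have hsum : ∑ i, w i = ∑ i, u i + ∑ i, v i + ∑ i, z i := by
    rw [Fin.sum_univ_add, Fin.sum_univ_add]
  have hH' : Hautus (F + β • LinearMap.id) Γ := by
    intro μ y
    obtain ⟨z, l, h⟩ := hH (μ - β) y
    refine ⟨z, l, ?_⟩
    rw [← h]; simp only [LinearMap.add_apply, LinearMap.smul_apply, LinearMap.id_apply, sub_smul]; abel
  have hHex : ∃ H : Y →ₗ[ℂ] L, (∀ i, Eig (F + β • LinearMap.id - Γ ∘ₗ H) (z i)) ∧ (k = 0 ∨ ¬ IsSc (α + α' + H ∘ₗ Γ)) := by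
    by_cases hk : k = 0
    · obtain ⟨H, h⟩ := pp e Y (F + β • LinearMap.id) Γ hY hH' z
      exact ⟨H, h, Or.inl hk⟩
    · by_cases he : 1 ≤ e
      · obtain ⟨H, h, h'⟩ := pp_nonsc e (F + β • LinearMap.id) Γ hY hH' z hz he (by omega) (α + α')
        exact ⟨H, h, Or.inr h'⟩
      · have hs : ¬ IsSc (α + α') := by
          rcases hc with h | h | h
          · omega
          · omega
          · exact h
        have : e = 0 := by omega
        subst this
        refine ⟨0, fun i => i.elim0, Or.inr ?_⟩
        rwa [LinearMap.zero_comp, add_zero]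
  obtain ⟨H, hHz, hHs⟩ := hHex
  have hWtr := distinct_trace e hY _ z hz hHz
  rw [map_sub, map_add, LinearMap.trace_comp_comm', trace_sc (β • LinearMap.id) β (by simp)] at hWtr
  have hAt := trace_NFA A α κ μ ν Γ F hA
  have hBt := trace_NFB B α' κ' μ' ν' β hB
  have htr2 : LinearMap.trace ℂ L (α + α' + H ∘ₗ Γ) = ∑ i, (u i + v i) := by
    rw [Finset.sum_add_distrib, map_add, map_add]
    rw [hsum, ← hWtr, hAt, hBt] at htr
    linear_combination htr
  obtain ⟨U, Vv, hUV, hUe, hVe, hcen⟩ := fillmore k L (α + α' + H ∘ₗ Γ) hL hHs u v hu hv htr2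
  obtain ⟨EA, EB, TA, TB, hEA, hEB, hC⟩ := comb A B α κ α' κ' μ ν μ' ν' Γ F β hA hB H U Vv hUV
  obtain ⟨B', hBB', hB'⟩ := comb_transport A B TA TB EA EB hEA hEB
  refine ⟨A, B', Sim.refl A, hBB', ?_, ?_⟩
  · have key : ∀ μ, Eig (TA + TB) μ → Eig (A + B') μ := by
      intro μ h
      refine eig_sub (A + B') (TA + TB) EA.toLinearMap EA.injective ?_ μ h
      intro x; simp [hEA, hB']
    intro i
    apply key
    apply comb_eig TA TB U Vv Γ _ hC
    refine Fin.addCases (fun i => ?_) (fun i => ?_) i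
    · refine Fin.addCases (fun i => ?_) (fun i => ?_) i
      · left; exact hUe i
      · right; left; exact hVe i
    · right; right; exact hHz i
  · intro Z hZA hZB
    have hsc : IsSc (EA.symm.toLinearMap ∘ₗ Z ∘ₗ EA.toLinearMap) := by
      refine comb_central TA TB U Vv Γ _ hC ?_ ?_ ?_ (hautus_fb _ _ H hH') hcen _ ?_ ?_
      · rintro μ ⟨h1, h2⟩
        obtain ⟨i, rfl⟩ := distinct_eig (k+1) hL U u hu hUe μ h1
        obtain ⟨j, hj⟩ := distinct_eig (k+1) hL Vv v hv hVe _ h2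
        exact huv i j hj
      · rintro μ ⟨h1, h2⟩
        obtain ⟨i, rfl⟩ := distinct_eig (k+1) hL U u hu hUe μ h1
        obtain ⟨j, hj⟩ := distinct_eig e hY _ z hz hHz _ h2
        exact huz i j hj
      · rintro μ ⟨h1, h2⟩
        obtain ⟨i, rfl⟩ := distinct_eig (k+1) hL Vv v hv hVe μ h2
        obtain ⟨j, hj⟩ := distinct_eig e hY _ z hz hHz _ h1
        exact hvz i j hj
      · intro x
        apply EA.injective
        simp only [LinearMap.comp_apply, LinearEquiv.coe_coe, LinearEquiv.apply_symm_apply, ← hEA]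
        rw [hZA]
      · intro x
        apply EA.injective
        simp only [LinearMap.comp_apply, LinearEquiv.coe_coe, LinearEquiv.apply_symm_apply, ← hB']
        rw [hZB]
    obtain ⟨c, hc⟩ := hsc
    refine ⟨c, fun x => ?_⟩
    have := congrArg EA (hc (EA.symm x))
    simpa using this

def NF2 {V L : Type} [AddCommGroup V] [Module ℂ V] [AddCommGroup L] [Module ℂ L] 
    (A : V →ₗ[ℂ] V) (α κ : L →ₗ[ℂ] L) : Prop :=
  ∃ E : (L × L) ≃ₗ[ℂ] V, ∀ a b, A (E (a, b)) = E (α a + b, κ a)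

def assoc0 (L : Type) [AddCommGroup L] [Module ℂ L] : (L × L × PUnit) ≃ₗ[ℂ] (L × L) where
  toFun x := (x.1, x.2.1)
  invFun x := (x.1, x.2, PUnit.unit)
  map_add' x y := rfl
  map_smul' c x := rfl
  left_inv x := rfl
  right_inv x := rfl

lemma NF2_A (A : V →ₗ[ℂ] V) (α κ : L →ₗ[ℂ] L) (h : NF2 A α κ) : NFormA (Y := PUnit) A α κ 0 0 0 0 := by
  obtain ⟨E, hE⟩ := h
  refine ⟨(assoc0 L).trans E, fun a b y => ?_⟩
  show A (E (a, b)) = E (α a + b + 0, κ a + 0)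
  rw [hE, add_zero, add_zero]

def negsnd (L : Type) [AddCommGroup L] [Module ℂ L] : (L × L) ≃ₗ[ℂ] (L × L) where
  toFun x := (x.1, -x.2)
  invFun x := (x.1, -x.2)
  map_add' x y := by ext <;> simp; abel
  map_smul' c x := by ext <;> simp
  left_inv x := by simp
  right_inv x := by simp

lemma NF2_B (A : V →ₗ[ℂ] V) (α κ : L →ₗ[ℂ] L) (h : NF2 A α κ) : NFormB (Y := PUnit) A α (-κ) 0 0 0 := by
  obtain ⟨E, hE⟩ := h
  refine ⟨((assoc0 L).trans (negsnd L)).trans E, fun a b y => ?_⟩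
  show A (E (a, -b)) = E (α a - b + 0, -(-κ a + 0))
  rw [hE, add_zero, add_zero, neg_neg, sub_eq_add_neg]

lemma NF2_exists [FiniteDimensional ℂ V] (m : ℕ) (hn : Module.finrank ℂ V = 2 * m) 
    (A : V →ₗ[ℂ] V) (h : ∀ μ, KD A μ ≤ m) : ∃ α κ : (Fin m → ℂ) →ₗ[ℂ] (Fin m → ℂ), NF2 A α κ := by
  obtain ⟨α, κ, μ, ν, Γ, F, ⟨E, hE⟩, _⟩ := nfA (2 * m) m 0 hn (by omega) A (fun μ => by have := h μ; omega)
  let E0 : ((Fin m → ℂ) × (Fin m → ℂ)) ≃ₗ[ℂ] ((Fin m → ℂ) × (Fin m → ℂ) × (Fin 0 → ℂ)) :=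
    { toFun := fun x => (x.1, x.2, 0)
      invFun := fun x => (x.1, x.2.1)
      map_add' := fun x y => by simp
      map_smul' := fun c x => by simp
      left_inv := fun x => rfl
      right_inv := fun x => Prod.ext rfl (Prod.ext rfl (Subsingleton.elim _ _)) }
  refine ⟨α, κ, E0.trans E, fun a b => ?_⟩
  show A (E (a, b, 0)) = E (α a + b, κ a, 0)
  rw [hE, map_zero, map_zero, add_zero, add_zero, Subsingleton.elim (Γ a + F 0) 0]

/-- conjugating the normal form by an automorphism of `L` -/
lemma NF2_conj (A : V →ₗ[ℂ] V) (α κ : L →ₗ[ℂ] L) (h : NF2 A α κ) (g : L ≃ₗ[ℂ] L) :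
    NF2 A (g.symm.toLinearMap ∘ₗ α ∘ₗ g.toLinearMap) (g.symm.toLinearMap ∘ₗ κ ∘ₗ g.toLinearMap) := by
  obtain ⟨E, hE⟩ := h
  refine ⟨(LinearEquiv.prodCongr g g).trans E, fun a b => ?_⟩
  show A (E (g a, g b)) = E (g (g.symm (α (g a)) + b), g (g.symm (κ (g a))))
  rw [hE]; simp

lemma nonsc_pair [FiniteDimensional ℂ L] (T : L →ₗ[ℂ] L) (h : ¬ IsSc T) : 
    ∃ (x : L) (φ : L →ₗ[ℂ] ℂ), x ≠ 0 ∧ φ x = 0 ∧ φ (T x) = 1 := by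
  obtain ⟨x, hx⟩ := nonsc_vec T h
  have hx0 : x ≠ 0 := hx.ne_zero 0
  obtain ⟨φ, h1, h2⟩ : ∃ φ : L →ₗ[ℂ] ℂ, T x ∉ LinearMap.ker φ ∧ Submodule.span ℂ {x} ≤ LinearMap.ker φ := by
    have hn : T x ∉ Submodule.span ℂ {x} := by
      intro hm
      obtain ⟨c, hc⟩ := Submodule.mem_span_singleton.mp hm
      rw [LinearIndependent.pair_iff] at hx
      have := hx c (-1) (by rw [hc]; simp)
      simpa using this.2
    obtain ⟨φ, h1, h2⟩ := Submodule.exists_le_ker_of_notMem hn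
    exact ⟨φ, h1, h2⟩
  have h3 : φ x = 0 := h2 (Submodule.mem_span_singleton_self x)
  have h1 : φ (T x) ≠ 0 := h1
  refine ⟨x, (φ (T x))⁻¹ • φ, hx0, by simp [h3], by simp [h1]⟩

lemma NF2_conj_nonsc [FiniteDimensional ℂ L] (A : V →ₗ[ℂ] V) (α κ α' : L →ₗ[ℂ] L) (h : NF2 A α κ) (hα : ¬ IsSc α) :
    ∃ α₁ κ₁ : L →ₗ[ℂ] L, NF2 A α₁ κ₁ ∧ ¬ IsSc (α₁ + α') := by
  by_cases hs : IsSc (α + α')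
  swap
  · exact ⟨α, κ, h, hs⟩
  obtain ⟨x, φ, hx, h0, h1⟩ := nonsc_pair α hα
  let N : L →ₗ[ℂ] L := φ.smulRight x
  have hN : ∀ y, N y = φ y • x := fun y => rfl
  have hNN : ∀ y, N (N y) = 0 := fun y => by rw [hN, hN, map_smul, h0]; simp
  let g : L ≃ₗ[ℂ] L := LinearEquiv.ofLinear (LinearMap.id + N) (LinearMap.id - N) 
    (by ext y; simp [hNN]) (by ext y; simp [hNN])
  have hg : ∀ y, g y = y + N y := fun y => rfl
  have hgs : ∀ y, g.symm y = y - N y := fun y => rfl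
  refine ⟨_, _, NF2_conj A α κ h g, ?_⟩
  rintro ⟨c, hc⟩
  obtain ⟨d, hd⟩ := hs
  -- evaluate at x and at α x through φ
  have e1 := hc x
  have e2 := hd x
  simp only [LinearMap.add_apply, LinearMap.comp_apply, LinearEquiv.coe_coe, hg, hgs, hN, h0, zero_smul, add_zero, h1, one_smul] at e1 e2
  have e3 : d - c = 1 := by
    have : (d - c - 1) • x = 0 := by
      rw [sub_smul, sub_smul, ← e1, ← e2, one_smul]; abel
    rcases smul_eq_zero.mp this with h | h
    · linear_combination h
    · exact absurd h hx
  have e4 := congrArg φ (hc (α x))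
  have e5 := congrArg φ (hd (α x))
  simp only [LinearMap.add_apply, LinearMap.comp_apply, LinearEquiv.coe_coe, hg, hgs, hN, h0, h1, one_smul, map_add, map_sub, map_smul,
    smul_eq_mul, mul_zero, mul_one, sub_zero, add_zero] at e4 e5
  have : (2 : ℂ) = 0 := by linear_combination e4 - e5 - e3
  norm_num at this

lemma NF2_improve [FiniteDimensional ℂ V] [FiniteDimensional ℂ L] (A : V →ₗ[ℂ] V) (κ : L →ₗ[ℂ] L) (γ : ℂ) 
    (h : NF2 A (γ • LinearMap.id) κ) (hκ : ¬ IsSc κ) : 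
    ∃ α₁ κ₁ : L →ₗ[ℂ] L, NF2 A α₁ κ₁ ∧ ¬ IsSc α₁ := by
  obtain ⟨x, φ, hx, h0, h1⟩ := nonsc_pair κ hκ
  obtain ⟨E, hE⟩ := h
  simp only [LinearMap.smul_apply, LinearMap.id_apply] at hE
  let P : (L × L) →ₗ[ℂ] (L × L) := 
    LinearMap.prod ((γ • φ.smulRight x + LinearMap.id).coprod (φ.smulRight x)) ((κ ∘ₗ φ.smulRight x).coprod LinearMap.id)
  have hP : ∀ a b, P (a, b) = (γ • φ a • x + a + φ b • x, κ (φ a • x) + b) := fun a b => rfl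
  have hinj : Function.Injective P := by
    rw [← LinearMap.ker_eq_bot, LinearMap.ker_eq_bot']
    rintro ⟨a, b⟩ hab
    rw [hP, Prod.mk_eq_zero] at hab
    obtain ⟨e1, e2⟩ := hab
    have f1 := congrArg φ e1
    have f2 := congrArg φ e2
    simp only [map_add, map_smul, smul_eq_mul, h0, h1, mul_zero, zero_add, add_zero, mul_one, map_zero] at f1 f2
    rw [f1] at e1 e2 f2
    simp only [zero_add] at f2
    rw [f2] at e1
    simp only [zero_smul, smul_zero, zero_add, add_zero, map_zero] at e1 e2
    rw [e1, e2]; rfl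
  let E' : (L × L) ≃ₗ[ℂ] V := (LinearEquiv.ofInjectiveEndo P hinj).trans E
  have hE' : ∀ a b, E' (a, b) = E (γ • φ a • x + a + φ b • x, κ (φ a • x) + b) := fun a b => rfl
  let T := E'.symm.toLinearMap ∘ₗ A ∘ₗ E'.toLinearMap
  have hT : ∀ a b, A (E' (a, b)) = E' (T (a, b)) := fun a b => by simp [T]
  have hTb : ∀ b, T (0, b) = (b, 0) := by
    intro b
    apply E'.injective
    rw [← hT, hE', hE', hE]
    simp
  let α₁ : L →ₗ[ℂ] L := LinearMap.fst ℂ L L ∘ₗ T ∘ₗ LinearMap.inl ℂ L L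
  let κ₁ : L →ₗ[ℂ] L := LinearMap.snd ℂ L L ∘ₗ T ∘ₗ LinearMap.inl ℂ L L
  have hTa : ∀ a, T (a, 0) = (α₁ a, κ₁ a) := fun a => rfl
  have hTab : ∀ a b, A (E' (a, b)) = E' (α₁ a + b, κ₁ a) := by
    intro a b
    rw [hT]
    have : ((a, b) : L × L) = (a, 0) + (0, b) := by simp
    rw [this, map_add, hTa, hTb]; simp
  refine ⟨α₁, κ₁, ⟨E', hTab⟩, ?_⟩
  rintro ⟨c, hc⟩
  have key : ∀ a, (γ • (γ • φ a • x + a) + κ (φ a • x), κ (γ • φ a • x + a)) =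
      (γ • φ (c • a) • x + c • a + φ (κ₁ a) • x, κ (φ (c • a) • x) + κ₁ a) := by
    intro a
    apply E.injective
    have := hTab a 0
    rw [hE', hE', hE, hc] at this
    simpa using this
  have k1 := fun a => congrArg Prod.fst (key a)
  have k2 := fun a => congrArg (fun t => φ t.2) (key a)
  simp only [map_add, map_smul, smul_eq_mul, h1, mul_one, smul_add] at k1 k2
  -- at x
  have a1 := k1 x
  have a2 := k2 x
  simp only [h0, h1, mul_zero, zero_smul, smul_zero, zero_add, add_zero] at a1 a2
  rw [← a2, one_smul] at a1
  have e3 : γ = c + 1 := by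
    have : (γ - c - 1) • x = 0 := by rw [sub_smul, sub_smul, a1, one_smul]; abel
    rcases smul_eq_zero.mp this with h | h
    · linear_combination h
    · exact absurd h hx
  have e4 := congrArg φ (k1 (κ x))
  simp only [map_add, map_smul, smul_eq_mul, h0, h1, mul_zero, mul_one, zero_add, add_zero] at e4
  have : (2 : ℂ) = 0 := by linear_combination e4 - e3
  norm_num at this
end P8

section P9
variable {V W L X Y : Type} [AddCommGroup V] [Module ℂ V] [AddCommGroup W] [Module ℂ W]
  [AddCommGroup L] [Module ℂ L] [AddCommGroup X] [Module ℂ X] [AddCommGroup Y] [Module ℂ Y]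

def IsRk {V : Type} [AddCommGroup V] [Module ℂ V] (T : V →ₗ[ℂ] V) (p : ℕ) : Prop :=
  (∀ μ, KD T μ + p ≤ Module.finrank ℂ V) ∧ ∃ μ, KD T μ + p = Module.finrank ℂ V

def cenS {V : Type} [AddCommGroup V] [Module ℂ V] (A : V →ₗ[ℂ] V) : Submodule ℂ (V →ₗ[ℂ] V) where
  carrier := {Z | ∀ x, A (Z x) = Z (A x)}
  add_mem' := by
    intro a b ha hb x
    rw [LinearMap.add_apply, LinearMap.add_apply, map_add, ha x, hb x]
  zero_mem' := by intro x; simp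
  smul_mem' := by
    intro c a ha x
    rw [LinearMap.smul_apply, LinearMap.smul_apply, map_smul, ha x]

def Bad {V : Type} [AddCommGroup V] [Module ℂ V] (A : V →ₗ[ℂ] V) (m : ℕ) : Prop :=
  (∃ l, m ≤ KD A l) ∧ 2 * m * m ≤ Module.finrank ℂ (cenS A)

lemma exists_root (γ k : ℂ) : ∃ l : ℂ, k = l * (l - γ) := by
  obtain ⟨s, hs⟩ := IsAlgClosed.exists_pow_nat_eq (γ ^ 2 / 4 + k) (n := 2) (by norm_num)
  refine ⟨γ / 2 + s, ?_⟩
  linear_combination -hs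

lemma NF2_bad [FiniteDimensional ℂ V] [FiniteDimensional ℂ L] (m : ℕ) (hL : Module.finrank ℂ L = m) (A : V →ₗ[ℂ] V) (γ k : ℂ)
    (h : NF2 A (γ • (LinearMap.id : L →ₗ[ℂ] L)) (k • (LinearMap.id : L →ₗ[ℂ] L))) : Bad A m := by
  obtain ⟨E, hE⟩ := h
  simp only [LinearMap.smul_apply, LinearMap.id_apply] at hE
  constructor
  · obtain ⟨l, hl⟩ := exists_root γ k
    refine ⟨l, ?_⟩
    let f : L →ₗ[ℂ] LinearMap.ker (sh A l) := 
      (E.toLinearMap ∘ₗ LinearMap.prod LinearMap.id ((l - γ) • LinearMap.id)).codRestrict _ (by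
        intro a
        show sh A l (E (a, (l - γ) • a)) = 0
        rw [shift_apply, hE, ← map_smul, ← map_sub, hl]
        convert map_zero E
        ext
        · simp [sub_smul]
        · simp [mul_smul])
    have hf : Function.Injective f := by
      intro a b hab
      have : E (a, (l - γ) • a) = E (b, (l - γ) • b) := congrArg Subtype.val hab
      exact congrArg Prod.fst (E.injective this)
    rw [← hL]
    exact LinearMap.finrank_le_finrank_of_injective hf
  · let G : ((L →ₗ[ℂ] L) × (L →ₗ[ℂ] L)) →ₗ[ℂ] (V →ₗ[ℂ] V) :=
      { toFun := fun X => E.toLinearMap ∘ₗ LinearMap.prod ((X.1 + γ • X.2).coprod X.2) ((k • X.2).coprod X.1) ∘ₗ E.symm.toLinearMap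
        map_add' := fun X X' => by
          apply LinearMap.ext; intro x
          simp only [LinearMap.comp_apply, LinearMap.add_apply, LinearEquiv.coe_coe, ← map_add]
          congr 1
          ext <;> simp <;> abel
        map_smul' := fun c X => by
          apply LinearMap.ext; intro x
          simp only [LinearMap.comp_apply, LinearMap.smul_apply, LinearEquiv.coe_coe, ← map_smul, RingHom.id_apply]
          congr 1
          ext <;> simp [smul_comm c] }
    have hG : ∀ X a b, G X (E (a, b)) = E (X.1 a + γ • X.2 a + X.2 b, k • X.2 a + X.1 b) := by
      intro X a b; simp [G]
    have hmem : ∀ X, G X ∈ cenS A := by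
      intro X x
      obtain ⟨⟨a, b⟩, rfl⟩ := E.surjective x
      rw [hG, hE, hE, hG]
      congr 1
      ext
      · simp only [map_add, map_smul, smul_add]; abel
      · simp only [map_add, map_smul, smul_add]; abel
    have hinj : Function.Injective (G.codRestrict (cenS A) hmem) := by
      rw [← LinearMap.ker_eq_bot, LinearMap.ker_eq_bot']
      intro X hX
      have hX : G X = 0 := congrArg Subtype.val hX
      have h0 : ∀ a b, X.1 a + γ • X.2 a + X.2 b = 0 ∧ k • X.2 a + X.1 b = 0 := by
        intro a b
        have := hG X a b
        rw [hX, LinearMap.zero_apply] at this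
        have := E.injective ((map_zero E).trans this)
        exact Prod.mk_eq_zero.mp this.symm
      have h2 : X.2 = 0 := by
        apply LinearMap.ext; intro b
        have := (h0 0 b).1
        simpa using this
      have h1 : X.1 = 0 := by
        apply LinearMap.ext; intro b
        have := (h0 0 b).2
        simpa using this
      exact Prod.ext h1 h2
    have := LinearMap.finrank_le_finrank_of_injective hinj
    rw [Module.finrank_prod, Module.finrank_linearMap, hL] at this
    nlinarith

lemma NF2_dich [FiniteDimensional ℂ V] (m : ℕ) (hn : Module.finrank ℂ V = 2 * m) 
    (A : V →ₗ[ℂ] V) (h : ∀ μ, KD A μ ≤ m) : 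
    (∃ α κ : (Fin m → ℂ) →ₗ[ℂ] (Fin m → ℂ), NF2 A α κ ∧ ¬ IsSc α) ∨ Bad A m := by
  obtain ⟨α, κ, h1⟩ := NF2_exists m hn A h
  by_cases hα : IsSc α
  swap
  · exact Or.inl ⟨α, κ, h1, hα⟩
  obtain ⟨γ, hγ⟩ := hα
  have e : α = γ • LinearMap.id := LinearMap.ext hγ
  rw [e] at h1
  by_cases hκ : IsSc κ
  swap
  · exact Or.inl (NF2_improve A κ γ h1 hκ)
  obtain ⟨k, hk⟩ := hκ
  have e' : κ = k • LinearMap.id := LinearMap.ext hk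
  rw [e'] at h1
  exact Or.inr (NF2_bad m (by simp) A γ k h1)

lemma PT_even_aux [FiniteDimensional ℂ V] (m : ℕ) (hm : 1 ≤ m) (hn : Module.finrank ℂ V = 2 * m) 
    (A B : V →ₗ[ℂ] V) (α κ : (Fin m → ℂ) →ₗ[ℂ] (Fin m → ℂ)) (hA : NF2 A α κ) (hα : ¬ IsSc α)
    (hB : ∀ μ, KD B μ ≤ m) (w : Fin (m + m + 0) → ℂ) (hw : Function.Injective w)
    (htr : LinearMap.trace ℂ V A + LinearMap.trace ℂ V B = ∑ i, w i) : PTc A B w := by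
  obtain ⟨α', κ', h2⟩ := NF2_exists m hn B hB
  obtain ⟨α₁, κ₁, h3, h4⟩ := NF2_conj_nonsc A α κ α' hA hα
  refine PTcore (L := Fin m → ℂ) (Y := PUnit) m 0 (by simp) Module.finrank_zero_of_subsingleton hm A B α₁ κ₁ α' (-κ') 0 0 0 0 0 0 0 
    (NF2_A A α₁ κ₁ h3) (NF2_B B α' κ' h2) ?_ (Or.inr (Or.inr h4)) w hw htr
  intro μ y; exact ⟨0, 0, Subsingleton.elim _ _⟩

lemma PT_even [FiniteDimensional ℂ V] (m : ℕ) (hm : 1 ≤ m) (hn : Module.finrank ℂ V = 2 * m) 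
    (A B : V →ₗ[ℂ] V) (hA : ∀ μ, KD A μ ≤ m)
    (hB : ∀ μ, KD B μ ≤ m) (w : Fin (m + m + 0) → ℂ) (hw : Function.Injective w)
    (htr : LinearMap.trace ℂ V A + LinearMap.trace ℂ V B = ∑ i, w i) : PTc A B w ∨ (Bad A m ∧ Bad B m) := by
  rcases NF2_dich m hn A hA with ⟨α, κ, h1, h2⟩ | hbA
  · exact Or.inl (PT_even_aux m hm hn A B α κ h1 h2 hB w hw htr)
  rcases NF2_dich m hn B hB with ⟨α, κ, h1, h2⟩ | hbB
  · refine Or.inl (PTc.symm _ _ _ (PT_even_aux m hm hn B A α κ h1 h2 hA w hw ?_))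
    rw [add_comm]; exact htr
  · exact Or.inr ⟨hbA, hbB⟩

lemma hautus_of_CK [FiniteDimensional ℂ Y] (F : Y →ₗ[ℂ] Y) (Γ : L →ₗ[ℂ] Y) (h : ∀ l, CK F Γ l = 0) : Hautus F Γ := by
  intro μ y
  have h1 := h μ
  unfold CK at h1
  rw [Module.finrank_zero_iff, Submodule.Quotient.subsingleton_iff] at h1
  have : y ∈ LinearMap.range (sh F μ) ⊔ LinearMap.range Γ := by rw [h1]; trivial
  obtain ⟨_, ⟨z, rfl⟩, _, ⟨l, rfl⟩, h⟩ := Submodule.mem_sup.mp this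
  exact ⟨z, l, by rw [← h, shift_apply]⟩

lemma PT_aux [FiniteDimensional ℂ V] (n : ℕ) (hn : Module.finrank ℂ V = n) (hn2 : 2 ≤ n)
    (P Q : V →ₗ[ℂ] V) (p q : ℕ) (hp : IsRk P p) (hq : IsRk Q q) (hpq : n ≤ p + q) (hqp : q ≤ p) (hq1 : 1 ≤ q) 
    (w : Fin n → ℂ) (hw : Function.Injective w)
    (htr : LinearMap.trace ℂ V P + LinearMap.trace ℂ V Q = ∑ i, w i) : 
    PTc P Q w ∨ ∃ m, n = 2 * m ∧ 2 ≤ m ∧ Bad P m ∧ Bad Q m := by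
  obtain ⟨hp1, hp2⟩ := hp
  obtain ⟨hq1', l, hl⟩ := hq
  rw [hn] at hp1 hq1' hl
  obtain ⟨m, hm⟩ : ∃ m, m = min q (n / 2) := ⟨_, rfl⟩
  obtain ⟨e, he⟩ : ∃ e, e = n - 2 * m := ⟨_, rfl⟩
  have hmn : n = m + m + e := by omega
  have hm1 : 1 ≤ m := by omega
  by_cases hcase : e = 0 ∧ 2 ≤ m
  · obtain ⟨rfl, hm2⟩ := hcase
    subst hmn
    rcases PT_even m hm1 (by omega) P Q (fun μ => by have := hp1 μ; omega) (fun μ => by have := hq1' μ; omega) w hw htr with h | h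
    · exact Or.inl h
    · exact Or.inr ⟨m, by omega, hm2, h⟩
  · left
    obtain ⟨α, κ, μ, ν, Γ, F, hA, hck⟩ := nfA n m e hn (by omega) P (fun μ => by have := hp1 μ; omega)
    obtain ⟨α', κ', μ', ν', β, hB⟩ := nfB n m e hn (by omega) Q (fun μ => by have := hq1' μ; omega) (by
      by_cases h : m = q
      · right; exact ⟨l, by omega⟩
      · left; omega)
    subst hmn
    refine PTcore (L := Fin m → ℂ) (Y := Fin e → ℂ) m e (by simp) (by simp) hm1 P Q α κ α' κ' μ ν μ' ν' Γ F β hA hB ?_ ?_ w hw htr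
    · apply hautus_of_CK
      intro l
      have h1 := hck l
      have h2 := hp1 l
      omega
    · by_cases h : m = 1
      · exact Or.inl h
      · right; left; omega

lemma PT [FiniteDimensional ℂ V] (n : ℕ) (hn : Module.finrank ℂ V = n) (hn2 : 2 ≤ n)
    (P Q : V →ₗ[ℂ] V) (p q : ℕ) (hp : IsRk P p) (hq : IsRk Q q) (hpq : n ≤ p + q) (hp1 : 1 ≤ p) (hq1 : 1 ≤ q) 
    (w : Fin n → ℂ) (hw : Function.Injective w)
    (htr : LinearMap.trace ℂ V P + LinearMap.trace ℂ V Q = ∑ i, w i) : 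
    PTc P Q w ∨ ∃ m, n = 2 * m ∧ 2 ≤ m ∧ Bad P m ∧ Bad Q m := by
  rcases le_total q p with h | h
  · exact PT_aux n hn hn2 P Q p q hp hq hpq h hq1 w hw htr
  · rcases PT_aux n hn hn2 Q P q p hq hp (by omega) h hp1 w hw (by rw [add_comm]; exact htr) with h | ⟨m, h1, h2, h3, h4⟩
    · exact Or.inl (PTc.symm _ _ _ h)
    · exact Or.inr ⟨m, h1, h2, h4, h3⟩

lemma KD_le_finrank [FiniteDimensional ℂ V] (T : V →ₗ[ℂ] V) (μ : ℂ) : KD T μ ≤ Module.finrank ℂ V := Submodule.finrank_le _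

lemma IsRk_exists [FiniteDimensional ℂ V] (T : V →ₗ[ℂ] V) : ∃ p, IsRk T p := by
  have hne : (Set.range (fun μ => Module.finrank ℂ V - KD T μ)).Nonempty := ⟨_, 0, rfl⟩
  obtain ⟨μ, hμ⟩ := Nat.sInf_mem hne
  refine ⟨sInf (Set.range (fun μ => Module.finrank ℂ V - KD T μ)), fun μ' => ?_, μ, ?_⟩
  · have := Nat.sInf_le (s := Set.range (fun μ => Module.finrank ℂ V - KD T μ)) ⟨μ', rfl⟩
    simp only at this
    have := KD_le_finrank T μ'
    omega
  · have := KD_le_finrank T μ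
    simp only at hμ
    omega

lemma MG_aux [FiniteDimensional ℂ V] (n : ℕ) (hn : Module.finrank ℂ V = n) (hn2 : 2 ≤ n)
    (P Q : V →ₗ[ℂ] V) (p q : ℕ) (hp : IsRk P p) (hq : IsRk Q q) (hqp : q ≤ p) (hq1 : 1 ≤ q) :
    ∃ Q', Sim Q Q' ∧ ∀ μ, KD (P + Q') μ ≤ max 1 (n - p - q) := by
  obtain ⟨hp1, hp2⟩ := hp
  obtain ⟨hq1', l, hl⟩ := hq
  rw [hn] at hp1 hq1' hl
  obtain ⟨m, hm⟩ : ∃ m, m = min q (n / 2) := ⟨_, rfl⟩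
  obtain ⟨e, he⟩ : ∃ e, e = n - 2 * m := ⟨_, rfl⟩
  have hmn : n = m + m + e := by omega
  have hm1 : 1 ≤ m := by omega
  obtain ⟨α, κ, μ, ν, Γ, F, hA, hck⟩ := nfA n m e hn (by omega) P (fun μ => by have := hp1 μ; omega)
  obtain ⟨α', κ', μ', ν', β, hB⟩ := nfB n m e hn (by omega) Q (fun μ => by have := hq1' μ; omega) (by
      by_cases h : m = q
      · right; exact ⟨l, by omega⟩
      · left; omega)
  obtain ⟨H, hH⟩ := ppg e (Fin e → ℂ) (F + β • LinearMap.id) Γ (by simp) ∅ Set.finite_empty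
  obtain ⟨U, Vv, hUV, hU, hV, hdis, hav⟩ := uvg m (Fin m → ℂ) (α + α' + H ∘ₗ Γ) (by simp) 
    {l | Eig (F + β • LinearMap.id - Γ ∘ₗ H) l} (eig_finite _)
  obtain ⟨EA, EB, TA, TB, hEA, hEB, hC⟩ := comb P Q α κ α' κ' μ ν μ' ν' Γ F β hA hB H U Vv hUV
  obtain ⟨B', hBB', hB'⟩ := comb_transport P Q TA TB EA EB hEA hEB
  refine ⟨B', hBB', fun l => ?_⟩
  have h1 : KD (P + B') l ≤ KD (TA + TB) l := by
    have := KD_sub (X := PUnit) (P + B') (TA + TB) 0 0 (fun a b _ => Subsingleton.elim _ _) (fun x => by simp) EA.symm.toLinearMap 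
      (by
        intro x
        obtain ⟨y, rfl⟩ := EA.surjective x
        simp [hEA, hB', ← map_add]) 
      (fun y hy => ⟨0, by simpa using hy⟩) l
    have h0 := KD_le_finrank (0 : PUnit →ₗ[ℂ] PUnit) l
    rw [Module.finrank_zero_of_subsingleton] at h0
    omega
  have h2 := comb_KD TA TB U Vv Γ _ hC l
  have h3 := (hH l).1
  have hckβ : CK (F + β • LinearMap.id) Γ l = CK F Γ (l - β) := by
    unfold CK
    have : sh (F + β • LinearMap.id) l = sh F (l - β) := by
      apply LinearMap.ext; intro x; simp only [shift_apply, LinearMap.add_apply, LinearMap.smul_apply, LinearMap.id_apply, sub_smul]; abel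
    rw [this]
  rw [hckβ] at h3
  have h4 := hck (l - β)
  have h5 := hp1 (l - β)
  have hbound : n - p - m ≤ max 1 (n - p - q) := by omega
  by_cases hW : Eig (F + β • LinearMap.id - Γ ∘ₗ H) l
  · obtain ⟨a, b⟩ := hav l hW
    rw [← KD_pos_iff] at a b
    omega
  · have hW0 : ¬ 0 < KD (F + β • LinearMap.id - Γ ∘ₗ H) l := by rwa [KD_pos_iff]
    by_cases hUe : Eig U l
    · have := hdis l hUe
      rw [← KD_pos_iff] at this
      have := hU l
      omega
    · rw [← KD_pos_iff] at hUe
      have := hV l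
      omega
end P9

section P10
variable {V W L X Y : Type} [AddCommGroup V] [Module ℂ V] [AddCommGroup W] [Module ℂ W]
  [AddCommGroup L] [Module ℂ L] [AddCommGroup X] [Module ℂ X] [AddCommGroup Y] [Module ℂ Y]

lemma Sim.trans (A A' A'' : V →ₗ[ℂ] V) (h : Sim A A') (h' : Sim A' A'') : Sim A A'' := by
  obtain ⟨g, hg⟩ := h
  obtain ⟨f, hf⟩ := h'
  exact ⟨f.trans g, fun x => by simp [hg, hf]⟩

def cj {V : Type} [AddCommGroup V] [Module ℂ V] (g : V ≃ₗ[ℂ] V) (A : V →ₗ[ℂ] V) : V →ₗ[ℂ] V :=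
  g.symm.toLinearMap ∘ₗ A ∘ₗ g.toLinearMap

lemma cj_sim (g : V ≃ₗ[ℂ] V) (A : V →ₗ[ℂ] V) : Sim A (cj g A) := ⟨g, fun x => by simp [cj]⟩

lemma cj_sum {ι : Type} (g : V ≃ₗ[ℂ] V) (s : Finset ι) (A : ι → V →ₗ[ℂ] V) :
    ∑ i ∈ s, cj g (A i) = cj g (∑ i ∈ s, A i) := by
  apply LinearMap.ext; intro x
  simp [cj, LinearMap.sum_apply, map_sum]

lemma cj_eq (g : V ≃ₗ[ℂ] V) (A A' : V →ₗ[ℂ] V) (h : ∀ x, A (g x) = g (A' x)) : cj g A = A' := by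
  apply LinearMap.ext; intro x
  simp [cj, h]

lemma IsRk_zero (T : V →ₗ[ℂ] V) [FiniteDimensional ℂ V] (h : IsRk T 0) : IsSc T := by
  obtain ⟨_, μ, hμ⟩ := h
  refine ⟨μ, fun x => ?_⟩
  have : LinearMap.ker (sh T μ) = ⊤ := Submodule.eq_top_of_finrank_eq (by rw [← hμ]; rfl)
  have hx : x ∈ LinearMap.ker (sh T μ) := by rw [this]; trivial
  rw [LinearMap.mem_ker, shift_apply, sub_eq_zero] at hx
  exact hx

lemma MG [FiniteDimensional ℂ V] (n : ℕ) (hn : Module.finrank ℂ V = n) (hn2 : 2 ≤ n)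
    (P Q : V →ₗ[ℂ] V) (p q : ℕ) (hp : IsRk P p) (hq : IsRk Q q) :
    ∃ P' Q', Sim P P' ∧ Sim Q Q' ∧ ∀ r, IsRk (P' + Q') r → min (n - 1) (p + q) ≤ r := by
  have sc : ∀ (P Q : V →ₗ[ℂ] V) (p q : ℕ) (hp : IsRk P p) (hq : IsRk Q q), q = 0 → 
      ∀ r, IsRk (P + Q) r → p ≤ r := by
    rintro P Q p q hp hq rfl r ⟨_, l, hr⟩
    obtain ⟨c, hc⟩ := IsRk_zero Q hq
    have : sh (P + Q) l = sh P (l - c) := by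
      apply LinearMap.ext; intro x
      simp only [shift_apply, LinearMap.add_apply, hc, sub_smul]; abel
    have h1 := hp.1 (l - c)
    unfold KD at h1 hr
    rw [this] at hr
    omega
  by_cases hq0 : q = 0
  · refine ⟨P, Q, Sim.refl P, Sim.refl Q, fun r hr => ?_⟩
    have := sc P Q p q hp hq hq0 r hr
    omega
  by_cases hp0 : p = 0
  · refine ⟨P, Q, Sim.refl P, Sim.refl Q, fun r hr => ?_⟩
    have := sc Q P q p hq hp hp0 r (by rwa [add_comm])
    omega
  rcases le_total q p with h | h
  · obtain ⟨Q', hQ, hk⟩ := MG_aux n hn hn2 P Q p q hp hq h (by omega)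
    refine ⟨P, Q', Sim.refl P, hQ, ?_⟩
    rintro r ⟨_, l, hr⟩
    have := hk l
    omega
  · obtain ⟨Q', hQ, hk⟩ := MG_aux n hn hn2 Q P q p hq hp h (by omega)
    refine ⟨Q', Q, hQ, Sim.refl Q, ?_⟩
    rintro r ⟨_, l, hr⟩
    have := hk l
    rw [add_comm] at hr
    rw [add_comm] at this
    omega

lemma MGF [FiniteDimensional ℂ V] (n : ℕ) (hn : Module.finrank ℂ V = n) (hn2 : 2 ≤ n) {ι : Type} [DecidableEq ι]
    (B : ι → V →ₗ[ℂ] V) (r : ι → ℕ) (hr : ∀ i, IsRk (B i) (r i)) (s : Finset ι) : 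
    ∃ B' : ι → V →ₗ[ℂ] V, (∀ i, Sim (B i) (B' i)) ∧ ∀ c, IsRk (∑ i ∈ s, B' i) c → min (n - 1) (∑ i ∈ s, r i) ≤ c := by
  induction s using Finset.induction_on with
  | empty => exact ⟨B, fun i => Sim.refl _, fun c _ => by simp⟩
  | insert a s ha ih =>
    obtain ⟨B', hB', hc⟩ := ih
    obtain ⟨c, hcr⟩ := IsRk_exists (∑ i ∈ s, B' i)
    have hcc := hc c hcr
    obtain ⟨P', Q', ⟨g, hg⟩, hQ, hPQ⟩ := MG n hn hn2 _ _ _ _ hcr (hr a)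
    refine ⟨fun i => if i = a then Q' else cj g (B' i), fun i => ?_, fun d hd => ?_⟩
    · by_cases h : i = a
      · subst h; simpa using hQ
      · simp only [h, if_false]
        exact Sim.trans _ _ _ (hB' i) (cj_sim g _)
    · rw [Finset.sum_insert ha] at hd ⊢
      have e : ∑ i ∈ s, (if i = a then Q' else cj g (B' i)) = P' := by
        rw [← cj_eq g _ _ hg, ← cj_sum]
        apply Finset.sum_congr rfl
        intro i hi
        rw [if_neg]; rintro rfl; exact ha hi
      rw [e, if_pos rfl, add_comm] at hd
      have := hPQ d hd
      omega

lemma cenS_sim [FiniteDimensional ℂ V] (A A' : V →ₗ[ℂ] V) (h : Sim A A') : 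
    Module.finrank ℂ (cenS A') ≤ Module.finrank ℂ (cenS A) := by
  obtain ⟨g, hg⟩ := h
  have hg' : ∀ x, A' (g.symm x) = g.symm (A x) := by
    intro x; apply g.injective; rw [← hg]; simp
  let f : cenS A' →ₗ[ℂ] cenS A := (g.conj.toLinearMap ∘ₗ (cenS A').subtype).codRestrict _ (by
    rintro ⟨Z, hZ⟩ x
    show A (g (Z (g.symm x))) = g (Z (g.symm (A x)))
    rw [hg, hZ, hg'])
  have hf : Function.Injective f := by
    intro a b hab
    have : g.conj a.1 = g.conj b.1 := congrArg Subtype.val hab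
    exact Subtype.ext (g.conj.injective this)
  exact LinearMap.finrank_le_finrank_of_injective hf

lemma IsRk_lt [FiniteDimensional ℂ V] [Nontrivial V] (T : V →ₗ[ℂ] V) (p : ℕ) (h : IsRk T p) : p + 1 ≤ Module.finrank ℂ V := by
  obtain ⟨μ, hμ⟩ := exists_eig T
  rw [← KD_pos_iff] at hμ
  have := h.1 μ
  omega

lemma IsRk_sim0 (A A' : V →ₗ[ℂ] V) (h : Sim A A') (hs : IsSc A) : IsSc A' := by
  obtain ⟨g, hg⟩ := h
  obtain ⟨c, hc⟩ := hs
  refine ⟨c, fun x => ?_⟩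
  apply g.injective
  rw [← hg, hc, map_smul]

lemma assembly [FiniteDimensional ℂ V] (n : ℕ) (hn : Module.finrank ℂ V = n) (hn2 : 2 ≤ n) {ι : Type} [DecidableEq ι] [Fintype ι]
    (B : ι → V →ₗ[ℂ] V) (r : ι → ℕ) (hr : ∀ i, IsRk (B i) (r i)) (hsum : n ≤ ∑ i, r i)
    (w : Fin n → ℂ) (hw : Function.Injective w) (htr : ∑ i, LinearMap.trace ℂ V (B i) = ∑ k, w k)
    (hα : ∀ (m : ℕ) (i j : ι), i ≠ j → n = 2 * m → 2 ≤ m → 2 * m * m ≤ Module.finrank ℂ (cenS (B i)) →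
      2 * m * m ≤ Module.finrank ℂ (cenS (B j)) → (∀ k, k ≠ i → k ≠ j → IsSc (B k)) → False) :
    ∃ B' : ι → V →ₗ[ℂ] V, (∀ i, Sim (B i) (B' i)) ∧ (∀ k, Eig (∑ i, B' i) (w k)) ∧
      ∀ Z : V →ₗ[ℂ] V, (∀ i x, Z (B' i x) = B' i (Z x)) → IsSc Z := by
  haveI : Nontrivial V := Module.nontrivial_of_finrank_pos (R := ℂ) (by omega)
  have hex : ∃ i, 0 < r i := by
    by_contra hc
    push Not at hc
    have : ∑ i, r i = 0 := Finset.sum_eq_zero (fun i _ => by have := hc i; omega)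
    omega
  obtain ⟨i0, hi0⟩ := hex
  obtain ⟨a, ha, hmin⟩ := Finset.exists_min_image (Finset.univ.filter (fun i => 0 < r i)) r ⟨i0, by simpa using hi0⟩
  have ha : 0 < r a := by simpa using ha
  have hmin : ∀ i, 0 < r i → r a ≤ r i := fun i hi => hmin i (by simpa using hi)
  have hsplit : r a + ∑ i ∈ Finset.univ.erase a, r i = ∑ i, r i := Finset.add_sum_erase _ _ (Finset.mem_univ a)
  have ra := IsRk_lt (B a) _ (hr a)
  rw [hn] at ra
  obtain ⟨B', hB', hc⟩ := MGF n hn hn2 B r hr (Finset.univ.erase a)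
  obtain ⟨C, hC⟩ : ∃ C, C = ∑ i ∈ Finset.univ.erase a, B' i := ⟨_, rfl⟩
  rw [← hC] at hc
  obtain ⟨c, hcr⟩ := IsRk_exists C
  have hcc := hc c hcr
  have htr' : LinearMap.trace ℂ V C + LinearMap.trace ℂ V (B a) = ∑ k, w k := by
    rw [← htr, ← Finset.sum_erase_add _ _ (Finset.mem_univ a), hC, map_sum]
    congr 1
    apply Finset.sum_congr rfl
    intro i _
    obtain ⟨g, hg⟩ := hB' i
    exact (trace_sim _ _ g hg).symm
  rcases PT n hn hn2 C (B a) c (r a) hcr (hr a) (by omega) (by omega) ha w hw htr' with h | ⟨m, hm, hm2, hbC, hbA⟩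
  · obtain ⟨C', M', ⟨g, hg⟩, hM, he, hz⟩ := h
    have e : ∑ i ∈ Finset.univ.erase a, (if i = a then M' else cj g (B' i)) = C' := by
      rw [← cj_eq g _ _ hg, hC, ← cj_sum]
      apply Finset.sum_congr rfl
      intro i hi
      rw [if_neg (Finset.ne_of_mem_erase hi)]
    refine ⟨fun i => if i = a then M' else cj g (B' i), fun i => ?_, fun k => ?_, fun Z hZ => ?_⟩
    · by_cases h : i = a
      · subst h; simpa using hM
      · simp only [h, if_false]
        exact Sim.trans _ _ _ (hB' i) (cj_sim g _)
    · rw [← Finset.sum_erase_add _ _ (Finset.mem_univ a), e, if_pos rfl]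
      exact he k
    · apply hz Z
      · intro x
        rw [← e, LinearMap.sum_apply, LinearMap.sum_apply, map_sum]
        exact Finset.sum_congr rfl (fun i _ => hZ i x)
      · intro x
        have := hZ a x
        simpa using this
  · exfalso
    obtain ⟨⟨l, hl⟩, hcC⟩ := hbC
    obtain ⟨⟨l', hl'⟩, hcA⟩ := hbA
    have h1 := hcr.1 l
    have h2 := (hr a).1 l'
    rw [hn] at h1 h2
    have h3 : ∑ i ∈ Finset.univ.erase a, r i = m := by omega
    have h4 : r a = m := by omega
    obtain ⟨b, hb, hb0⟩ : ∃ b ∈ Finset.univ.erase a, r b ≠ 0 := by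
      apply Finset.exists_ne_zero_of_sum_ne_zero; omega
    have h5 := hmin b (by omega)
    have h6 := Finset.add_sum_erase _ r hb
    have h7 : ∑ i ∈ (Finset.univ.erase a).erase b, r i = 0 := by omega
    have h8 : ∀ k, k ≠ a → k ≠ b → IsSc (B k) := by
      intro k hka hkb
      apply IsRk_zero
      have : r k = 0 := Finset.sum_eq_zero_iff.mp h7 k (by simp [hka, hkb])
      rw [← this]; exact hr k
    refine hα m a b (Finset.ne_of_mem_erase hb).symm hm hm2 hcA ?_ h8
    refine hcC.trans (le_trans (Submodule.finrank_mono ?_) (cenS_sim _ _ (hB' b)))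
    have hscal : ∃ d : ℂ, ∀ x, C x = B' b x + d • x := by
      have : ∀ k ∈ (Finset.univ.erase a).erase b, ∃ d : ℂ, ∀ x, B' k x = d • x := by
        intro k hk
        simp only [Finset.mem_erase, Finset.mem_univ, and_true] at hk
        exact IsRk_sim0 _ _ (hB' k) (h8 k hk.2 hk.1)
      choose! d hd using this
      refine ⟨∑ k ∈ (Finset.univ.erase a).erase b, d k, fun x => ?_⟩
      rw [hC, ← Finset.add_sum_erase _ _ hb, LinearMap.add_apply, LinearMap.sum_apply, Finset.sum_smul]
      congr 1
      exact Finset.sum_congr rfl (fun k hk => hd k hk x)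
    obtain ⟨d, hd⟩ := hscal
    intro Z hZ x
    have := hZ x
    rw [hd, hd, map_add, map_smul] at this
    exact add_right_cancel this
end P10

section P11

lemma rk_attain {n : ℕ} (Y : Matrix (Fin n) (Fin n) ℂ) :
    ∃ μ : ℂ, (Y - μ • (1 : Matrix (Fin n) (Fin n) ℂ)).rank = rk Y := by
  have := Nat.sInf_mem (s := Set.range (fun μ : ℂ => (Y - μ • (1 : Matrix (Fin n) (Fin n) ℂ)).rank)) ⟨_, ⟨0, rfl⟩⟩
  obtain ⟨μ, h⟩ := this
  exact ⟨μ, h⟩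

lemma rk_le {n : ℕ} (Y : Matrix (Fin n) (Fin n) ℂ) (μ : ℂ) :
    rk Y ≤ (Y - μ • (1 : Matrix (Fin n) (Fin n) ℂ)).rank :=
  Nat.sInf_le ⟨μ, rfl⟩

lemma sh_toLin {n : ℕ} (Y : Matrix (Fin n) (Fin n) ℂ) (μ : ℂ) :
    sh (Matrix.toLin' Y) μ = Matrix.toLin' (Y - μ • (1 : Matrix (Fin n) (Fin n) ℂ)) := by
  simp [sh, map_sub, map_smul]

lemma rank_KD {n : ℕ} (Y : Matrix (Fin n) (Fin n) ℂ) (μ : ℂ) :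
    KD (Matrix.toLin' Y) μ + (Y - μ • (1 : Matrix (Fin n) (Fin n) ℂ)).rank = n := by
  have := KD_rank (Matrix.toLin' Y) μ
  rw [sh_toLin] at this
  rw [Module.finrank_fin_fun] at this
  rw [add_comm]
  exact this

lemma IsRk_rk {n : ℕ} (Y : Matrix (Fin n) (Fin n) ℂ) : IsRk (Matrix.toLin' Y) (rk Y) := by
  constructor
  · intro μ
    rw [Module.finrank_fin_fun]
    have := rank_KD Y μ
    have := rk_le Y μ
    omega
  · obtain ⟨μ, h⟩ := rk_attain Y
    refine ⟨μ, ?_⟩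
    rw [Module.finrank_fin_fun, ← h]
    exact rank_KD Y μ

lemma centSub_finrank {n : ℕ} (Y : Matrix (Fin n) (Fin n) ℂ) :
    Module.finrank ℂ (centSub Y) = Module.finrank ℂ (cenS (Matrix.toLin' Y)) := by
  have : (cenS (Matrix.toLin' Y)) = (centSub Y).map (Matrix.toLin' : Matrix (Fin n) (Fin n) ℂ ≃ₗ[ℂ] _).toLinearMap := by
    ext Z
    constructor
    · intro h
      refine ⟨LinearMap.toMatrix' Z, ?_, by simp⟩
      show Y * _ = _ * Y
      apply Matrix.toLin'.injective
      ext1 x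
      rw [Matrix.toLin'_mul, Matrix.toLin'_mul]
      ext1
      simp only [Matrix.toLin'_toMatrix', LinearMap.comp_apply]
      rw [h _]
    · rintro ⟨W, hW, rfl⟩
      intro x
      have hW : Y * W = W * Y := hW
      have := congrArg (fun M => Matrix.toLin' M x) hW
      simpa [Matrix.toLin'_mul] using this
  rw [this]
  exact (LinearEquiv.finrank_map_eq _ _).symm

lemma dd_sc {n : ℕ} (Y : Matrix (Fin n) (Fin n) ℂ) (h : IsSc (Matrix.toLin' Y)) : dd Y = 0 := by
  obtain ⟨c, hc⟩ := h
  have : cenS (Matrix.toLin' Y) = ⊤ := by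
    rw [eq_top_iff]
    intro Z _ x
    rw [hc, hc, map_smul]
  unfold dd
  rw [centSub_finrank, this, finrank_top, Module.finrank_linearMap, Module.finrank_fin_fun]
  simp [sq]

lemma SameClass_of_Sim {n : ℕ} (Y : Matrix (Fin n) (Fin n) ℂ) (T : (Fin n → ℂ) →ₗ[ℂ] (Fin n → ℂ))
    (h : Sim (Matrix.toLin' Y) T) : SameClass (LinearMap.toMatrix' T) Y := by
  obtain ⟨g, hg⟩ := h
  have h1 : LinearMap.toMatrix' (g.symm : (Fin n → ℂ) →ₗ[ℂ] (Fin n → ℂ)) * LinearMap.toMatrix' (g : (Fin n → ℂ) →ₗ[ℂ] (Fin n → ℂ)) = 1 := by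
    rw [← LinearMap.toMatrix'_comp]; simp
  have h2 := mul_eq_one_comm.mp h1
  refine ⟨LinearMap.toMatrix' (g.symm : (Fin n → ℂ) →ₗ[ℂ] (Fin n → ℂ)), IsUnit.of_mul_eq_one _ h1, ?_⟩
  rw [Matrix.inv_eq_right_inv h1]
  have h3 : T = (g.symm : (Fin n → ℂ) →ₗ[ℂ] (Fin n → ℂ)) ∘ₗ (Matrix.toLin' Y) ∘ₗ (g : (Fin n → ℂ) →ₗ[ℂ] (Fin n → ℂ)) := by
    apply LinearMap.ext
    intro x
    simp only [LinearMap.comp_apply, LinearEquiv.coe_coe]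
    rw [hg, LinearEquiv.symm_apply_apply]
  conv_lhs => rw [h3, LinearMap.toMatrix'_comp, LinearMap.toMatrix'_comp, LinearMap.toMatrix'_toLin']
  rw [mul_assoc]

lemma Sim_of_eig {n : ℕ} (T T' : (Fin n → ℂ) →ₗ[ℂ] (Fin n → ℂ)) (w : Fin n → ℂ) (hw : Function.Injective w)
    (h : ∀ i, Eig T (w i)) (h' : ∀ i, Eig T' (w i)) : Sim T T' := by
  obtain ⟨b, hb⟩ := distinct_basis n (Module.finrank_fin_fun ℂ) T w hw h
  obtain ⟨b', hb'⟩ := distinct_basis n (Module.finrank_fin_fun ℂ) T' w hw h'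
  refine ⟨b'.equiv b (Equiv.refl _), fun x => ?_⟩
  have : T ∘ₗ (b'.equiv b (Equiv.refl _)).toLinearMap = (b'.equiv b (Equiv.refl _)).toLinearMap ∘ₗ T' := by
    apply b'.ext
    intro i
    simp [hb, hb']
  exact congrArg (fun f => f x) this

lemma cen_dist {n : ℕ} (T : (Fin n → ℂ) →ₗ[ℂ] (Fin n → ℂ)) (w : Fin n → ℂ) (hw : Function.Injective w)
    (h : ∀ i, Eig T (w i)) : n ≤ Module.finrank ℂ (cenS T) := by
  obtain ⟨b, hb⟩ := distinct_basis n (Module.finrank_fin_fun ℂ) T w hw h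
  let F : (Fin n → ℂ) →ₗ[ℂ] ((Fin n → ℂ) →ₗ[ℂ] (Fin n → ℂ)) :=
    { toFun := fun d => b.constr ℂ (fun i => d i • b i)
      map_add' := by intro d e; apply b.ext; intro i; rw [LinearMap.add_apply, b.constr_basis, b.constr_basis, b.constr_basis, Pi.add_apply, add_smul]
      map_smul' := by intro d e; apply b.ext; intro i; simp [Module.Basis.constr_basis, mul_smul] }
  have hF : ∀ d i, F d (b i) = d i • b i := fun d i => b.constr_basis ℂ _ i
  have hinj : Function.Injective F := by
    intro d e hde
    ext i
    have := hF d i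
    rw [hde, hF] at this
    exact (smul_left_injective ℂ (b.ne_zero i) this).symm
  have hr : LinearMap.range F ≤ cenS T := by
    rintro _ ⟨d, rfl⟩
    intro x
    have : T ∘ₗ F d = F d ∘ₗ T := by
      apply b.ext
      intro i
      simp only [LinearMap.comp_apply]
      rw [hF, hb, map_smul, map_smul, hb, hF, smul_comm]
    exact congrArg (fun f => f x) this
  have := Submodule.finrank_mono hr
  rw [LinearMap.finrank_range_of_inj hinj, Module.finrank_fin_fun] at this
  exact this

lemma suff (n p : ℕ) (hn : 2 ≤ n) 
    (B : Fin (p + 1) → Matrix (Fin n) (Fin n) ℂ)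
    (hdist : HasDistinctEigenvalues (B 0))
    (htrace : ∑ j, (B j).trace = 0)
    (hα : 2 * n ^ 2 - 2 ≤ ∑ j, dd (B j))
    (hβ : n ≤ ∑ i ∈ Finset.univ.erase 0, rk (B i)) :
    ∃ A : Fin (p + 1) → Matrix (Fin n) (Fin n) ℂ,
        (∀ j, SameClass (A j) (B j)) ∧ ∑ j, A j = 0 ∧ TrivialCentralizer A := by
  obtain ⟨μ, hμ, hchar⟩ := hdist
  have hfr : Module.finrank ℂ (Fin n → ℂ) = n := Module.finrank_fin_fun ℂ
  have heig : ∀ k, Eig (Matrix.toLin' (B 0)) (μ k) := by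
    intro k
    rw [eig_iff_hasEig, Module.End.hasEigenvalue_iff_isRoot_charpoly, Matrix.charpoly_toLin', hchar]
    rw [Polynomial.IsRoot, Polynomial.eval_prod]
    exact Finset.prod_eq_zero (Finset.mem_univ k) (by simp)
  have htr0 : (B 0).trace = ∑ k, μ k := by
    rw [← distinct_trace n hfr _ μ hμ heig, Matrix.trace_toLin'_eq]
  have hsumrk : ∑ i ∈ Finset.univ.erase 0, rk (B i) = ∑ i : Fin p, rk (B i.succ) := by
    have h1 := Finset.add_sum_erase Finset.univ (fun i => rk (B i)) (Finset.mem_univ 0)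
    have h2 := Fin.sum_univ_succ (fun i => rk (B i))
    omega
  obtain ⟨B', hB', hS, hZ⟩ := assembly n hfr hn (fun i : Fin p => Matrix.toLin' (B i.succ)) (fun i => rk (B i.succ))
    (fun i => IsRk_rk _) (by rw [← hsumrk]; exact hβ) (fun k => - μ k) (fun a b h => hμ (neg_injective h))
    (by
      simp only [Matrix.trace_toLin'_eq]
      rw [Fin.sum_univ_succ, htr0] at htrace
      rw [Finset.sum_neg_distrib]
      exact eq_neg_of_add_eq_zero_right htrace)
    (by
      intro m i j hij hnm hm hi hj hk
      rw [← centSub_finrank] at hi hj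
      have h0 := cen_dist _ μ hμ heig
      rw [← centSub_finrank] at h0
      have hz : ∀ k, k ≠ i → k ≠ j → dd (B k.succ) = 0 := fun k h1 h2 => dd_sc _ (hk k h1 h2)
      rw [Fin.sum_univ_succ, ← Finset.add_sum_erase Finset.univ _ (Finset.mem_univ i),
        ← Finset.add_sum_erase _ _ (Finset.mem_erase.mpr ⟨hij.symm, Finset.mem_univ j⟩),
        Finset.sum_eq_zero (s := (Finset.univ.erase i).erase j)
          (by intro k hk; simp only [Finset.mem_erase] at hk; exact hz k hk.2.1 hk.1)] at hα
      have e1 : dd (B 0) ≤ n^2 - n := by unfold dd; omega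
      have e2 : dd (B i.succ) ≤ n^2 - 2*m*m := by unfold dd; omega
      have e3 : dd (B j.succ) ≤ n^2 - 2*m*m := by unfold dd; omega
      have e4 : n^2 = 4*(m*m) := by rw [hnm]; ring
      have e5 : 2*m*m = 2*(m*m) := by ring
      have : 2 * m ≤ m*m := Nat.mul_le_mul_right m hm
      omega)
  refine ⟨Fin.cons (LinearMap.toMatrix' (-∑ i, B' i)) (fun i => LinearMap.toMatrix' (B' i)), ?_, ?_, ?_⟩
  · intro j
    refine Fin.cases ?_ (fun i => ?_) j
    · rw [Fin.cons_zero]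
      apply SameClass_of_Sim
      apply Sim_of_eig _ _ μ hμ heig
      intro k
      obtain ⟨x, h0, hx⟩ := hS k
      exact ⟨x, h0, by rw [LinearMap.neg_apply, hx, neg_smul, neg_neg]⟩
    · rw [Fin.cons_succ]
      exact SameClass_of_Sim _ _ (hB' i)
  · rw [Fin.sum_univ_succ]
    simp only [Fin.cons_zero, Fin.cons_succ, map_neg, map_sum]
    exact neg_add_cancel _
  · intro Z h
    obtain ⟨c, hc⟩ := hZ (Matrix.toLin' Z) (by
      intro i x
      have := h i.succ
      rw [Fin.cons_succ] at this
      have := congrArg (fun M => Matrix.toLin' M x) this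
      simpa [Matrix.toLin'_mul] using this)
    refine ⟨c, Matrix.toLin'.injective ?_⟩
    apply LinearMap.ext
    intro x
    rw [hc]; simp

end P11

section P12

lemma SameClass_symm {n : ℕ} (A B : Matrix (Fin n) (Fin n) ℂ) (h : SameClass A B) : SameClass B A := by
  obtain ⟨S, hS, rfl⟩ := h
  have hd := (Matrix.isUnit_iff_isUnit_det S).mp hS
  refine ⟨S⁻¹, (Matrix.isUnit_nonsing_inv_iff).mpr hS, ?_⟩
  rw [Matrix.nonsing_inv_nonsing_inv _ hd, mul_assoc, mul_assoc, Matrix.nonsing_inv_mul _ hd, mul_one, ← mul_assoc,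
    Matrix.nonsing_inv_mul _ hd, one_mul]

lemma rk_le_same {n : ℕ} (A B : Matrix (Fin n) (Fin n) ℂ) (h : SameClass A B) : rk A ≤ rk B := by
  obtain ⟨S, hS, rfl⟩ := h
  have hd := (Matrix.isUnit_iff_isUnit_det S).mp hS
  obtain ⟨μ, hμ⟩ := rk_attain B
  refine (rk_le _ μ).trans ?_
  have : S * B * S⁻¹ - μ • (1 : Matrix (Fin n) (Fin n) ℂ) = S * (B - μ • (1 : Matrix (Fin n) (Fin n) ℂ)) * S⁻¹ := by
    rw [mul_sub, sub_mul, Matrix.mul_smul, Matrix.smul_mul, mul_one, Matrix.mul_nonsing_inv _ hd]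
  rw [this, ← hμ]
  exact (Matrix.rank_mul_le_left _ _).trans (Matrix.rank_mul_le_right _ _)

lemma rk_same {n : ℕ} (A B : Matrix (Fin n) (Fin n) ℂ) (h : SameClass A B) : rk A = rk B :=
  le_antisymm (rk_le_same _ _ h) (rk_le_same _ _ (SameClass_symm _ _ h))

lemma dd_le_same {n : ℕ} (A B : Matrix (Fin n) (Fin n) ℂ) (h : SameClass A B) : dd A ≤ dd B := by
  obtain ⟨S, hS, rfl⟩ := h
  have hd := (Matrix.isUnit_iff_isUnit_det S).mp hS
  have hle : Module.finrank ℂ (centSub B) ≤ Module.finrank ℂ (centSub (S * B * S⁻¹)) := by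
    have hinv := Matrix.nonsing_inv_mul _ hd
    let F : Matrix (Fin n) (Fin n) ℂ →ₗ[ℂ] Matrix (Fin n) (Fin n) ℂ :=
      { toFun := fun Z => S * Z * S⁻¹
        map_add' := by intro x y; rw [mul_add, add_mul]
        map_smul' := by intro c x; simp }
    have hF : ∀ Z, F Z = S * Z * S⁻¹ := fun _ => rfl
    have hmul : ∀ X Y, F X * F Y = F (X * Y) := by
      intro X Y
      simp only [hF]
      calc S * X * S⁻¹ * (S * Y * S⁻¹) = S * X * (S⁻¹ * S) * Y * S⁻¹ := by noncomm_ring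
        _ = _ := by rw [hinv]; noncomm_ring
    have hinj : Function.Injective F := by
      intro X Y h
      have h : S * X * S⁻¹ = S * Y * S⁻¹ := h
      have e : ∀ X, S⁻¹ * (S * X * S⁻¹) * S = X := by
        intro X
        calc S⁻¹ * (S * X * S⁻¹) * S = (S⁻¹ * S) * X * (S⁻¹ * S) := by noncomm_ring
          _ = X := by rw [hinv]; simp
      rw [← e X, h, e]
    have := Submodule.finrank_mono (s := (centSub B).map F) (t := centSub (S * B * S⁻¹)) (by
      rintro _ ⟨Z, hZ, rfl⟩
      have hZ : B * Z = Z * B := hZ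
      show F B * F Z = F Z * F B
      rw [hmul, hmul, hZ])
    rwa [← (Submodule.equivMapOfInjective F hinj (centSub B)).finrank_eq] at this
  unfold dd
  omega

lemma dd_same {n : ℕ} (A B : Matrix (Fin n) (Fin n) ℂ) (h : SameClass A B) : dd A = dd B :=
  le_antisymm (dd_le_same _ _ h) (dd_le_same _ _ (SameClass_symm _ _ h))

lemma dd_range {n : ℕ} (A : Matrix (Fin n) (Fin n) ℂ) :
    dd A = Module.finrank ℂ (LinearMap.range (sylv A A)) := by
  have h := LinearMap.finrank_range_add_finrank_ker (sylv A A)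
  have h1 : LinearMap.ker (sylv A A) = centSub A := by
    ext Z
    show A * Z - Z * A = 0 ↔ A * Z = Z * A
    exact sub_eq_zero
  rw [h1, Module.finrank_matrix] at h
  simp only [Fintype.card_fin, Module.finrank_self, mul_one] at h
  unfold dd
  rw [sq]
  omega

lemma common_vec {n q : ℕ} (M : Fin q → Matrix (Fin n) (Fin n) ℂ) (h : ∑ i, (M i).rank < n) :
    ∃ v : Fin n → ℂ, v ≠ 0 ∧ ∀ i, (M i).mulVec v = 0 := by
  let F : (Fin n → ℂ) →ₗ[ℂ] (∀ i, LinearMap.range (M i).mulVecLin) :=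
    LinearMap.pi (fun i => (M i).mulVecLin.rangeRestrict)
  have hlt : Module.finrank ℂ (∀ i, LinearMap.range (M i).mulVecLin) < Module.finrank ℂ (Fin n → ℂ) := by
    rw [Module.finrank_pi_fintype, Module.finrank_fin_fun]
    exact h
  have := LinearMap.ker_ne_bot_of_finrank_lt (f := F) hlt
  obtain ⟨v, hv, h0⟩ := (Submodule.ne_bot_iff _).mp this
  refine ⟨v, h0, fun i => ?_⟩
  have := congrArg (fun f => ((f i : LinearMap.range (M i).mulVecLin) : Fin n → ℂ)) (LinearMap.mem_ker.mp hv)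
  simpa [F] using this

lemma beta_nec {n p : ℕ} (hn : 2 ≤ n) (A : Fin (p+1) → Matrix (Fin n) (Fin n) ℂ) (hs : ∑ j, A j = 0)
    (hc : TrivialCentralizer A) (j : Fin (p+1)) : n ≤ ∑ i ∈ Finset.univ.erase j, rk (A i) := by
  by_contra hlt
  push Not at hlt
  choose l hl using fun i => rk_attain (A i)
  let N : Fin (p+1) → Matrix (Fin n) (Fin n) ℂ := fun i => if i = j then 0 else A i - l i • 1
  have hNj : N j = 0 := by simp [N]
  have hNi : ∀ i, i ≠ j → N i = A i - l i • 1 := fun i hi => by simp [N, hi]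
  have hN : ∑ i, (N i).rank < n := by
    rw [← Finset.add_sum_erase _ _ (Finset.mem_univ j), hNj, Matrix.rank_zero, zero_add]
    refine lt_of_eq_of_lt (Finset.sum_congr rfl fun i hi => ?_) hlt
    rw [hNi i (Finset.ne_of_mem_erase hi), hl]
  obtain ⟨v, hv0, hv⟩ := common_vec N hN
  obtain ⟨w, hw0, hw⟩ := common_vec (fun i => (N i).transpose) (by simpa only [Matrix.rank_transpose] using hN)
  have hv1 : ∀ i, i ≠ j → (A i).mulVec v = l i • v := by
    intro i hi
    have := hv i
    rw [hNi i hi, Matrix.sub_mulVec, Matrix.smul_mulVec, Matrix.one_mulVec] at this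
    exact sub_eq_zero.mp this
  have hw1 : ∀ i, i ≠ j → Matrix.vecMul w (A i) = l i • w := by
    intro i hi
    have := hw i
    rw [Matrix.mulVec_transpose, hNi i hi, Matrix.vecMul_sub, Matrix.vecMul_smul, Matrix.vecMul_one] at this
    exact sub_eq_zero.mp this
  have hAj : A j = - ∑ i ∈ Finset.univ.erase j, A i := by
    rw [← Finset.add_sum_erase _ _ (Finset.mem_univ j)] at hs
    exact eq_neg_of_add_eq_zero_left hs
  have hcomm : ∀ i, i ≠ j → Matrix.vecMulVec v w * A i = A i * Matrix.vecMulVec v w := by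
    intro i hi
    rw [Matrix.vecMulVec_mul, Matrix.mul_vecMulVec, hv1 i hi, hw1 i hi, Matrix.vecMulVec_smul, Matrix.smul_vecMulVec]
  obtain ⟨c, hc⟩ := hc (Matrix.vecMulVec v w) (by
    intro i
    by_cases hi : i = j
    · rw [hi, hAj, mul_neg, neg_mul, Finset.mul_sum, Finset.sum_mul]
      congr 1
      exact Finset.sum_congr rfl fun k hk => hcomm k (Finset.ne_of_mem_erase hk)
    · exact hcomm i hi)
  obtain ⟨a, ha⟩ := Function.ne_iff.mp hv0
  obtain ⟨b, hb⟩ := Function.ne_iff.mp hw0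
  simp only [Pi.zero_apply] at ha hb
  have key : ∀ x y, v x * w y = if x = y then c else 0 := by
    intro x y
    have := congrFun (congrFun hc x) y
    simpa [Matrix.vecMulVec_apply, Matrix.one_apply] using this
  have hab : a = b := by
    by_contra h
    have := key a b
    rw [if_neg h] at this
    exact mul_ne_zero ha hb this
  subst hab
  have hcne : c ≠ 0 := by
    have := key a a
    rw [if_pos rfl] at this
    rw [← this]; exact mul_ne_zero ha hb
  haveI : Nontrivial (Fin n) := Fin.nontrivial_iff_two_le.mpr hn
  obtain ⟨x, hx⟩ := exists_ne a
  have h1 := key x a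
  rw [if_neg hx] at h1
  have h2 := key x x
  rw [if_pos rfl] at h2
  rcases mul_eq_zero.mp h1 with h | h
  · rw [h, zero_mul] at h2; exact hcne h2.symm
  · exact hb h

lemma trace_sylv {n : ℕ} (A X Q : Matrix (Fin n) (Fin n) ℂ) :
    (sylv A A X * Q).trace = (X * (Q * A - A * Q)).trace := by
  show ((A * X - X * A) * Q).trace = _
  rw [sub_mul, mul_sub, Matrix.trace_sub, Matrix.trace_sub, mul_assoc, Matrix.trace_mul_comm A, mul_assoc, mul_assoc]

lemma trace_nondeg {n : ℕ} (Q : Matrix (Fin n) (Fin n) ℂ) (h : ∀ X : Matrix (Fin n) (Fin n) ℂ, (X * Q).trace = 0) : Q = 0 := by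
  ext i j
  have := h (Matrix.single j i 1)
  simpa [Matrix.trace_single_mul] using this

noncomputable def tauM (n : ℕ) : Matrix (Fin n) (Fin n) ℂ →ₗ[ℂ] (Matrix (Fin n) (Fin n) ℂ →ₗ[ℂ] ℂ) where
  toFun Q := 
    { toFun := fun X => (X * Q).trace
      map_add' := by intro x y; rw [add_mul, Matrix.trace_add]
      map_smul' := by intro c x; simp }
  map_add' := by intro x y; ext1 X; simp [mul_add]
  map_smul' := by intro c x; ext1 X; simp

lemma tauM_apply (n : ℕ) (Q X : Matrix (Fin n) (Fin n) ℂ) : tauM n Q X = (X * Q).trace := rfl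

lemma tauM_surj (n : ℕ) : Function.Surjective (tauM n) := by
  have hi : Function.Injective (tauM n) := by
    rw [← LinearMap.ker_eq_bot, LinearMap.ker_eq_bot']
    intro Q hQ
    exact trace_nondeg Q (fun X => by rw [← tauM_apply, hQ]; rfl)
  exact (LinearMap.injective_iff_surjective_of_finrank_eq_finrank (Subspace.dual_finrank_eq).symm).mp hi

lemma alpha_nec {n p : ℕ} (hn : 2 ≤ n) (A : Fin (p+1) → Matrix (Fin n) (Fin n) ℂ) (hs : ∑ j, A j = 0)
    (hc : TrivialCentralizer A) : 2 * n^2 - 2 ≤ ∑ j, dd (A j) := by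
  let P := ∀ j, LinearMap.range (sylv (A j) (A j))
  let Φ : P →ₗ[ℂ] Matrix (Fin n) (Fin n) ℂ :=
    ∑ j, (LinearMap.range (sylv (A j) (A j))).subtype ∘ₗ LinearMap.proj j
  have hΦ : ∀ f : P, Φ f = ∑ j, (f j : Matrix (Fin n) (Fin n) ℂ) := by
    intro f; simp [Φ]; rfl
  have hP : Module.finrank ℂ P = ∑ j, dd (A j) := by
    rw [Module.finrank_pi_fintype]
    exact Finset.sum_congr rfl fun j _ => (dd_range _).symm
  have hM : Module.finrank ℂ (Matrix (Fin n) (Fin n) ℂ) = n^2 := by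
    rw [Module.finrank_matrix]; simp [sq]
  have hrn := LinearMap.finrank_range_add_finrank_ker Φ
  let Θ : Matrix (Fin n) (Fin n) ℂ →ₗ[ℂ] P := LinearMap.pi (fun j => (sylv (A j) (A j)).rangeRestrict)
  have hΘ : ∀ X j, ((Θ X j : LinearMap.range (sylv (A j) (A j))) : Matrix (Fin n) (Fin n) ℂ) = A j * X - X * A j := fun X j => rfl
  have hspan : Module.finrank ℂ (Submodule.span ℂ {(1 : Matrix (Fin n) (Fin n) ℂ)}) ≤ 1 :=
    (finrank_span_le_card _).trans (by simp)
  have hkT : Module.finrank ℂ (LinearMap.ker Θ) ≤ 1 := by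
    refine (Submodule.finrank_mono ?_).trans hspan
    intro X hX
    obtain ⟨c, rfl⟩ := hc X (by
      intro j
      have := hΘ X j
      rw [LinearMap.mem_ker.mp hX] at this
      exact (sub_eq_zero.mp this.symm).symm)
    exact Submodule.smul_mem _ _ (Submodule.mem_span_singleton_self _)
  have hrT := LinearMap.finrank_range_add_finrank_ker Θ
  have hle : Module.finrank ℂ (LinearMap.range Θ) ≤ Module.finrank ℂ (LinearMap.ker Φ) := by
    apply Submodule.finrank_mono
    rintro _ ⟨X, rfl⟩
    rw [LinearMap.mem_ker, hΦ]
    simp only [hΘ]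
    rw [Finset.sum_sub_distrib, ← Finset.sum_mul, ← Finset.mul_sum, hs]; simp
  have hann := Subspace.finrank_add_finrank_dualAnnihilator_eq (LinearMap.range Φ)
  have hann1 : Module.finrank ℂ (LinearMap.range Φ).dualAnnihilator ≤ 1 := by
    have : (LinearMap.range Φ).dualAnnihilator ≤ (Submodule.span ℂ {(1 : Matrix (Fin n) (Fin n) ℂ)}).map (tauM n) := by
      intro φ hφ
      obtain ⟨Q, rfl⟩ := tauM_surj n φ
      refine ⟨Q, ?_, rfl⟩
      obtain ⟨c, rfl⟩ := hc Q (by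
        intro j
        apply sub_eq_zero.mp
        apply trace_nondeg
        intro X
        rw [← trace_sylv, ← tauM_apply]
        apply (Submodule.mem_dualAnnihilator _).mp hφ
        refine ⟨Pi.single j ⟨sylv (A j) (A j) X, X, rfl⟩, ?_⟩
        rw [hΦ, Finset.sum_eq_single j]
        · simp
        · intro b _ hb
          rw [Pi.single_eq_of_ne hb]; rfl
        · simp)
      exact Submodule.smul_mem _ _ (Submodule.mem_span_singleton_self _)
    exact (Submodule.finrank_mono this).trans ((Submodule.finrank_map_le _ _).trans hspan)
  rw [hM] at hann hrT
  omega

end P12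

theorem stmt7 (n p : ℕ) (hn : 2 ≤ n) (hp : 1 ≤ p)
    (B : Fin (p + 1) → Matrix (Fin n) (Fin n) ℂ)
    (hdist : HasDistinctEigenvalues (B 0))
    (htrace : ∑ j, (B j).trace = 0) :
    (∃ A : Fin (p + 1) → Matrix (Fin n) (Fin n) ℂ,
        (∀ j, SameClass (A j) (B j)) ∧ ∑ j, A j = 0 ∧ TrivialCentralizer A) ↔
      ((2 * n ^ 2 - 2 ≤ ∑ j, dd (B j)) ∧
        ∀ j, n ≤ ∑ i ∈ Finset.univ.erase j, rk (B i)) := by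
  constructor
  · rintro ⟨A, hA, hs, hc⟩
    constructor
    · have := alpha_nec hn A hs hc
      rwa [Finset.sum_congr rfl fun j _ => dd_same _ _ (hA j)] at this
    · intro j
      have := beta_nec hn A hs hc j
      rwa [Finset.sum_congr rfl fun j _ => rk_same _ _ (hA j)] at this
  · rintro ⟨h1, h2⟩
    exact suff n p hn B hdist htrace h1 (h2 0)
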